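/- There exists a universal constant c > 0 with the following property. For every k ≥ 1 and every polynomial Q ∈ ℝ[X_1,…,X_k] of degree at most d, each connected component C of the real algebraic set Z(Q,ℝ^k) = {x ∈ ℝ^k : Q(x) = 0} can be written as a finite union of realizations of sign conditions on some finite family A ⊆ ℝ[X_1,…,X_k] of polynomials, each of degree at most (c·d)^{k²}. -/

import Mathlib

open MvPolynomial Set

/-- The realization `R(σ)` of a sign condition `σ` on the finite family of polynomials
`A = (A 0, …, A (n-1))` in `ℝ[X_1,…,X_k]`. -/
def signRealization {k n : ℕ} (A : Fin n → MvPolynomial (Fin k) ℝ)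
    (σ : Fin n → SignType) : Set (Fin k → ℝ) :=
  {x | ∀ i, SignType.sign (eval x (A i)) = σ i}

section RealRooted

open Polynomial

theorem signVariations_congr {p q : ℝ[X]}
    (h : ∀ n, SignType.sign (p.coeff n) = SignType.sign (q.coeff n)) :
    p.signVariations = q.signVariations := by
  have hz : ∀ n, p.coeff n = 0 ↔ q.coeff n = 0 := fun n => by
    rw [← sign_eq_zero_iff, h n, sign_eq_zero_iff]
  have hdeg : p.degree = q.degree := by
    have hs : p.support = q.support := by
      ext n
      simp [hz n]
    simp [Polynomial.degree, hs]
  have hl : p.coeffList.map SignType.sign = q.coeffList.map SignType.sign := by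
    simp only [coeffList, hdeg, List.map_map]
    exact List.map_congr_left fun n _ => h n
  unfold signVariations
  simp only [hl]

theorem coeff_comp_neg_X (p : ℝ[X]) (n : ℕ) :
    (p.comp (-Polynomial.X)).coeff n = (-1) ^ n * p.coeff n := by
  have := comp_C_mul_X_coeff (p := p) (r := (-1 : ℝ)) (n := n)
  rw [mul_comm, ← this]
  simp

theorem sign_leadingCoeff_comp_neg_X (p : ℝ[X]) :
    (p.comp (-Polynomial.X)).leadingCoeff = (-1) ^ p.natDegree * p.leadingCoeff := by
  have : (p.comp (-Polynomial.X)).natDegree = p.natDegree := by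
    rw [natDegree_comp]; simp
  rw [leadingCoeff, this, coeff_comp_neg_X, leadingCoeff]

theorem eraseLead_comp_neg_X (p : ℝ[X]) :
    (p.comp (-Polynomial.X)).eraseLead = p.eraseLead.comp (-Polynomial.X) := by
  have : (p.comp (-Polynomial.X)).natDegree = p.natDegree := by
    rw [natDegree_comp]; simp
  ext n
  simp only [eraseLead_coeff, coeff_comp_neg_X, this]
  split_ifs <;> simp

theorem signVariations_add_comp_neg_X_le (p : ℝ[X]) (hp : p ≠ 0) :
    p.signVariations + (p.comp (-Polynomial.X)).signVariations + p.natTrailingDegree ≤ p.natDegree := by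
  induction hc : p.support.card using Nat.strong_induction_on generalizing p with
  | _ c ih =>
  have hp' : p.comp (-Polynomial.X) ≠ 0 := by
    intro h
    apply hp
    ext n
    have := congrArg (fun r => Polynomial.coeff r n) h
    simpa [coeff_comp_neg_X] using this
  rw [signVariations_eq_eraseLead_add_ite hp, signVariations_eq_eraseLead_add_ite hp',
    eraseLead_comp_neg_X, sign_leadingCoeff_comp_neg_X, sign_leadingCoeff_comp_neg_X]
  by_cases h0 : p.eraseLead = 0
  · have hl : p.leadingCoeff ≠ 0 := leadingCoeff_ne_zero.mpr hp
    have hl' : (-1) ^ p.natDegree * p.leadingCoeff ≠ 0 := by simp [hl]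
    have h1 : SignType.sign p.leadingCoeff ≠ 0 := by simpa using hl
    simp only [h0, zero_comp, signVariations_zero, leadingCoeff_zero, sign_zero, neg_zero,
      mul_zero, sign_eq_zero_iff, hl, hl', if_false]
    simpa using natTrailingDegree_le_natDegree p
  · have hlt : p.eraseLead.support.card < c := hc ▸ eraseLead_support_card_lt hp
    have h1 := ih _ hlt _ h0 rfl
    have hd : p.eraseLead.natDegree < p.natDegree :=
      eraseLead_natDegree_lt_or_eraseLead_eq_zero p |>.resolve_right h0
    have ht : p.eraseLead.natTrailingDegree = p.natTrailingDegree := by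
      apply le_antisymm
      · apply natTrailingDegree_le_of_ne_zero
        rw [eraseLead_coeff_of_ne]
        · exact trailingCoeff_nonzero_iff_nonzero.mpr hp
        · intro h
          have h2 : p.natTrailingDegree ≤ p.eraseLead.natTrailingDegree := by
            apply natTrailingDegree_le_of_ne_zero
            intro h3
            have := trailingCoeff_nonzero_iff_nonzero.mpr h0
            apply this
            rw [trailingCoeff, eraseLead_coeff, h3]; simp
          have := natTrailingDegree_le_natDegree p.eraseLead
          omega
      · apply natTrailingDegree_le_of_ne_zero
        intro h3
        apply trailingCoeff_nonzero_iff_nonzero.mpr h0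
        rw [trailingCoeff, eraseLead_coeff, h3]; simp
    obtain ⟨k, hk⟩ := Nat.exists_eq_add_of_lt hd
    have hsl : SignType.sign p.leadingCoeff ≠ 0 := by simpa using hp
    have hse : SignType.sign p.eraseLead.leadingCoeff ≠ 0 := by simpa using h0
    have hpow : SignType.sign ((-1 : ℝ) ^ p.natDegree) =
        SignType.sign ((-1 : ℝ) ^ p.eraseLead.natDegree) * (-1) ^ (k + 1) := by
      rw [hk, show p.eraseLead.natDegree + k + 1 = p.eraseLead.natDegree + (k + 1) from rfl,
        pow_add, sign_mul, sign_pow (-1 : ℝ) (k + 1)]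
      simp
    have hm : SignType.sign ((-1 : ℝ) ^ p.eraseLead.natDegree) ≠ 0 := by simp
    rw [sign_mul, sign_mul, hpow]
    have key : (if SignType.sign p.leadingCoeff = -SignType.sign p.eraseLead.leadingCoeff
        then 1 else 0) + (if SignType.sign ((-1 : ℝ) ^ p.eraseLead.natDegree) * (-1) ^ (k + 1) *
          SignType.sign p.leadingCoeff = -(SignType.sign ((-1 : ℝ) ^ p.eraseLead.natDegree) *
          SignType.sign p.eraseLead.leadingCoeff) then 1 else 0) ≤ k + 1 := by
      generalize SignType.sign p.leadingCoeff = a at *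
      generalize SignType.sign p.eraseLead.leadingCoeff = b at *
      generalize SignType.sign ((-1 : ℝ) ^ p.eraseLead.natDegree) = e at *
      rcases Nat.eq_zero_or_pos k with rfl | hk0
      · clear h1 hpow
        revert a b e
        decide
      · split_ifs <;> omega
    rw [ht] at h1
    omega

theorem countP_add_countP_add_count (s : Multiset ℝ) :
    s.countP (0 < ·) + s.countP (· < 0) + s.count 0 = s.card := by
  induction s using Multiset.induction with
  | empty => simp
  | cons a s ih =>
    rcases lt_trichotomy a 0 with h | h | h
    · simp [h, h.not_gt, h.ne']; omega
    · simp [h]; omega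
    · simp [h, h.not_gt, h.ne]; omega

theorem roots_countP_neg_le (p : ℝ[X]) :
    p.roots.countP (· < 0) ≤ (p.comp (-Polynomial.X)).signVariations := by
  refine le_trans (le_of_eq ?_) (roots_countP_pos_le_signVariations _)
  rw [roots_comp_neg_X, Multiset.countP_map, ← Multiset.countP_eq_card_filter]
  exact Multiset.countP_congr rfl fun x _ => by simp

/-- For a polynomial with only real roots, Descartes' rule of signs is exact. -/
theorem countP_pos_roots_eq_signVariations {p : ℝ[X]} (hp : p ≠ 0)
    (hs : p.roots.card = p.natDegree) :
    p.roots.countP (0 < ·) = p.signVariations ∧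
      p.roots.countP (· < 0) = (p.comp (-Polynomial.X)).signVariations := by
  have h1 := roots_countP_pos_le_signVariations p
  have h2 := roots_countP_neg_le p
  have h3 := signVariations_add_comp_neg_X_le p hp
  have h4 := countP_add_countP_add_count p.roots
  rw [count_roots, rootMultiplicity_eq_natTrailingDegree'] at h4
  omega

theorem countP_roots_congr {p q : ℝ[X]} (hp : p ≠ 0) (hq : q ≠ 0)
    (hps : p.roots.card = p.natDegree) (hqs : q.roots.card = q.natDegree)
    (h : ∀ n, SignType.sign (p.coeff n) = SignType.sign (q.coeff n)) :
    p.roots.countP (0 < ·) = q.roots.countP (0 < ·) ∧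
      p.roots.countP (· < 0) = q.roots.countP (· < 0) := by
  obtain ⟨a, b⟩ := countP_pos_roots_eq_signVariations hp hps
  obtain ⟨c, d⟩ := countP_pos_roots_eq_signVariations hq hqs
  rw [a, b, c, d, signVariations_congr h]
  refine ⟨rfl, signVariations_congr fun n => ?_⟩
  rw [coeff_comp_neg_X, coeff_comp_neg_X, sign_mul, sign_mul, h n]

end RealRooted

section Signature

variable {ι : Type*} [Fintype ι] [DecidableEq ι]

theorem toQuadraticForm'_apply (H : Matrix ι ι ℝ) (f : ι → ℝ) :
    H.toQuadraticForm' f = ∑ i, ∑ j, H i j * (f i * f j) := by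
  simp only [Matrix.toQuadraticForm', LinearMap.BilinMap.toQuadraticMap_apply,
    Matrix.toLinearMap₂'_apply, smul_eq_mul]
  exact Finset.sum_congr rfl fun i _ => Finset.sum_congr rfl fun j _ => by ring

theorem toQuadraticForm'_eq_dotProduct (H : Matrix ι ι ℝ) (f : ι → ℝ) :
    H.toQuadraticForm' f = f ⬝ᵥ (H.mulVec f) := by
  simp only [toQuadraticForm'_apply, dotProduct, Matrix.mulVec, Finset.mul_sum]
  exact Finset.sum_congr rfl fun i _ => Finset.sum_congr rfl fun j _ => by ring

theorem equivalent_weightedSumSquares_eigenvalues {H : Matrix ι ι ℝ} (hH : H.IsHermitian) :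
    QuadraticMap.Equivalent (H.toQuadraticForm')
      (QuadraticMap.weightedSumSquares ℝ hH.eigenvalues) := by
  set U : Matrix ι ι ℝ := (hH.eigenvectorUnitary : Matrix ι ι ℝ) with hU
  have h1 : U * star U = 1 := Unitary.mul_star_self_of_mem hH.eigenvectorUnitary.2
  have h2 : star U * U = 1 := Unitary.star_mul_self_of_mem hH.eigenvectorUnitary.2
  refine QuadraticMap.Equivalent.symm ⟨⟨Matrix.toLin'OfInv (M := star U) (M' := U) h2 h1, ?_⟩⟩
  intro f
  have hspec : star U * H * U = Matrix.diagonal hH.eigenvalues := by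
    have := hH.conjStarAlgAut_star_eigenvectorUnitary
    rw [Unitary.conjStarAlgAut_star_apply] at this
    simpa [hU] using this
  have hst : star U = U.transpose := by
    simp [Matrix.star_eq_conjTranspose]
  have hU' : (Matrix.toLin'OfInv (M := star U) (M' := U) h2 h1) f = U.mulVec f := rfl
  change H.toQuadraticForm' ((Matrix.toLin'OfInv (M := star U) (M' := U) h2 h1) f) = _
  rw [hU']
  rw [toQuadraticForm'_eq_dotProduct, Matrix.mulVec_mulVec, Matrix.dotProduct_mulVec,
    Matrix.vecMul_mulVec, ← hst, ← mul_assoc, hspec]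
  simp [QuadraticMap.weightedSumSquares_apply, Matrix.vecMul_diagonal, dotProduct]
  exact Finset.sum_congr rfl fun i _ => by ring

theorem ncard_eq_countP_roots {H : Matrix ι ι ℝ} (hH : H.IsHermitian) (P : ℝ → Prop)
    [DecidablePred P] :
    {i | P (hH.eigenvalues i)}.ncard = H.charpoly.roots.countP P := by
  rw [hH.roots_charpoly_eq_eigenvalues, Multiset.countP_map, Set.ncard_eq_toFinset_card']
  simp [Finset.card_def]

theorem card_roots_charpoly {H : Matrix ι ι ℝ} (hH : H.IsHermitian) :
    H.charpoly.roots.card = H.charpoly.natDegree := by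
  rw [hH.roots_charpoly_eq_eigenvalues, Matrix.charpoly_natDegree_eq_dim]
  simp

/-- The signs of the coefficients of its characteristic polynomial determine the signature of a
symmetric matrix. -/
theorem sigPos_sigNeg_congr {H H' : Matrix ι ι ℝ} (hH : H.IsHermitian) (hH' : H'.IsHermitian)
    (h : ∀ n, SignType.sign (H.charpoly.coeff n) = SignType.sign (H'.charpoly.coeff n)) :
    sigPos H.toQuadraticForm' = sigPos H'.toQuadraticForm' ∧
      sigNeg H.toQuadraticForm' = sigNeg H'.toQuadraticForm' := by
  have key := countP_roots_congr H.charpoly_monic.ne_zero H'.charpoly_monic.ne_zero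
    (card_roots_charpoly hH) (card_roots_charpoly hH') h
  rw [← ncard_eq_countP_roots hH, ← ncard_eq_countP_roots hH', ← ncard_eq_countP_roots hH,
    ← ncard_eq_countP_roots hH'] at key
  rw [(equivalent_weightedSumSquares_eigenvalues hH).sigPos_eq,
    (equivalent_weightedSumSquares_eigenvalues hH').sigPos_eq,
    (equivalent_weightedSumSquares_eigenvalues hH).sigNeg_eq,
    (equivalent_weightedSumSquares_eigenvalues hH').sigNeg_eq]
  simpa only [QuadraticForm.sigPos_weightedSumSquares, QuadraticForm.sigNeg_weightedSumSquares]
    using key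

end Signature

section HermiteForm

theorem sigPos_sub_sigNeg_of_diagonal {V J : Type*} [AddCommGroup V] [Module ℝ V]
    [FiniteDimensional ℝ V] [Fintype J] (q : QuadraticForm ℝ V) (c : J → ℝ)
    (l : J → V →ₗ[ℝ] ℝ) (hl : LinearIndependent ℝ l)
    (hq : ∀ v, q v = ∑ j, c j * (l j v) ^ 2) :
    (sigPos q : ℤ) - sigNeg q = ∑ j, (SignType.sign (c j) : ℤ) := by
  classical
  let b := Module.Basis.sumExtend hl
  have : Fintype (Module.Basis.sumExtendIndex hl) :=
    have := FiniteDimensional.fintypeBasisIndex b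
    Fintype.ofInjective (Sum.inr : _ → J ⊕ Module.Basis.sumExtendIndex hl) Sum.inr_injective
  have hbl : ∀ j, b (Sum.inl j) = l j := by
    intro j
    simp only [b, Module.Basis.sumExtend, Module.Basis.coe_reindex,
      Function.comp_apply, Module.Basis.extend_apply_self]
    rfl
  let Φ : V →ₗ[ℝ] (J ⊕ Module.Basis.sumExtendIndex hl → ℝ) := LinearMap.pi fun i => b i
  have hinj : Function.Injective Φ := by
    rw [← LinearMap.ker_eq_bot, LinearMap.ker_eq_bot']
    intro v hv
    rw [← Module.forall_dual_apply_eq_zero_iff ℝ v]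
    intro f
    rw [← b.sum_repr f]
    simp only [LinearMap.sum_apply, LinearMap.smul_apply]
    refine Finset.sum_eq_zero fun i _ => ?_
    have : b i v = 0 := congrFun hv i
    rw [this, smul_zero]
  have hdim : Module.finrank ℝ V =
      Module.finrank ℝ (J ⊕ Module.Basis.sumExtendIndex hl → ℝ) := by
    rw [Module.finrank_fintype_fun_eq_card, ← Module.finrank_eq_card_basis b,
      Subspace.dual_finrank_eq]
  let E := LinearMap.linearEquivOfInjective Φ hinj hdim
  let w : J ⊕ Module.Basis.sumExtendIndex hl → ℝ := Sum.elim c 0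
  have heq : QuadraticMap.Equivalent q (QuadraticMap.weightedSumSquares ℝ w) := by
    refine ⟨⟨E, fun v => ?_⟩⟩
    change QuadraticMap.weightedSumSquares ℝ w (Φ v) = q v
    rw [QuadraticMap.weightedSumSquares_apply, hq]
    refine (Fintype.sum_sum_type _).trans ?_
    simp [w, Φ, hbl, pow_two]
  rw [QuadraticForm.sigPos_of_equiv_weightedSumSquares heq,
    QuadraticForm.sigNeg_of_equiv_weightedSumSquares heq]
  have h1 : ∀ (p : ℝ → Prop) [DecidablePred p], ¬ p 0 →
      ({i | p (w i)}.ncard : ℤ) = ∑ j, if p (c j) then 1 else 0 := by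
    intro p _ hp
    have : {i | p (w i)} = Sum.inl '' {j | p (c j)} := by
      ext i
      rcases i with i | i
      · simp [w]
      · simp [w, hp]
    rw [this, Set.ncard_image_of_injective _ Sum.inl_injective, Set.ncard_eq_toFinset_card']
    simp
  rw [h1 (fun t => 0 < t) (by simp), h1 (fun t => t < 0) (by simp), ← Finset.sum_sub_distrib]
  refine Finset.sum_congr rfl fun j _ => ?_
  rcases lt_trichotomy (c j) 0 with h | h | h
  · simp [h, h.not_gt]
  · simp [h]
  · simp [h, h.not_gt]

open ComplexConjugate in
theorem real_mul_sq_add_conj (e : ℝ) (z : ℂ) : (e : ℂ) * z ^ 2 + e * (conj z) ^ 2 =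
    ((2 * e : ℝ) : ℂ) * (z.re : ℂ) ^ 2 + ((-(2 * e) : ℝ) : ℂ) * (z.im : ℂ) ^ 2 := by
  apply Complex.ext <;> simp [pow_two] <;> ring

open ComplexConjugate in
theorem mul_add_conj_mul (a b : ℝ) (z : ℂ) :
    z * ((a - b * Complex.I) / 2) + conj z * ((a + b * Complex.I) / 2) =
      a * (z.re : ℂ) + b * (z.im : ℂ) := by
  apply Complex.ext <;> simp <;> ring

open ComplexConjugate in
/-- Hermite's theorem: the signature of a real quadratic form that is a complex combination of
squares of independent forms permuted by conjugation. -/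
theorem sigPos_sub_sigNeg_of_conj {V Ω : Type*} [AddCommGroup V] [Module ℝ V]
    [FiniteDimensional ℝ V] [Fintype Ω] [DecidableEq Ω] (q : QuadraticForm ℝ V) (w : Ω → ℂ)
    (ψ : Ω → V →ₗ[ℝ] ℂ) (hψ : LinearIndependent ℂ ψ) (σ : Ω → Ω) (hσ : ∀ ω, σ (σ ω) = ω)
    (hσψ : ∀ ω v, ψ (σ ω) v = conj (ψ ω v)) (hσw : ∀ ω, w (σ ω) = conj (w ω))
    (hq : ∀ v, (q v : ℂ) = ∑ ω, w ω * (ψ ω v) ^ 2) :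
    (sigPos q : ℤ) - sigNeg q =
      ∑ ω with σ ω = ω, (SignType.sign (w ω).re : ℤ) := by
  classical
  obtain ⟨o⟩ : Nonempty (Ω ≃ Fin (Fintype.card Ω)) := ⟨Fintype.equivFin Ω⟩
  have hsq : ∀ ω, ∃ s : ℂ, s ≠ 0 ∧ ∃ ε : ℝ, w ω = ε * s ^ 2 := by
    intro ω
    by_cases h : w ω = 0
    · exact ⟨1, one_ne_zero, 0, by simp [h]⟩
    · obtain ⟨s, hs⟩ := IsAlgClosed.exists_pow_nat_eq (w ω) (n := 2) two_pos
      refine ⟨s, ?_, 1, by simp [hs]⟩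
      rintro rfl
      exact h (by simpa using hs.symm)
  choose s hs ε hε using hsq
  -- one real form for each index
  let c : Ω → ℝ := fun ω =>
    if σ ω = ω then (w ω).re else if o ω < o (σ ω) then 2 * ε ω else -(2 * ε (σ ω))
  let l : Ω → V →ₗ[ℝ] ℝ := fun ω =>
    if σ ω = ω then Complex.reLm ∘ₗ ψ ω
    else if o ω < o (σ ω) then Complex.reLm ∘ₗ (s ω • ψ ω)
    else Complex.imLm ∘ₗ (s (σ ω) • ψ (σ ω))
  have hfix : ∀ ω, σ ω = ω → ∀ v, ((ψ ω v).re : ℂ) = ψ ω v := by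
    intro ω h v
    have := hσψ ω v
    rw [h] at this
    exact Complex.conj_eq_iff_re.mp this.symm
  have hwfix : ∀ ω, σ ω = ω → ((w ω).re : ℂ) = w ω := by
    intro ω h
    have := hσw ω
    rw [h] at this
    exact Complex.conj_eq_iff_re.mp this.symm
  have hdich : ∀ ω, σ ω ≠ ω → ¬ o ω < o (σ ω) → o (σ ω) < o (σ (σ ω)) := by
    intro ω h h'
    rw [hσ]
    exact lt_of_le_of_ne (not_lt.mp h') (fun h2 => h (o.injective h2))
  have hne : ∀ ω, σ ω ≠ ω → σ (σ ω) ≠ σ ω := fun ω h => by rw [hσ]; exact h.symm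
  have hsum : ∀ f : Ω → ℂ, ∑ ω, f (σ ω) = ∑ ω, f ω := fun f =>
    Fintype.sum_bijective σ (Function.Involutive.bijective hσ) _ _ fun _ => rfl
  have hqc : ∀ v, q v = ∑ ω, c ω * (l ω v) ^ 2 := by
    intro v
    have h2 : (q v : ℂ) = ∑ ω, (c ω * (l ω v : ℂ) ^ 2) := by
      have e1 : ∀ f : Ω → ℂ, ∑ ω, f ω = ∑ ω, (f ω + f (σ ω)) / 2 := by
        intro f
        rw [← Finset.sum_div, Finset.sum_add_distrib, hsum]
        ring
      rw [hq, e1 (fun ω => w ω * (ψ ω v) ^ 2), e1 (fun ω => (c ω * (l ω v : ℂ) ^ 2))]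
      refine Finset.sum_congr rfl fun ω _ => ?_
      by_cases h : σ ω = ω
      · simp only [h, c, l, if_true, LinearMap.comp_apply, Complex.reLm_coe, hfix ω h v,
          hwfix ω h]
      · have key : ∀ ω, o ω < o (σ ω) → σ ω ≠ ω →
            w ω * (ψ ω v) ^ 2 + w (σ ω) * (ψ (σ ω) v) ^ 2 =
            c ω * (l ω v : ℂ) ^ 2 + c (σ ω) * (l (σ ω) v : ℂ) ^ 2 := by
          intro ω h h'
          simp only [c, l, h, h', h'.symm, h.not_gt, if_true, if_false, hσw, hσψ,
            LinearMap.comp_apply, Complex.reLm_coe, Complex.imLm_coe, hσ]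
          rw [hε ω]
          simp only [LinearMap.smul_apply, smul_eq_mul]
          have e4 : (ε ω : ℂ) * s ω ^ 2 * ψ ω v ^ 2 = ε ω * (s ω * ψ ω v) ^ 2 := by ring
          have e5 : conj ((ε ω : ℂ) * s ω ^ 2) * conj (ψ ω v) ^ 2 =
              ε ω * (conj (s ω * ψ ω v)) ^ 2 := by
            simp only [map_mul, map_pow, Complex.conj_ofReal]; ring
          rw [e4, e5, real_mul_sq_add_conj]
        by_cases h' : o ω < o (σ ω)
        · rw [key ω h' h]
        · have := key (σ ω) (hdich ω h h') (hne ω h)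
          rw [hσ] at this
          rw [add_comm, this, add_comm]
    exact_mod_cast h2
  have hli : LinearIndependent ℝ l := by
    rw [Fintype.linearIndependent_iff] at hψ ⊢
    intro r hr
    -- coefficients of the vanishing complex combination
    let g : Ω → ℂ := fun ω =>
      if σ ω = ω then r ω else if o ω < o (σ ω) then s ω * (r ω - r (σ ω) * Complex.I) / 2
      else conj (s (σ ω)) * (r (σ ω) + r ω * Complex.I) / 2
    have hg := hψ g ?_
    · have key : ∀ ω, σ ω ≠ ω → o ω < o (σ ω) → r ω = 0 ∧ r (σ ω) = 0 := by
        intro ω h h'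
        have h1 := hg ω
        simp only [g, h, h', if_true, if_false] at h1
        have h2 : (r ω : ℂ) - r (σ ω) * Complex.I = 0 := by
          simpa [hs ω] using h1
        have h3 := congrArg Complex.re h2
        have h4 := congrArg Complex.im h2
        simp at h3 h4
        exact ⟨h3, h4⟩
      intro ω
      by_cases h : σ ω = ω
      · have h1 := hg ω
        simpa [g, h] using h1
      · by_cases h' : o ω < o (σ ω)
        · exact (key ω h h').1
        · have := (key (σ ω) (hne ω h) (hdich ω h h')).2
          rwa [hσ] at this
    · ext v
      have hv : ∑ ω, (r ω * l ω v : ℂ) = 0 := by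
        have := congrArg (fun F => F v) hr
        simp only [LinearMap.sum_apply, LinearMap.smul_apply, smul_eq_mul,
          LinearMap.zero_apply] at this
        exact_mod_cast this
      have e1 : ∀ f : Ω → ℂ, ∑ ω, f ω = ∑ ω, (f ω + f (σ ω)) / 2 := by
        intro f
        rw [← Finset.sum_div, Finset.sum_add_distrib, hsum]
        ring
      simp only [LinearMap.sum_apply, LinearMap.smul_apply, smul_eq_mul, LinearMap.zero_apply]
      rw [← hv, e1 (fun ω => g ω * ψ ω v), e1 (fun ω => (r ω * (l ω v : ℂ)))]
      refine Finset.sum_congr rfl fun ω _ => ?_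
      by_cases h : σ ω = ω
      · simp only [h, g, l, if_true, LinearMap.comp_apply, Complex.reLm_coe, hfix ω h v]
      · have key : ∀ ω, o ω < o (σ ω) → σ ω ≠ ω →
            g ω * ψ ω v + g (σ ω) * ψ (σ ω) v = r ω * l ω v + r (σ ω) * l (σ ω) v := by
          intro ω h h'
          simp only [g, l, h, h', h'.symm, h.not_gt, if_true, if_false, hσψ,
            LinearMap.comp_apply, Complex.reLm_coe, Complex.imLm_coe, hσ]
          simp only [LinearMap.smul_apply, smul_eq_mul]
          have e4 : s ω * (r ω - r (σ ω) * Complex.I) / 2 * ψ ω v =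
            (s ω * ψ ω v) * ((r ω - r (σ ω) * Complex.I) / 2) := by ring
          have e5 : conj (s ω) * (r ω + r (σ ω) * Complex.I) / 2 * conj (ψ ω v) =
              (conj (s ω * ψ ω v)) * ((r ω + r (σ ω) * Complex.I) / 2) := by
            simp only [map_mul]; ring
          rw [e4, e5, mul_add_conj_mul]
        by_cases h' : o ω < o (σ ω)
        · rw [key ω h' h]
        · have := key (σ ω) (hdich ω h h') (hne ω h)
          rw [hσ] at this
          rw [add_comm, this, add_comm]
  rw [sigPos_sub_sigNeg_of_diagonal q c l hli hqc,
    ← Finset.sum_filter_add_sum_filter_not _ (fun ω => σ ω = ω)]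
  have hz : ∑ ω with ¬ σ ω = ω, (SignType.sign (c ω) : ℤ) = 0 := by
    refine Finset.sum_involution (fun ω _ => σ ω) ?_ ?_ ?_ ?_
    · intro ω hω
      have h : σ ω ≠ ω := by simpa using hω
      by_cases h' : o ω < o (σ ω)
      · simp only [c, h, h', Ne.symm h, h'.not_gt, if_true, if_false, hσ, Left.sign_neg]
        simp
      · have h3 := hdich ω h h'
        simp only [c, h, h', hne ω h, h3, if_true, if_false, Left.sign_neg]
        simp
    · intro ω hω _
      simpa using hω
    · intro ω hω
      have h : σ ω ≠ ω := by simpa using hω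
      simpa using hne ω h
    · intro ω _
      exact hσ ω
  rw [hz, add_zero]
  refine Finset.sum_congr rfl fun ω hω => ?_
  have h : σ ω = ω := by simpa using hω
  simp [c, h]

end HermiteForm

section TraceForm

variable {B : Type*} [CommRing B] [Algebra ℝ B]


theorem finite_algHom_complex [Module.Finite ℝ B] : Finite (B →ₐ[ℝ] ℂ) :=
  (linearIndependent_algHom_toLinearMap ℝ B ℂ).finite

theorem isNilpotent_of_forall_algHom_eq_zero [Module.Finite ℝ B] {b : B}
    (hb : ∀ ω : B →ₐ[ℝ] ℂ, ω b = 0) :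
    IsNilpotent b := by
  rw [nilpotent_iff_mem_prime]
  intro P hP
  have : IsArtinianRing B := IsArtinianRing.of_finite ℝ B
  have hM : P.IsMaximal := IsArtinianRing.isMaximal_of_isPrime P
  let _ : Field (B ⧸ P) := Ideal.Quotient.field P
  have : Module.Finite ℝ (B ⧸ P) := inferInstance
  have : Algebra.IsAlgebraic ℝ (B ⧸ P) := Algebra.IsAlgebraic.of_finite ℝ (B ⧸ P)
  let φ : (B ⧸ P) →ₐ[ℝ] ℂ := IsAlgClosed.lift
  have h1 := hb (φ.comp (Ideal.Quotient.mkₐ ℝ P))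
  rw [AlgHom.comp_apply, map_eq_zero] at h1
  exact Ideal.Quotient.eq_zero_iff_mem.mp h1

/-- The complex conjugate of an algebra homomorphism. -/
noncomputable def conjAlgHom (ω : B →ₐ[ℝ] ℂ) : B →ₐ[ℝ] ℂ := Complex.conjAe.toAlgHom.comp ω

/-- The complexification of a real point. -/
noncomputable def complexAlgHom (φ : B →ₐ[ℝ] ℝ) : B →ₐ[ℝ] ℂ := Complex.ofRealAm.comp φ

open ComplexConjugate

theorem conjAlgHom_apply (ω : B →ₐ[ℝ] ℂ) (b : B) : conjAlgHom ω b = conj (ω b) := rfl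

theorem complexAlgHom_apply (φ : B →ₐ[ℝ] ℝ) (b : B) : complexAlgHom φ b = (φ b : ℂ) := rfl

theorem conjAlgHom_conjAlgHom (ω : B →ₐ[ℝ] ℂ) : conjAlgHom (conjAlgHom ω) = ω := by
  ext b; simp [conjAlgHom_apply]

theorem conjAlgHom_eq_iff (ω : B →ₐ[ℝ] ℂ) :
    conjAlgHom ω = ω ↔ ∃ φ : B →ₐ[ℝ] ℝ, complexAlgHom φ = ω := by
  constructor
  · intro h
    have hre : ∀ b, ((ω b).re : ℂ) = ω b := fun b => by
      have := congrArg (fun f => f b) h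
      exact Complex.conj_eq_iff_re.mp this
    refine ⟨AlgHom.ofLinearMap (Complex.reLm ∘ₗ ω.toLinearMap) (by simp) ?_, ?_⟩
    · intro x y
      have : ((ω (x * y)).re : ℂ) = ((ω x).re * (ω y).re : ℝ) := by
        push_cast
        rw [hre, hre, hre, map_mul]
      exact_mod_cast this
    · ext b
      exact hre b
  · rintro ⟨φ, rfl⟩
    ext b
    simp [conjAlgHom_apply, complexAlgHom_apply]

theorem exists_trace_eq_sum [Module.Finite ℝ B] [Fintype (B →ₐ[ℝ] ℂ)] :
    ∃ β : (B →ₐ[ℝ] ℂ) → ℂ, ∀ b : B, (Algebra.trace ℝ B b : ℂ) = ∑ ω, β ω * ω b := by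
  let L : (B →ₐ[ℝ] ℂ) ⊕ (B →ₐ[ℝ] ℂ) → B →ₗ[ℝ] ℝ :=
    Sum.elim (fun ω => Complex.reLm ∘ₗ ω.toLinearMap) (fun ω => Complex.imLm ∘ₗ ω.toLinearMap)
  have h1 : Algebra.trace ℝ B ∈ Submodule.span ℝ (Set.range L) := by
    apply mem_span_of_iInf_ker_le_ker
    intro b hb
    rw [Submodule.mem_iInf] at hb
    have hn : IsNilpotent b := isNilpotent_of_forall_algHom_eq_zero fun ω => by
      have h2 := hb (Sum.inl ω)
      have h3 := hb (Sum.inr ω)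
      simp only [L, Sum.elim_inl, Sum.elim_inr, LinearMap.mem_ker, LinearMap.comp_apply] at h2 h3
      exact Complex.ext h2 h3
    rw [LinearMap.mem_ker, Algebra.trace_apply]
    exact (LinearMap.isNilpotent_trace_of_isNilpotent
      (hn.map (Algebra.lmul ℝ B))).eq_zero
  obtain ⟨c, hc⟩ := (Submodule.mem_span_range_iff_exists_fun ℝ).mp h1
  have hinv : Function.Involutive (conjAlgHom (B := B)) := conjAlgHom_conjAlgHom
  refine ⟨fun ω => (c (Sum.inl ω) - c (Sum.inr ω) * Complex.I) / 2 +
    (c (Sum.inl (conjAlgHom ω)) + c (Sum.inr (conjAlgHom ω)) * Complex.I) / 2, fun b => ?_⟩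
  have h2 : ∀ f : (B →ₐ[ℝ] ℂ) → ℂ, ∑ ω, f (conjAlgHom ω) = ∑ ω, f ω := fun f =>
    Fintype.sum_bijective _ hinv.bijective _ _ fun _ => rfl
  have h3 := h2 fun ω => (c (Sum.inl ω) + c (Sum.inr ω) * Complex.I) / 2 * conj (ω b)
  simp only [conjAlgHom_apply, Complex.conj_conj] at h3
  simp only [add_mul, Finset.sum_add_distrib]
  have hcb : Algebra.trace ℝ B b =
      ∑ ω, (c (Sum.inl ω) * (ω b).re + c (Sum.inr ω) * (ω b).im) := by
    rw [← hc, LinearMap.sum_apply]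
    refine (Fintype.sum_sum_type _).trans ?_
    rw [← Finset.sum_add_distrib]
    rfl
  rw [h3, hcb, ← Finset.sum_add_distrib]
  push_cast
  refine Finset.sum_congr rfl fun ω _ => ?_
  rw [← mul_add_conj_mul (c (Sum.inl ω)) (c (Sum.inr ω)) (ω b)]
  ring

theorem trace_weights_conj [Fintype (B →ₐ[ℝ] ℂ)] {t : B → ℝ} {β : (B →ₐ[ℝ] ℂ) → ℂ}
    (hβ : ∀ b : B, (t b : ℂ) = ∑ ω, β ω * ω b) (ω : B →ₐ[ℝ] ℂ) :
    β (conjAlgHom ω) = conj (β ω) := by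
  have hinv : Function.Involutive (conjAlgHom (B := B)) := conjAlgHom_conjAlgHom
  have hli := Fintype.linearIndependent_iff.mp (linearIndependent_algHom_toLinearMap ℝ B ℂ)
    (fun ω => conj (β (conjAlgHom ω)) - β ω) ?_ ω
  · rw [sub_eq_zero] at hli
    rw [← hli, Complex.conj_conj]
  · ext b
    have h1 := congrArg conj (hβ b)
    rw [Complex.conj_ofReal, hβ b, map_sum] at h1
    have h2 : ∑ ω, conj (β (conjAlgHom ω)) * ω b = ∑ ω, conj (β ω * ω b) := by
      refine Fintype.sum_bijective _ hinv.bijective _ _ fun ω => ?_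
      simp [conjAlgHom_apply]
    simp only [LinearMap.sum_apply, LinearMap.smul_apply, smul_eq_mul, AlgHom.toLinearMap_apply,
      sub_mul, Finset.sum_sub_distrib, LinearMap.zero_apply]
    rw [h2, h1, sub_self]

theorem exists_idempotent [Module.Finite ℝ B] [Fintype (B →ₐ[ℝ] ℂ)] (φ : B →ₐ[ℝ] ℝ) :
    ∃ e : B, IsIdempotentElem e ∧ φ e = 1 ∧ ∀ ω, ω ≠ complexAlgHom φ → ω e = 0 := by
  classical
  have h1 : ∀ ω : B →ₐ[ℝ] ℂ, ∃ b : B, φ b = 1 ∧ (ω ≠ complexAlgHom φ → ω b = 0) := by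
    intro ω
    by_cases h : ω = complexAlgHom φ
    · exact ⟨1, by simp, fun h' => absurd h h'⟩
    · obtain ⟨b, hb⟩ : ∃ b, ω b ≠ complexAlgHom φ b := by
        by_contra! h'
        exact h (AlgHom.ext h')
      set z : ℂ := ω b - φ b with hz
      have hz0 : z ≠ 0 := by
        rw [hz, sub_ne_zero]
        exact hb
      have hn : Complex.normSq z ≠ 0 := by simpa using hz0
      let b' := b - algebraMap ℝ B (φ b)
      have hb' : ω b' = z := by simp [b', hz]
      have hb0 : φ b' = 0 := by simp [b']
      refine ⟨(Complex.normSq z)⁻¹ • (b' ^ 2 - (2 * z.re) • b' + Complex.normSq z • 1), ?_, ?_⟩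
      · simp [hb0, hn]
      · intro _
        have : z ^ 2 - 2 * z.re * z + Complex.normSq z = 0 := by
          apply Complex.ext <;> simp [pow_two, Complex.normSq_apply] <;> ring
        rw [map_smul ω, map_add ω, map_sub ω, map_smul ω, map_smul ω, map_pow ω, hb', map_one ω]
        simp only [Complex.real_smul]
        push_cast
        rw [mul_one, this, mul_zero]
  choose b hb1 hb2 using h1
  let a := ∏ ω, b ω
  have ha1 : φ a = 1 := by simp [a, hb1]
  have ha2 : ∀ ω, ω ≠ complexAlgHom φ → ω a = 0 := by
    intro ω h
    simp only [a, map_prod]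
    exact Finset.prod_eq_zero (Finset.mem_univ ω) (hb2 ω h)
  have hker : ∀ x ∈ RingHom.ker (Ideal.Quotient.mk (nilradical B)), IsNilpotent x := by
    intro x hx
    rwa [Ideal.mk_ker, mem_nilradical] at hx
  have hidem : IsIdempotentElem (Ideal.Quotient.mk (nilradical B) a) := by
    rw [IsIdempotentElem, ← map_mul, Ideal.Quotient.eq, mem_nilradical]
    apply isNilpotent_of_forall_algHom_eq_zero
    intro ω
    by_cases h : ω = complexAlgHom φ
    · subst h
      simp [complexAlgHom_apply, ha1]
    · simp [ha2 ω h]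
  obtain ⟨e, he, hea⟩ := exists_isIdempotentElem_eq_of_ker_isNilpotent _ hker _ ⟨a, rfl⟩ hidem
  rw [Ideal.Quotient.eq, mem_nilradical] at hea
  refine ⟨e, he, ?_, fun ω hω => ?_⟩
  · have := (hea.map φ).eq_zero
    rw [map_sub, ha1, sub_eq_zero] at this
    exact this
  · have := (hea.map ω).eq_zero
    rwa [map_sub, ha2 ω hω, sub_zero] at this

theorem trace_weight_pos [Module.Finite ℝ B] [Fintype (B →ₐ[ℝ] ℂ)] {β : (B →ₐ[ℝ] ℂ) → ℂ}
    (hβ : ∀ b : B, (Algebra.trace ℝ B b : ℂ) = ∑ ω, β ω * ω b) (φ : B →ₐ[ℝ] ℝ) :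
    0 < (β (complexAlgHom φ)).re := by
  classical
  obtain ⟨e, he, he1, he2⟩ := exists_idempotent φ
  have h1 := hβ e
  rw [Finset.sum_eq_single (complexAlgHom φ) (fun ω _ h => by rw [he2 ω h, mul_zero])
    (by simp), complexAlgHom_apply, he1] at h1
  have hp : LinearMap.IsProj (LinearMap.range (Algebra.lmul ℝ B e)) (Algebra.lmul ℝ B e) :=
    LinearMap.isProj_range_iff_isIdempotentElem _ |>.mpr (he.map (Algebra.lmul ℝ B))
  have h2 : Algebra.trace ℝ B e = Module.finrank ℝ (LinearMap.range (Algebra.lmul ℝ B e)) := by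
    rw [Algebra.trace_apply]
    exact hp.trace
  have h3 : 0 < Module.finrank ℝ (LinearMap.range (Algebra.lmul ℝ B e)) := by
    have : Nontrivial (LinearMap.range (Algebra.lmul ℝ B e)) := by
      refine ⟨⟨⟨e, ⟨1, by simp⟩⟩, 0, fun h => ?_⟩⟩
      have : e = 0 := congrArg Subtype.val h
      rw [this, map_zero] at he1
      exact zero_ne_one he1
    exact Module.finrank_pos
  rw [h2] at h1
  have h4 : β (complexAlgHom φ) = (Module.finrank ℝ (LinearMap.range (Algebra.lmul ℝ B e)) : ℝ) := by
    simpa using h1.symm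
  rw [h4, Complex.ofReal_re]
  exact_mod_cast h3

/-- Hermite's theorem: the signature of the form `(f, g) ↦ Tr (h f g)` counts the real points of a
finite real algebra with the sign of `h`. -/
theorem sigPos_sub_sigNeg_trace [Module.Finite ℝ B] {ι : Type*} [Fintype ι] [DecidableEq ι]
    (b : Module.Basis ι ℝ B)
    (h : B) [Fintype (B →ₐ[ℝ] ℝ)] :
    (sigPos (Matrix.of fun i j => Algebra.trace ℝ B (h * (b i * b j))).toQuadraticForm' : ℤ) -
      sigNeg (Matrix.of fun i j => Algebra.trace ℝ B (h * (b i * b j))).toQuadraticForm' =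
      ∑ φ : B →ₐ[ℝ] ℝ, (SignType.sign (φ h) : ℤ) := by
  classical
  have : Finite (B →ₐ[ℝ] ℂ) := finite_algHom_complex
  have : Fintype (B →ₐ[ℝ] ℂ) := Fintype.ofFinite _
  obtain ⟨β, hβ⟩ := exists_trace_eq_sum (B := B)
  have hconj := trace_weights_conj hβ
  let E : (ι → ℝ) ≃ₗ[ℝ] B := b.equivFun.symm
  have hE : ∀ f, E f = ∑ i, f i • b i := fun f => b.equivFun_symm_apply f
  let ψ : (B →ₐ[ℝ] ℂ) → (ι → ℝ) →ₗ[ℝ] ℂ := fun ω => ω.toLinearMap ∘ₗ E.toLinearMap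
  have hψ : LinearIndependent ℂ ψ := by
    have h0 := Fintype.linearIndependent_iff.mp (linearIndependent_algHom_toLinearMap ℝ B ℂ)
    rw [Fintype.linearIndependent_iff]
    intro g hg
    apply h0
    ext x
    have := congrArg (fun F => F (E.symm x)) hg
    simpa [ψ] using this
  rw [sigPos_sub_sigNeg_of_conj _ (fun ω => β ω * ω h) ψ hψ conjAlgHom conjAlgHom_conjAlgHom
    (fun ω v => rfl) (fun ω => by rw [hconj, conjAlgHom_apply, map_mul]) ?_]
  · symm
    refine Finset.sum_bij (fun φ _ => complexAlgHom φ) ?_ ?_ ?_ ?_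
    · intro φ _
      simp [conjAlgHom_eq_iff]
    · intro φ _ φ' _ hh
      ext x
      have := congrArg (fun F => F x) hh
      simpa [complexAlgHom_apply] using this
    · intro ω hω
      have : conjAlgHom ω = ω := by simpa using hω
      obtain ⟨φ, hφ⟩ := (conjAlgHom_eq_iff ω).mp this
      exact ⟨φ, Finset.mem_univ _, hφ⟩
    · intro φ _
      rw [complexAlgHom_apply, Complex.re_mul_ofReal, sign_mul,
        sign_pos (trace_weight_pos hβ φ), one_mul]
  · intro f
    rw [toQuadraticForm'_apply]
    have h1 : ∑ i, ∑ j, (Matrix.of fun i j => Algebra.trace ℝ B (h * (b i * b j))) i j *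
        (f i * f j) = Algebra.trace ℝ B (h * (E f * E f)) := by
      rw [hE, Finset.sum_mul_sum, Finset.mul_sum, map_sum]
      refine Finset.sum_congr rfl fun i _ => ?_
      rw [Finset.mul_sum, map_sum]
      refine Finset.sum_congr rfl fun j _ => ?_
      rw [Matrix.of_apply, smul_mul_smul_comm, mul_smul_comm, map_smul, smul_eq_mul, mul_comm]
    rw [h1, hβ]
    refine Finset.sum_congr rfl fun ω _ => ?_
    simp only [ψ, LinearMap.comp_apply, map_mul, LinearEquiv.coe_coe, AlgHom.toLinearMap_apply]
    ring

end TraceForm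

section SignDetermination

variable {I : Type*}

/-- In a finite nonempty set of vectors, some vector is isolated by logarithmically many
coordinates. -/
theorem exists_isolated (S : Finset (I → SignType)) (hS : S.Nonempty) :
    ∃ T : Finset I, 2 ^ T.card ≤ S.card ∧
      ∃ v ∈ S, ∀ u ∈ S, (∀ i ∈ T, u i = v i) → u = v := by
  classical
  induction hn : S.card using Nat.strong_induction_on generalizing S with
  | _ n ih =>
  by_cases hsub : ∃ u ∈ S, ∃ u' ∈ S, u ≠ u'
  · obtain ⟨u, hu, u', hu', hne⟩ := hsub
    obtain ⟨i, hi⟩ := Function.ne_iff.mp hne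
    obtain ⟨w, hw, hcard⟩ : ∃ w ∈ S, 2 * (S.filter (fun z => z i = w i)).card ≤ n := by
      have hdisj : Disjoint (S.filter (fun z => z i = u i)) (S.filter (fun z => z i = u' i)) := by
        rw [Finset.disjoint_filter]
        intro z _ h1 h2
        exact hi (h1.symm.trans h2)
      have hle : (S.filter (fun z => z i = u i)).card + (S.filter (fun z => z i = u' i)).card
          ≤ n := by
        rw [← Finset.card_union_of_disjoint hdisj, ← hn]
        exact Finset.card_le_card (Finset.union_subset (Finset.filter_subset _ _)
          (Finset.filter_subset _ _))
      rcases le_total (S.filter (fun z => z i = u i)).card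
        (S.filter (fun z => z i = u' i)).card with h | h
      · exact ⟨u, hu, by omega⟩
      · exact ⟨u', hu', by omega⟩
    have hne' : (S.filter (fun z => z i = w i)).Nonempty := ⟨w, by simp [hw]⟩
    have hpos := hne'.card_pos
    obtain ⟨T, hT, v, hv, hiso⟩ := ih _ (by omega) _ hne' rfl
    have hvS : v ∈ S ∧ v i = w i := by simpa using hv
    refine ⟨insert i T, ?_, v, hvS.1, ?_⟩
    · have := Finset.card_insert_le i T
      calc 2 ^ (insert i T).card ≤ 2 ^ (T.card + 1) := Nat.pow_le_pow_right two_pos this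
        _ ≤ n := by rw [pow_succ]; omega
    · intro z hz hzT
      refine hiso z ?_ fun j hj => hzT j (Finset.mem_insert_of_mem hj)
      simp only [Finset.mem_filter]
      exact ⟨hz, (hzT i (Finset.mem_insert_self i T)).trans hvS.2⟩
  · push Not at hsub
    obtain ⟨v, hv⟩ := hS
    refine ⟨∅, ?_, v, hv, fun u hu _ => hsub u hu v hv⟩
    have : 0 < S.card := Finset.card_pos.mpr ⟨v, hv⟩
    simp only [Finset.card_empty, pow_zero]
    omega

theorem exists_sign_indicator (y : SignType) : ∃ c : ℕ → ℤ, ∀ x : SignType,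
    ∑ a ∈ Finset.range 3, c a * (x : ℤ) ^ a = if x = y then 2 else 0 := by
  rcases y with _ | _ | _
  · refine ⟨fun a => if a = 0 then 2 else if a = 1 then 0 else -2, fun x => ?_⟩
    cases x <;> simp [Finset.sum_range_succ]
  · refine ⟨fun a => if a = 0 then 0 else if a = 1 then -1 else 1, fun x => ?_⟩
    cases x <;> simp [Finset.sum_range_succ]
  · refine ⟨fun a => if a = 0 then 0 else if a = 1 then 1 else 1, fun x => ?_⟩
    cases x <;> simp [Finset.sum_range_succ]

variable [Fintype I]

/-- Sign determination: the sums of products of few sign functions determine which sign vectors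
are realized. -/
theorem exists_eq_of_sum_prod_sign {Ω Ω' : Type*} [Fintype Ω] [Fintype Ω']
    (s : Ω → I → SignType) (s' : Ω' → I → SignType) (L : ℕ)
    (hL : Fintype.card Ω + Fintype.card Ω' ≤ 2 ^ L)
    (h : ∀ a : I → ℕ, (∀ i, a i ≤ 2) → (Finset.univ.filter fun i => a i ≠ 0).card ≤ L →
      ∑ ω, ∏ i, (s ω i : ℤ) ^ a i = ∑ ω, ∏ i, (s' ω i : ℤ) ^ a i) (ω : Ω) :
    ∃ ω', s' ω' = s ω := by
  classical
  let S := Finset.univ.image s ∪ Finset.univ.image s'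
  let m : (I → SignType) → ℤ := fun v =>
    ((Finset.univ.filter fun ω => s ω = v).card : ℤ) -
      ((Finset.univ.filter fun ω => s' ω = v).card : ℤ)
  let Sp := S.filter fun v => m v ≠ 0
  have hsum : ∀ F : (I → SignType) → ℤ, ∑ v ∈ Sp, m v * F v = ∑ ω, F (s ω) - ∑ ω, F (s' ω) := by
    intro F
    have e1 : ∀ {Ω : Type _} [Fintype Ω] (s : Ω → I → SignType), Finset.univ.image s ⊆ S →
        ∑ v ∈ S, ((Finset.univ.filter fun ω => s ω = v).card : ℤ) * F v = ∑ ω, F (s ω) := by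
      intro Ω _ s hs
      rw [← Finset.sum_fiberwise_of_maps_to (s := Finset.univ) (t := S) (g := s)
        (fun ω _ => hs (Finset.mem_image_of_mem s (Finset.mem_univ ω))) (fun ω => F (s ω))]
      refine Finset.sum_congr rfl fun v _ => ?_
      rw [Finset.sum_congr rfl (g := fun _ => F v) fun ω hω => by
        rw [(Finset.mem_filter.mp hω).2]]
      simp
    have e2 : ∑ v ∈ Sp, m v * F v = ∑ v ∈ S, m v * F v := by
      refine Finset.sum_subset (Finset.filter_subset _ _) fun v hv hv' => ?_
      have : m v = 0 := by
        by_contra h0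
        exact hv' (Finset.mem_filter.mpr ⟨hv, h0⟩)
      rw [this, zero_mul]
    rw [e2]
    simp only [m, sub_mul, Finset.sum_sub_distrib]
    rw [e1 s Finset.subset_union_left]
    congr 1
    have e3 := fun hs => (Finset.sum_fiberwise_of_maps_to (s := Finset.univ) (t := S) (g := s')
        hs (fun ω => F (s' ω)))
    rw [← e3 fun ω _ => Finset.subset_union_right (Finset.mem_image_of_mem s' (Finset.mem_univ ω))]
    refine Finset.sum_congr rfl fun v _ => ?_
    rw [Finset.sum_congr rfl (g := fun _ => F v) fun ω hω => by
      rw [(Finset.mem_filter.mp hω).2]]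
    simp
  by_cases hne : Sp.Nonempty
  · exfalso
    obtain ⟨T, hT, v, hv, hiso⟩ := exists_isolated Sp hne
    have hTL : T.card ≤ L := by
      refine (Nat.pow_le_pow_iff_right (a := 2) (by norm_num)).mp (hT.trans ?_)
      refine le_trans (Finset.card_le_card (Finset.filter_subset _ _)) (le_trans ?_ hL)
      exact (Finset.card_union_le _ _).trans (add_le_add Finset.card_image_le Finset.card_image_le)
    choose c hc using exists_sign_indicator
    let F : (I → SignType) → ℤ := fun u =>
      ∏ i, ∑ a ∈ (if i ∈ T then Finset.range 3 else {0}),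
        (if i ∈ T then c (v i) a else 1) * (u i : ℤ) ^ a
    have hF : ∀ u, F u = ∏ i ∈ T, (if u i = v i then 2 else 0) := by
      intro u
      simp only [F]
      rw [← Finset.prod_subset (Finset.subset_univ T)]
      · refine Finset.prod_congr rfl fun i hi => ?_
        simp only [hi, if_true, hc]
      · intro i _ hi
        simp [hi]
    have h1 := hsum F
    have h2 : ∑ u ∈ Sp, m u * F u = m v * 2 ^ T.card := by
      rw [Finset.sum_eq_single v]
      · simp [hF]
      · intro u hu huv
        rw [hF]
        have : ∃ i ∈ T, u i ≠ v i := by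
          by_contra! h'
          exact huv (hiso u hu h')
        obtain ⟨i, hi, hne⟩ := this
        rw [Finset.prod_eq_zero hi (by simp [hne]), mul_zero]
      · intro h'
        exact absurd hv h'
    have h3 : ∑ ω, F (s ω) = ∑ ω, F (s' ω) := by
      simp only [F, Finset.prod_univ_sum]
      rw [Finset.sum_comm, Finset.sum_comm (s := Finset.univ (α := Ω'))]
      refine Finset.sum_congr rfl fun a ha => ?_
      rw [Fintype.mem_piFinset] at ha
      simp only [Finset.prod_mul_distrib, ← Finset.mul_sum]
      congr 1
      apply h a
      · intro i
        have := ha i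
        split_ifs at this
        · have := Finset.mem_range.mp this; omega
        · have := Finset.mem_singleton.mp this; omega
      · refine (Finset.card_le_card fun i hi => ?_).trans hTL
        by_contra hiT
        have := ha i
        rw [if_neg hiT, Finset.mem_singleton] at this
        exact (Finset.mem_filter.mp hi).2 this
    rw [h2, h3, sub_self] at h1
    have hmv : m v ≠ 0 := (Finset.mem_filter.mp hv).2
    exact hmv (by simpa using h1)
  · by_contra! hno
    apply hne
    refine ⟨s ω, Finset.mem_filter.mpr ⟨Finset.mem_union_left _
      (Finset.mem_image_of_mem s (Finset.mem_univ ω)), ?_⟩⟩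
    have e1 : (Finset.univ.filter fun ω' => s' ω' = s ω) = ∅ := by
      ext ω'
      simp [hno ω']
    have e2 : 0 < (Finset.univ.filter fun ω' => s ω' = s ω).card :=
      Finset.card_pos.mpr ⟨ω, by simp⟩
    simp only [m, e1, Finset.card_empty]
    omega

end SignDetermination

section DegreeReduction

/-- Polynomials of total degree less than `d`. -/
noncomputable def degreeLT (σ : Type*) (d : ℕ) : Submodule ℝ (MvPolynomial σ ℝ) :=
  restrictSupport ℝ {κ | κ.degree < d}

theorem mem_degreeLT {σ : Type*} {d : ℕ} {f : MvPolynomial σ ℝ} :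
    f ∈ degreeLT σ d ↔ ∀ κ ∈ f.support, κ.degree < d := by
  rw [degreeLT, mem_restrictSupport_iff]
  rfl

theorem mem_degreeLT_succ {σ : Type*} {d : ℕ} {f : MvPolynomial σ ℝ} :
    f ∈ degreeLT σ (d + 1) ↔ f.totalDegree ≤ d := by
  rw [mem_degreeLT, totalDegree, Finset.sup_le_iff]
  simp only [Nat.lt_succ_iff]
  rfl

theorem degreeLT_mono {σ : Type*} {d e : ℕ} (h : d ≤ e) : degreeLT σ d ≤ degreeLT σ e :=
  fun _ hf => mem_degreeLT.2 fun κ hκ => (mem_degreeLT.1 hf κ hκ).trans_le h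

theorem degreeLT_zero {σ : Type*} {f : MvPolynomial σ ℝ} (hf : f ∈ degreeLT σ 0) : f = 0 := by
  rw [mem_degreeLT] at hf
  rw [← support_eq_empty]
  exact Finset.eq_empty_of_forall_notMem fun κ hκ => by simpa using hf κ hκ

theorem mul_mem_degreeLT {σ : Type*} {a b : ℕ} {f g : MvPolynomial σ ℝ}
    (hf : f ∈ degreeLT σ a) (hg : g ∈ degreeLT σ (b + 1)) : f * g ∈ degreeLT σ (a + b) := by
  rcases a with _ | a
  · rw [degreeLT_zero hf, zero_mul]; exact zero_mem _
  · rw [mem_degreeLT_succ] at hf hg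
    rw [show a + 1 + b = a + b + 1 by ring, mem_degreeLT_succ]
    exact (totalDegree_mul _ _).trans (add_le_add hf hg)

/-- `f` agrees with `g`, of degree at most `d`, up to terms of degree less than `d`. -/
def SameLead {σ : Type*} (d : ℕ) (f g : MvPolynomial σ ℝ) : Prop :=
  g ∈ degreeLT σ (d + 1) ∧ f - g ∈ degreeLT σ d

theorem SameLead.mul {σ : Type*} {a b : ℕ} {f g f' g' : MvPolynomial σ ℝ}
    (h : SameLead a f g) (h' : SameLead b f' g') : SameLead (a + b) (f * f') (g * g') := by
  refine ⟨?_, ?_⟩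
  · have := mul_mem_degreeLT h.1 h'.1
    rwa [show a + 1 + b = a + b + 1 by ring] at this
  · have hf' : f' ∈ degreeLT σ (b + 1) := by
      have := add_mem (degreeLT_mono (Nat.le_succ b) h'.2) h'.1
      simpa using this
    have h1 := mul_mem_degreeLT h.2 hf'
    have h2 := mul_mem_degreeLT h'.2 h.1
    rw [add_comm] at h2
    have := add_mem h1 h2
    convert this using 1
    ring

theorem SameLead.one {σ : Type*} : SameLead 0 (1 : MvPolynomial σ ℝ) 1 := by
  refine ⟨?_, by simp [zero_mem]⟩
  rw [mem_degreeLT_succ]; simp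

theorem SameLead.pow {σ : Type*} {a : ℕ} {f g : MvPolynomial σ ℝ}
    (h : SameLead a f g) (r : ℕ) : SameLead (r * a) (f ^ r) (g ^ r) := by
  induction r with
  | zero => simpa using SameLead.one
  | succ r ih => rw [pow_succ, pow_succ, add_mul, one_mul]; exact ih.mul h

theorem SameLead.prod {σ τ : Type*} (s : Finset τ) {a : τ → ℕ} {f g : τ → MvPolynomial σ ℝ}
    (h : ∀ l, SameLead (a l) (f l) (g l)) :
    SameLead (∑ l ∈ s, a l) (∏ l ∈ s, f l) (∏ l ∈ s, g l) := by
  classical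
  induction s using Finset.induction_on with
  | empty => simpa using SameLead.one
  | insert l s hl ih =>
    rw [Finset.sum_insert hl, Finset.prod_insert hl, Finset.prod_insert hl]; exact (h l).mul ih

theorem SameLead.X {σ : Type*} (l : σ) : SameLead 1 (X l : MvPolynomial σ ℝ) (X l) := by
  refine ⟨?_, by simp [zero_mem]⟩
  rw [mem_degreeLT_succ]; simp

/-- The power product in the `p l` and the variables replacing the monomial `X ^ κ`. -/
noncomputable def leadMonomial {σ : Type*} [Fintype σ] (N : σ → ℕ) (p : σ → MvPolynomial σ ℝ)
    (κ : σ →₀ ℕ) : MvPolynomial σ ℝ :=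
  ∏ l, (p l ^ (κ l / N l) * X l ^ (κ l % N l))

/-- The linear map sending `X ^ κ` to `leadMonomial N p κ`. -/
noncomputable def leadMap {σ : Type*} [Fintype σ] (N : σ → ℕ) (p : σ → MvPolynomial σ ℝ) :
    MvPolynomial σ ℝ →ₗ[ℝ] MvPolynomial σ ℝ :=
  (basisMonomials σ ℝ).constr ℝ (leadMonomial N p)

theorem leadMap_monomial {σ : Type*} [Fintype σ] (N : σ → ℕ) (p : σ → MvPolynomial σ ℝ)
    (κ : σ →₀ ℕ) : leadMap N p (monomial κ 1) = leadMonomial N p κ := by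
  have := (basisMonomials σ ℝ).constr_basis ℝ (leadMonomial N p) κ
  rwa [coe_basisMonomials] at this

theorem leadMonomial_sub {σ : Type*} [Fintype σ] {N : σ → ℕ} {p : σ → MvPolynomial σ ℝ}
    (hp : ∀ l, N l ≠ 0 → p l - X l ^ N l ∈ degreeLT σ (N l)) (κ : σ →₀ ℕ) :
    leadMonomial N p κ - monomial κ 1 ∈ degreeLT σ κ.degree := by
  have key : ∀ l, SameLead (κ l) (p l ^ (κ l / N l) * X l ^ (κ l % N l))
      ((X l : MvPolynomial σ ℝ) ^ κ l) := by
    intro l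
    have hX : SameLead (κ l % N l) ((X l : MvPolynomial σ ℝ) ^ (κ l % N l))
        (X l ^ (κ l % N l)) := by simpa using (SameLead.X l).pow (κ l % N l)
    by_cases hN : N l = 0
    · simpa [hN] using hX
    · have h1 : SameLead (N l) (p l) (X l ^ N l) :=
        ⟨by simpa using ((SameLead.X l).pow (N l)).1, hp l hN⟩
      have h2 := (h1.pow (κ l / N l)).mul hX
      rwa [← pow_mul, ← pow_add, mul_comm (N l), Nat.div_add_mod'] at h2
  have := (SameLead.prod Finset.univ key).2
  rw [show (monomial κ (1 : ℝ)) = ∏ l, (X l : MvPolynomial σ ℝ) ^ κ l from ?_]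
  · rwa [Finsupp.degree_eq_sum]
  · rw [monomial_eq, C_1, one_mul, Finsupp.prod_fintype _ _ (by simp)]

theorem leadMap_sub {σ : Type*} [Fintype σ] {N : σ → ℕ} {p : σ → MvPolynomial σ ℝ}
    (hp : ∀ l, N l ≠ 0 → p l - X l ^ N l ∈ degreeLT σ (N l)) {d : ℕ} {f : MvPolynomial σ ℝ}
    (hf : f ∈ degreeLT σ (d + 1)) : leadMap N p f - f ∈ degreeLT σ d := by
  rw [mem_degreeLT] at hf
  have h : leadMap N p f - f =
      ∑ κ ∈ f.support, coeff κ f • (leadMonomial N p κ - monomial κ 1) := by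
    conv_lhs => rw [f.as_sum]
    rw [map_sum, ← Finset.sum_sub_distrib]
    refine Finset.sum_congr rfl fun κ _ => ?_
    rw [show monomial κ (coeff κ f) = coeff κ f • monomial κ (1 : ℝ) by simp [smul_monomial],
      map_smul, leadMap_monomial, smul_sub]
  rw [h]
  exact sum_mem fun κ hκ => Submodule.smul_mem _ _
    (degreeLT_mono (Nat.lt_succ_iff.1 (hf κ hκ)) (leadMonomial_sub hp κ))

theorem leadMap_injective {σ : Type*} [Fintype σ] {N : σ → ℕ} {p : σ → MvPolynomial σ ℝ}
    (hp : ∀ l, N l ≠ 0 → p l - X l ^ N l ∈ degreeLT σ (N l)) :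
    Function.Injective (leadMap N p) := by
  rw [injective_iff_map_eq_zero]
  intro f hf
  suffices h : ∀ d, f ∈ degreeLT σ d → f = 0 from
    h _ (mem_degreeLT_succ.2 le_rfl)
  intro d
  induction d with
  | zero => exact degreeLT_zero
  | succ d ih =>
    intro h
    have := leadMap_sub hp h
    rw [hf, zero_sub, Submodule.neg_mem_iff] at this
    exact ih this

theorem leadMap_surjective {σ : Type*} [Fintype σ] {N : σ → ℕ} {p : σ → MvPolynomial σ ℝ}
    (hp : ∀ l, N l ≠ 0 → p l - X l ^ N l ∈ degreeLT σ (N l)) {d : ℕ} {f : MvPolynomial σ ℝ}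
    (hf : f ∈ degreeLT σ d) : ∃ g ∈ degreeLT σ d, leadMap N p g = f := by
  induction d generalizing f with
  | zero => exact ⟨0, zero_mem _, by rw [map_zero, degreeLT_zero hf]⟩
  | succ d ih =>
    obtain ⟨g, hg, hgf⟩ := ih (leadMap_sub hp hf)
    exact ⟨f - g, sub_mem hf (degreeLT_mono (Nat.le_succ d) hg), by rw [map_sub, hgf]; abel⟩

theorem leadMap_X_pow_mul {σ : Type*} [Fintype σ] {N : σ → ℕ} {p : σ → MvPolynomial σ ℝ}
    {l : σ} (hl : N l ≠ 0) (g : MvPolynomial σ ℝ) :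
    leadMap N p (X l ^ N l * g) = p l * leadMap N p g := by
  classical
  induction g using MvPolynomial.induction_on' with
  | monomial κ a =>
    rw [show monomial κ a = a • monomial κ (1 : ℝ) by simp [smul_monomial], mul_smul_comm,
      map_smul, map_smul, mul_smul_comm, leadMap_monomial, X_pow_eq_monomial, monomial_mul,
      one_mul, leadMap_monomial]
    congr 1
    unfold leadMonomial
    rw [← Finset.mul_prod_erase _ _ (Finset.mem_univ l),
      ← Finset.mul_prod_erase _ _ (Finset.mem_univ l), ← mul_assoc, ← mul_assoc]
    congr 1
    · simp only [Finsupp.add_apply, Finsupp.single_eq_same]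
      rw [Nat.add_div_left _ (Nat.pos_of_ne_zero hl), Nat.add_mod_left, pow_succ']
    · refine Finset.prod_congr rfl fun j hj => ?_
      have : j ≠ l := Finset.ne_of_mem_erase hj
      simp [this]
  | add f g hf hg => rw [mul_add, map_add, map_add, hf, hg, mul_add]

/-- The ideal generated by the `p l` with `N l ≠ 0`. -/
noncomputable def leadIdeal {σ : Type*} (N : σ → ℕ) (p : σ → MvPolynomial σ ℝ) :
    Ideal (MvPolynomial σ ℝ) :=
  Ideal.span (Set.range fun l : {l // N l ≠ 0} => p l)

theorem mem_leadIdeal {σ : Type*} (N : σ → ℕ) (p : σ → MvPolynomial σ ℝ) {l : σ} (hl : N l ≠ 0) :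
    p l ∈ leadIdeal N p :=
  Ideal.subset_span ⟨⟨l, hl⟩, rfl⟩

/-- No monomial of `f` is divisible by some `X l ^ N l`, `N l ≠ 0`. -/
def IsReducedBy {σ : Type*} (N : σ → ℕ) (f : MvPolynomial σ ℝ) : Prop :=
  ∀ κ ∈ f.support, ∀ l, N l ≠ 0 → κ l < N l

theorem exists_isReducedBy {σ : Type*} [Fintype σ] {N : σ → ℕ} {p : σ → MvPolynomial σ ℝ}
    (hp : ∀ l, N l ≠ 0 → p l - X l ^ N l ∈ degreeLT σ (N l)) {f : MvPolynomial σ ℝ} :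
    ∃ g, f - g ∈ leadIdeal N p ∧ g.totalDegree ≤ f.totalDegree ∧ IsReducedBy N g := by
  classical
  obtain ⟨h, hh, hf⟩ := leadMap_surjective hp (mem_degreeLT_succ.2 (le_refl f.totalDegree))
  let s := h.support.filter fun κ => ∀ l, N l ≠ 0 → κ l < N l
  have hmem : ∀ κ, (∃ l, N l ≠ 0 ∧ N l ≤ κ l) → leadMonomial N p κ ∈ leadIdeal N p := by
    rintro κ ⟨l, hl, hκ⟩
    unfold leadMonomial
    rw [← Finset.mul_prod_erase _ _ (Finset.mem_univ l)]
    refine Ideal.mul_mem_right _ _ (Ideal.mul_mem_right _ _ ?_)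
    exact Ideal.pow_mem_of_mem _ (mem_leadIdeal N p hl) _ (Nat.div_pos hκ (Nat.pos_of_ne_zero hl))
  have hred : ∀ κ, (∀ l, N l ≠ 0 → κ l < N l) → leadMonomial N p κ = monomial κ 1 := by
    intro κ hκ
    rw [monomial_eq, C_1, one_mul, Finsupp.prod_fintype _ _ (by simp)]
    refine Finset.prod_congr rfl fun l _ => ?_
    by_cases hN : N l = 0
    · simp [hN]
    · rw [Nat.div_eq_of_lt (hκ l hN), Nat.mod_eq_of_lt (hκ l hN), pow_zero, one_mul]
  refine ⟨∑ κ ∈ s, monomial κ (coeff κ h), ?_, ?_, ?_⟩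
  · have h1 : f = ∑ κ ∈ h.support, coeff κ h • leadMonomial N p κ := by
      rw [← hf]
      conv_lhs => rw [h.as_sum]
      rw [map_sum]
      refine Finset.sum_congr rfl fun κ _ => ?_
      rw [show monomial κ (coeff κ h) = coeff κ h • monomial κ (1 : ℝ) by simp [smul_monomial],
        map_smul, leadMap_monomial]
    rw [h1, ← Finset.sum_filter_add_sum_filter_not h.support
      (fun κ => ∀ l, N l ≠ 0 → κ l < N l), add_sub_right_comm, ← Finset.sum_sub_distrib,
      Finset.sum_eq_zero, zero_add]
    · refine sum_mem fun κ hκ => ?_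
      have := (Finset.mem_filter.1 hκ).2
      push Not at this
      exact Submodule.smul_of_tower_mem _ _ (hmem κ this)
    · intro κ hκ
      rw [hred κ (Finset.mem_filter.1 hκ).2, smul_monomial, smul_eq_mul, mul_one, sub_self]
  · rw [← mem_degreeLT_succ]
    refine sum_mem fun κ hκ => mem_degreeLT.2 fun κ' hκ' => ?_
    have := support_monomial_subset hκ'
    rw [Finset.mem_singleton] at this
    rw [this]
    exact mem_degreeLT.1 hh κ (Finset.mem_filter.1 hκ).1
  · intro κ hκ
    have := support_sum hκ
    rw [Finset.mem_biUnion] at this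
    obtain ⟨κ', h1, h2⟩ := this
    have := support_monomial_subset h2
    rw [Finset.mem_singleton] at this
    rw [this]
    exact (Finset.mem_filter.1 h1).2

theorem eq_zero_of_isReducedBy {σ : Type*} [Fintype σ] {N : σ → ℕ} {p : σ → MvPolynomial σ ℝ}
    (hp : ∀ l, N l ≠ 0 → p l - X l ^ N l ∈ degreeLT σ (N l)) {f : MvPolynomial σ ℝ}
    (hf : f ∈ leadIdeal N p) (hr : IsReducedBy N f) : f = 0 := by
  classical
  rw [leadIdeal, Ideal.mem_span_range_iff_exists_fun] at hf
  obtain ⟨c, hc⟩ := hf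
  choose g hg1 hg using fun l =>
    leadMap_surjective hp (mem_degreeLT_succ.2 (le_refl (c l).totalDegree))
  have h1 : leadMap N p (∑ l : {l // N l ≠ 0}, X l.1 ^ N l.1 * g l) = f := by
    rw [map_sum, ← hc]
    refine Finset.sum_congr rfl fun l _ => ?_
    rw [leadMap_X_pow_mul l.2, hg, mul_comm]
  have h2 : leadMap N p f = f := by
    conv_lhs => rw [f.as_sum]
    conv_rhs => rw [f.as_sum]
    rw [map_sum]
    refine Finset.sum_congr rfl fun κ hκ => ?_
    rw [show monomial κ (coeff κ f) = coeff κ f • monomial κ (1 : ℝ) by simp [smul_monomial],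
      map_smul, leadMap_monomial]
    congr 1
    rw [monomial_eq, C_1, one_mul, Finsupp.prod_fintype _ _ (by simp)]
    refine Finset.prod_congr rfl fun l _ => ?_
    by_cases hN : N l = 0
    · simp [hN]
    · rw [Nat.div_eq_of_lt (hr κ hκ l hN), Nat.mod_eq_of_lt (hr κ hκ l hN), pow_zero, one_mul]
  have h3 := leadMap_injective hp (h1.trans h2.symm)
  rw [← support_eq_empty]
  refine Finset.eq_empty_of_forall_notMem fun κ hκ => ?_
  have h4 := hκ
  rw [← h3] at h4
  obtain ⟨l, _, hl⟩ := Finset.mem_biUnion.1 (support_sum h4)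
  have h5 := hr κ hκ l.1 l.2
  rw [X_pow_eq_monomial, mem_support_iff, coeff_monomial_mul'] at hl
  split_ifs at hl with h6
  · have := h6 l.1
    simp at this
    omega
  · exact hl rfl

end DegreeReduction

section Fiber

/-- The points `x` and `y` have the same coordinates of index less than `i`. -/
def Agr {m : ℕ} (i : ℕ) (x y : Fin m → ℝ) : Prop :=
  ∀ l : Fin m, (l : ℕ) < i → x l = y l

/-- The value of `f` depends only on the coordinates of index less than `i`. -/
def Dep {m : ℕ} (i : ℕ) (f : MvPolynomial (Fin m) ℝ) : Prop :=
  ∀ x y : Fin m → ℝ, Agr i x y → eval x f = eval y f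

/-- Exponents of the leading monomials of the equations of a fibre. -/
def fiberExp (m i n : ℕ) (l : Fin m) : ℕ := if i ≤ (l : ℕ) then n else 1

/-- Equations of a fibre. -/
noncomputable def fiberEq {m : ℕ} (i : ℕ) (p : Fin m → MvPolynomial (Fin m) ℝ) (x : Fin m → ℝ)
    (l : Fin m) : MvPolynomial (Fin m) ℝ := if i ≤ (l : ℕ) then p l else X l - C (x l)

/-- The ideal of a fibre. -/
noncomputable def fiberIdeal {m : ℕ} (i n : ℕ) (p : Fin m → MvPolynomial (Fin m) ℝ)
    (x : Fin m → ℝ) : Ideal (MvPolynomial (Fin m) ℝ) :=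
  leadIdeal (fiberExp m i n) (fiberEq i p x)

/-- The coordinate algebra of a fibre. -/
abbrev FiberAlg {m : ℕ} (i n : ℕ) (p : Fin m → MvPolynomial (Fin m) ℝ) (x : Fin m → ℝ) : Type :=
  MvPolynomial (Fin m) ℝ ⧸ fiberIdeal i n p x

/-- Exponents of the standard monomials of a fibre. -/
abbrev FiberIdx (m i n : ℕ) : Type := {l : Fin m // i ≤ (l : ℕ)} → Fin n

/-- The exponent vector of a standard monomial. -/
noncomputable def fiberMon {m i n : ℕ} (μ : FiberIdx m i n) : Fin m →₀ ℕ :=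
  Finsupp.equivFunOnFinite.symm fun l => if h : i ≤ (l : ℕ) then μ ⟨l, h⟩ else 0

theorem Agr.symm {m i : ℕ} {x y : Fin m → ℝ} (h : Agr i x y) : Agr i y x :=
  fun l hl => (h l hl).symm

theorem Agr.refl {m : ℕ} (i : ℕ) (x : Fin m → ℝ) : Agr i x x := fun _ _ => rfl

theorem Agr.trans {m i : ℕ} {x y z : Fin m → ℝ} (h : Agr i x y) (h' : Agr i y z) : Agr i x z :=
  fun l hl => (h l hl).trans (h' l hl)

theorem Agr.mono {m i j : ℕ} (hij : i ≤ j) {x y : Fin m → ℝ} (h : Agr j x y) : Agr i x y :=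
  fun l hl => h l (hl.trans_le hij)

theorem fiberIdeal_congr {m i : ℕ} (n : ℕ) (p : Fin m → MvPolynomial (Fin m) ℝ)
    {x y : Fin m → ℝ} (h : Agr i x y) : fiberIdeal i n p x = fiberIdeal i n p y := by
  have : fiberEq i p x = fiberEq i p y := by
    funext l
    unfold fiberEq
    split_ifs with hl
    · rfl
    · rw [h l (not_le.1 hl)]
  rw [fiberIdeal, fiberIdeal, this]

theorem fiberEq_lead {m i n : ℕ} {p : Fin m → MvPolynomial (Fin m) ℝ}
    (hp : ∀ l : Fin m, i ≤ (l : ℕ) → p l - X l ^ n ∈ degreeLT (Fin m) n) (x : Fin m → ℝ)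
    (l : Fin m) (_ : fiberExp m i n l ≠ 0) :
    fiberEq i p x l - X l ^ fiberExp m i n l ∈ degreeLT (Fin m) (fiberExp m i n l) := by
  unfold fiberEq fiberExp
  split_ifs with hl
  · exact hp l hl
  · rw [pow_one, sub_sub_cancel_left, Submodule.neg_mem_iff, ← zero_add 1, mem_degreeLT_succ,
      totalDegree_C]

theorem mem_fiberIdeal_of_le {m i n : ℕ} (hn : n ≠ 0) (p : Fin m → MvPolynomial (Fin m) ℝ)
    (x : Fin m → ℝ) {l : Fin m} (hl : i ≤ (l : ℕ)) : p l ∈ fiberIdeal i n p x := by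
  have := mem_leadIdeal (fiberExp m i n) (fiberEq i p x) (l := l) (by simp [fiberExp, hl, hn])
  rwa [fiberEq, if_pos hl] at this

theorem mem_fiberIdeal_of_lt {m i : ℕ} (n : ℕ) (p : Fin m → MvPolynomial (Fin m) ℝ)
    (x : Fin m → ℝ) {l : Fin m} (hl : (l : ℕ) < i) : X l - C (x l) ∈ fiberIdeal i n p x := by
  have := mem_leadIdeal (fiberExp m i n) (fiberEq i p x) (l := l) 
    (by simp [fiberExp, not_le.2 hl])
  rwa [fiberEq, if_neg (not_le.2 hl)] at this

theorem fiberMon_injective {m i n : ℕ} :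
    Function.Injective (fiberMon : FiberIdx m i n → Fin m →₀ ℕ) := by
  intro μ ν h
  funext l
  have := DFunLike.congr_fun h l.1
  simp only [fiberMon, Finsupp.equivFunOnFinite_symm_apply_apply, l.2, dite_true] at this
  exact Fin.ext this

/-- Reduction to standard monomials, uniformly in the fibres. -/
theorem exists_fiber_reduction {m i n : ℕ} (hn : n ≠ 0) {p : Fin m → MvPolynomial (Fin m) ℝ}
    (hp : ∀ l : Fin m, i ≤ (l : ℕ) → p l - X l ^ n ∈ degreeLT (Fin m) n)
    (f : MvPolynomial (Fin m) ℝ) :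
    ∃ r : FiberIdx m i n → MvPolynomial (Fin m) ℝ,
      (∀ μ, r μ ≠ 0 → (r μ).totalDegree + (fiberMon μ).degree ≤ f.totalDegree) ∧
      (∀ μ, Dep i (r μ)) ∧ ∀ x, Ideal.Quotient.mk (fiberIdeal i n p x) f =
        ∑ μ, eval x (r μ) • Ideal.Quotient.mk (fiberIdeal i n p x) (monomial (fiberMon μ) 1) := by
  classical
  let N : Fin m → ℕ := fun l => if i ≤ (l : ℕ) then n else 0
  have hN : ∀ l, N l ≠ 0 → i ≤ (l : ℕ) ∧ N l = n := by
    intro l h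
    by_cases hl : i ≤ (l : ℕ)
    · exact ⟨hl, by simp [N, hl]⟩
    · exact absurd (by simp [N, hl]) h
  have hNn : ∀ l : Fin m, i ≤ (l : ℕ) → N l = n := fun l hl => by simp [N, hl]
  obtain ⟨g, hfg, hdeg, hred⟩ := exists_isReducedBy (N := N) (p := p)
    (fun l hl => by rw [(hN l hl).2]; exact hp l (hN l hl).1) (f := f)
  have hle : ∀ x, leadIdeal N p ≤ fiberIdeal i n p x := by
    intro x
    rw [leadIdeal, Ideal.span_le]
    rintro _ ⟨l, rfl⟩
    exact mem_fiberIdeal_of_le hn p x (hN l l.2).1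
  let low : (Fin m →₀ ℕ) → (Fin m →₀ ℕ) := fun κ => κ.filter fun l => (l : ℕ) < i
  let top : (Fin m →₀ ℕ) → (Fin m →₀ ℕ) := fun κ => κ.filter fun l => ¬ (l : ℕ) < i
  have hlt : ∀ κ, low κ + top κ = κ := fun κ => Finsupp.filter_add_filter_not κ _
  refine ⟨fun μ => ∑ κ ∈ g.support with top κ = fiberMon μ, monomial (low κ) (coeff κ g), ?_, ?_, ?_⟩
  · intro μ hμ
    obtain ⟨κ0, hκ0⟩ : ∃ κ, κ ∈ g.support.filter fun κ => top κ = fiberMon μ := by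
      by_contra! h
      exact hμ (Finset.sum_eq_zero fun κ hκ => absurd hκ (h κ))
    have hD : ∀ κ ∈ g.support.filter fun κ => top κ = fiberMon μ,
        (low κ).degree + (fiberMon μ).degree ≤ f.totalDegree := by
      intro κ hκ
      obtain ⟨h1, h2⟩ := Finset.mem_filter.1 hκ
      rw [← h2, ← map_add, hlt]
      exact (mem_degreeLT.1 (mem_degreeLT_succ.2 le_rfl) κ h1 |> Nat.lt_succ_iff.1).trans hdeg
    have : (∑ κ ∈ g.support with top κ = fiberMon μ,
        monomial (low κ) (coeff κ g)).totalDegree ≤ f.totalDegree - (fiberMon μ).degree := by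
      refine totalDegree_finsetSum_le fun κ hκ => (totalDegree_monomial_le _ _).trans ?_
      have := hD κ hκ
      change (low κ).degree ≤ _
      omega
    have := hD κ0 hκ0
    beta_reduce
    omega
  · intro μ x y hxy
    simp only [map_sum, eval_monomial]
    refine Finset.sum_congr rfl fun κ _ => congrArg _ (Finsupp.prod_congr fun l hl => ?_)
    have hl' : (l : ℕ) < i := by
      by_contra h
      exact (Finsupp.mem_support_iff.1 hl) (Finsupp.filter_apply_neg _ _ h)
    rw [hxy l hl']
  · intro x
    rw [(Ideal.Quotient.eq).2 (hle x hfg)]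
    have hlow : ∀ κ : Fin m →₀ ℕ, ∀ a : ℝ,
        Ideal.Quotient.mk (fiberIdeal i n p x) (monomial (low κ) a) =
        Ideal.Quotient.mk (fiberIdeal i n p x) (C (eval x (monomial (low κ) a))) := by
      intro κ a
      rw [monomial_eq, eval_mul, eval_C, C_mul, map_mul, map_mul]
      congr 1
      rw [Finsupp.prod, map_prod, map_prod, map_prod, map_prod]
      refine Finset.prod_congr rfl fun l hl => ?_
      have hl' : (l : ℕ) < i := by
        by_contra h
        exact (Finsupp.mem_support_iff.1 hl) (Finsupp.filter_apply_neg _ _ h)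
      rw [map_pow, map_pow, eval_X, map_pow, map_pow,
        (Ideal.Quotient.eq).2 (mem_fiberIdeal_of_lt n p x hl')]
    have hterm : ∀ κ ∈ g.support, ∃ μ : FiberIdx m i n, top κ = fiberMon μ := by
      intro κ hκ
      refine ⟨fun l => ⟨κ l, ?_⟩, ?_⟩
      · have := hred κ hκ l.1 (by rw [hNn _ l.2]; exact hn)
        rwa [hNn _ l.2] at this
      · ext l
        by_cases h : (l : ℕ) < i
        · simp [top, fiberMon, not_le.2 h]
        · simp [top, fiberMon, not_lt.1 h]
    conv_lhs => rw [g.as_sum, map_sum]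
    simp only [map_sum, Finset.sum_smul, Finset.sum_filter]
    rw [Finset.sum_comm]
    refine Finset.sum_congr rfl fun κ hκ => ?_
    obtain ⟨μ, hμ⟩ := hterm κ hκ
    rw [Finset.sum_eq_single μ, if_pos hμ, ← hμ]
    · conv_lhs => rw [← hlt κ, ← mul_one (coeff (low κ + top κ) g), ← monomial_mul, map_mul, hlow]
      rw [hlt κ, ← map_mul, ← smul_eq_C_mul]
      rfl
    · intro ν _ hν
      rw [if_neg fun h => hν (fiberMon_injective (h.symm.trans hμ)), map_zero, zero_smul]
    · simp

theorem fiber_linearIndependent {m i n : ℕ} {p : Fin m → MvPolynomial (Fin m) ℝ}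
    (hp : ∀ l : Fin m, i ≤ (l : ℕ) → p l - X l ^ n ∈ degreeLT (Fin m) n) (x : Fin m → ℝ) :
    LinearIndependent ℝ fun μ : FiberIdx m i n =>
      Ideal.Quotient.mk (fiberIdeal i n p x) (monomial (fiberMon μ) 1) := by
  classical
  rw [Fintype.linearIndependent_iff]
  intro c hc μ
  have h1 : (∑ μ : FiberIdx m i n, monomial (fiberMon μ) (c μ)) ∈ fiberIdeal i n p x := by
    rw [← Ideal.Quotient.eq_zero_iff_mem, ← hc, map_sum]
    refine Finset.sum_congr rfl fun μ _ => ?_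
    rw [← mul_one (c μ), ← smul_eq_mul, ← smul_monomial, smul_eq_mul, mul_one]
    rfl
  have h2 := eq_zero_of_isReducedBy (fiberEq_lead hp x) h1 ?_
  · have h3 := congrArg (coeff (fiberMon μ)) h2
    rw [coeff_sum, Finset.sum_eq_single μ] at h3
    · simpa using h3
    · intro ν _ hν
      rw [coeff_monomial, if_neg fun h => hν (fiberMon_injective h)]
    · simp
  · intro κ hκ l _
    obtain ⟨ν, _, hν⟩ := Finset.mem_biUnion.1 (support_sum hκ)
    rw [Finset.mem_singleton.1 (support_monomial_subset hν)]
    unfold fiberExp fiberMon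
    by_cases h : i ≤ (l : ℕ) <;> simp [h]

/-- The basis of standard monomials of the algebra of a fibre. -/
noncomputable def fiberBasis {m i n : ℕ} (hn : n ≠ 0) {p : Fin m → MvPolynomial (Fin m) ℝ}
    (hp : ∀ l : Fin m, i ≤ (l : ℕ) → p l - X l ^ n ∈ degreeLT (Fin m) n) (x : Fin m → ℝ) :
    Module.Basis (FiberIdx m i n) ℝ (FiberAlg i n p x) :=
  Module.Basis.mk (fiber_linearIndependent hp x) (by
    rintro b -
    obtain ⟨f, rfl⟩ := Ideal.Quotient.mk_surjective b
    obtain ⟨r, -, -, hr⟩ := exists_fiber_reduction hn hp f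
    rw [hr x]
    exact sum_mem fun μ _ => Submodule.smul_mem _ _ (Submodule.subset_span ⟨μ, rfl⟩))

theorem fiberBasis_apply {m i n : ℕ} (hn : n ≠ 0) {p : Fin m → MvPolynomial (Fin m) ℝ}
    (hp : ∀ l : Fin m, i ≤ (l : ℕ) → p l - X l ^ n ∈ degreeLT (Fin m) n) (x : Fin m → ℝ)
    (μ : FiberIdx m i n) :
    fiberBasis hn hp x μ = Ideal.Quotient.mk (fiberIdeal i n p x) (monomial (fiberMon μ) 1) := by
  simp [fiberBasis]

theorem fiberMon_degree_le {m i n : ℕ} (μ : FiberIdx m i n) : (fiberMon μ).degree ≤ m * n := by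
  rw [Finsupp.degree_eq_sum]
  refine (Finset.sum_le_card_nsmul Finset.univ _ n fun l _ => ?_).trans (by simp)
  unfold fiberMon
  by_cases h : i ≤ (l : ℕ) <;> simp [h]

end Fiber

section Elimination

/-- The points of the fibre over `x`. -/
def fiberSet {m : ℕ} (i : ℕ) (p : Fin m → MvPolynomial (Fin m) ℝ) (x : Fin m → ℝ) :
    Set (Fin m → ℝ) :=
  {ξ | Agr i x ξ ∧ ∀ l : Fin m, i ≤ (l : ℕ) → eval ξ (p l) = 0}

/-- The point defined by a character of the algebra of a fibre. -/
noncomputable def fiberPoint {m i n : ℕ} {p : Fin m → MvPolynomial (Fin m) ℝ} {x : Fin m → ℝ}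
    (φ : FiberAlg i n p x →ₐ[ℝ] ℝ) (l : Fin m) : ℝ :=
  φ (Ideal.Quotient.mk (fiberIdeal i n p x) (X l))

theorem apply_mk_eq_eval_fiberPoint {m i n : ℕ} {p : Fin m → MvPolynomial (Fin m) ℝ}
    {x : Fin m → ℝ} (φ : FiberAlg i n p x →ₐ[ℝ] ℝ) (f : MvPolynomial (Fin m) ℝ) :
    φ (Ideal.Quotient.mk (fiberIdeal i n p x) f) = eval (fiberPoint φ) f := by
  have : φ.comp (Ideal.Quotient.mkₐ ℝ (fiberIdeal i n p x)) = aeval (fiberPoint φ) := by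
    ext l
    simp [fiberPoint]
  have h := DFunLike.congr_fun this f
  simpa using h

theorem fiberPoint_mem {m i n : ℕ} (hn : n ≠ 0) {p : Fin m → MvPolynomial (Fin m) ℝ}
    {x : Fin m → ℝ} (φ : FiberAlg i n p x →ₐ[ℝ] ℝ) : fiberPoint φ ∈ fiberSet i p x := by
  refine ⟨fun l hl => ?_, fun l hl => ?_⟩
  · have := apply_mk_eq_eval_fiberPoint φ (X l - C (x l))
    rw [Ideal.Quotient.eq_zero_iff_mem.2 (mem_fiberIdeal_of_lt n p x hl), map_zero, eval_sub,
      eval_X, eval_C] at this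
    linarith
  · rw [← apply_mk_eq_eval_fiberPoint φ,
      Ideal.Quotient.eq_zero_iff_mem.2 (mem_fiberIdeal_of_le hn p x hl), map_zero]

theorem eval_eq_zero_of_mem_fiberIdeal {m i n : ℕ} {p : Fin m → MvPolynomial (Fin m) ℝ}
    {x ξ : Fin m → ℝ} (hξ : ξ ∈ fiberSet i p x) {f : MvPolynomial (Fin m) ℝ}
    (hf : f ∈ fiberIdeal i n p x) : eval ξ f = 0 := by
  have : fiberIdeal i n p x ≤ RingHom.ker (eval ξ) := by
    rw [fiberIdeal, leadIdeal, Ideal.span_le]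
    rintro _ ⟨l, rfl⟩
    simp only [SetLike.mem_coe, RingHom.mem_ker, fiberEq]
    split_ifs with h
    · exact hξ.2 l h
    · simp [hξ.1 l (not_le.1 h)]
  exact this hf

theorem exists_fiberPoint_eq {m i : ℕ} (n : ℕ) {p : Fin m → MvPolynomial (Fin m) ℝ}
    {x ξ : Fin m → ℝ} (hξ : ξ ∈ fiberSet i p x) :
    ∃ φ : FiberAlg i n p x →ₐ[ℝ] ℝ, fiberPoint φ = ξ := by
  refine ⟨Ideal.Quotient.liftₐ (fiberIdeal i n p x) (aeval ξ) fun f hf => ?_, ?_⟩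
  · change eval ξ f = 0
    exact eval_eq_zero_of_mem_fiberIdeal hξ hf
  · funext l
    simp [fiberPoint]

/-- The trace of multiplication by `f` in the fibres, as a polynomial on the base. -/
theorem exists_trace_polynomial {m i n : ℕ} (hn : n ≠ 0) {p : Fin m → MvPolynomial (Fin m) ℝ}
    (hp : ∀ l : Fin m, i ≤ (l : ℕ) → p l - X l ^ n ∈ degreeLT (Fin m) n)
    (f : MvPolynomial (Fin m) ℝ) :
    ∃ t : MvPolynomial (Fin m) ℝ, t.totalDegree ≤ f.totalDegree ∧
      ∀ x, eval x t =
        Algebra.trace ℝ (FiberAlg i n p x) (Ideal.Quotient.mk (fiberIdeal i n p x) f) := by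
  choose r hdeg _ hr using fun μ : FiberIdx m i n =>
    exists_fiber_reduction hn hp (f * monomial (fiberMon μ) 1)
  refine ⟨∑ μ, r μ μ, totalDegree_finsetSum_le fun μ _ => ?_, fun x => ?_⟩
  · by_cases h : r μ μ = 0
    · simp [h]
    · have h1 := hdeg μ μ h
      have h2 : (f * monomial (fiberMon μ) 1).totalDegree ≤
          f.totalDegree + (fiberMon μ).degree :=
        (totalDegree_mul _ _).trans (Nat.add_le_add_left (totalDegree_monomial_le _ _) _)
      omega
  · classical
    rw [Algebra.trace_eq_matrix_trace (fiberBasis hn hp x), Matrix.trace, map_sum]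
    refine Finset.sum_congr rfl fun μ _ => ?_
    rw [Matrix.diag_apply, Algebra.leftMulMatrix_eq_repr_mul, fiberBasis_apply, ← map_mul, hr]
    simp_rw [← fiberBasis_apply hn hp x]
    rw [Module.Basis.repr_sum_self]

/-- All coefficients of `f` have total degree at most `D`. -/
def CoeffDegreeLE {σ : Type*} (D : ℕ) (f : Polynomial (MvPolynomial σ ℝ)) : Prop :=
  ∀ k, (f.coeff k).totalDegree ≤ D

theorem CoeffDegreeLE.mul {σ : Type*} {D E : ℕ} {f g : Polynomial (MvPolynomial σ ℝ)}
    (hf : CoeffDegreeLE D f) (hg : CoeffDegreeLE E g) : CoeffDegreeLE (D + E) (f * g) := by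
  intro k
  rw [Polynomial.coeff_mul]
  exact totalDegree_finsetSum_le fun x _ =>
    (totalDegree_mul _ _).trans (add_le_add (hf _) (hg _))

theorem CoeffDegreeLE.prod {σ τ : Type*} {D : τ → ℕ} (s : Finset τ)
    {f : τ → Polynomial (MvPolynomial σ ℝ)} (hf : ∀ l ∈ s, CoeffDegreeLE (D l) (f l)) :
    CoeffDegreeLE (∑ l ∈ s, D l) (∏ l ∈ s, f l) := by
  classical
  induction s using Finset.induction_on with
  | empty =>
    intro k
    rw [Finset.prod_empty, Polynomial.coeff_one]
    split_ifs <;> simp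
  | insert l s hl ih =>
    rw [Finset.sum_insert hl, Finset.prod_insert hl]
    exact (hf l (Finset.mem_insert_self _ _)).mul
      (ih fun j hj => hf j (Finset.mem_insert_of_mem hj))

theorem CoeffDegreeLE.sum {σ τ : Type*} {D : ℕ} (s : Finset τ)
    {f : τ → Polynomial (MvPolynomial σ ℝ)} (hf : ∀ l ∈ s, CoeffDegreeLE D (f l)) :
    CoeffDegreeLE D (∑ l ∈ s, f l) := by
  intro k
  rw [Polynomial.finsetSum_coeff]
  exact totalDegree_finsetSum_le fun l hl => hf l hl k

theorem CoeffDegreeLE.charpoly {σ ι : Type*} [Fintype ι] [DecidableEq ι] {D : ℕ}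
    {A : Matrix ι ι (MvPolynomial σ ℝ)} (hA : ∀ i j, (A i j).totalDegree ≤ D) :
    CoeffDegreeLE (Fintype.card ι * D) A.charpoly := by
  rw [Matrix.charpoly, Matrix.det_apply]
  refine CoeffDegreeLE.sum _ fun τ _ k => ?_
  have h : CoeffDegreeLE (Fintype.card ι * D) (∏ i, A.charmatrix (τ i) i) := by
    have := CoeffDegreeLE.prod (D := fun _ : ι => D) Finset.univ
      (f := fun i => A.charmatrix (τ i) i) ?_
    · simpa using this
    · intro i _ k
      rw [Matrix.charmatrix_apply, Polynomial.coeff_sub, Polynomial.coeff_C]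
      refine (totalDegree_sub _ _).trans (max_le ?_ ?_)
      · rw [Matrix.diagonal_apply]
        split_ifs
        · rw [Polynomial.coeff_X]
          split_ifs <;> simp
        · simp
      · split_ifs
        · exact hA _ _
        · simp
  rw [Polynomial.coeff_smul]
  rcases Int.units_eq_one_or (Equiv.Perm.sign τ) with h1 | h1 <;> rw [h1]
  · simpa using h k
  · simpa [Units.smul_def] using h k

/-- Sign determination at the points of a fibre. -/
theorem exists_sign_determination_fiber {m i n : ℕ} (hn : n ≠ 0)
    {p : Fin m → MvPolynomial (Fin m) ℝ}
    (hp : ∀ l : Fin m, i ≤ (l : ℕ) → p l - X l ^ n ∈ degreeLT (Fin m) n)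
    {Fam : Set (MvPolynomial (Fin m) ℝ)} (hF : Fam.Finite) {b L : ℕ}
    (hb : ∀ f ∈ Fam, f.totalDegree ≤ b) (hL : 2 * Fintype.card (FiberIdx m i n) ≤ 2 ^ L) :
    ∃ G : Set (MvPolynomial (Fin m) ℝ), G.Finite ∧
      (∀ g ∈ G, g.totalDegree ≤
        Fintype.card (FiberIdx m i n) * (L * (2 * b) + 2 * (m * n))) ∧
      (∀ g ∈ G, Dep i g) ∧
      ∀ x x' : Fin m → ℝ,
        (∀ g ∈ G, SignType.sign (eval x g) = SignType.sign (eval x' g)) →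
        ∀ ξ ∈ fiberSet i p x, ∃ ξ' ∈ fiberSet i p x',
          ∀ f ∈ Fam, SignType.sign (eval ξ' f) = SignType.sign (eval ξ f) := by
  classical
  have : Fintype Fam := hF.fintype
  choose t ht1 ht using exists_trace_polynomial hn hp
  let Hm : MvPolynomial (Fin m) ℝ → Matrix (FiberIdx m i n) (FiberIdx m i n)
      (MvPolynomial (Fin m) ℝ) := fun f => Matrix.of fun μ ν =>
        t (f * (monomial (fiberMon μ) 1 * monomial (fiberMon ν) 1))
  let pr : (Fam → Fin 3) → MvPolynomial (Fin m) ℝ := fun a => ∏ f, f.1 ^ (a f : ℕ)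
  let I : Set (Fam → Fin 3) := {a | (Finset.univ.filter fun f => (a f : ℕ) ≠ 0).card ≤ L}
  have hmap : ∀ f x, (Hm f).map (eval x) = Matrix.of fun μ ν =>
      Algebra.trace ℝ (FiberAlg i n p x) (Ideal.Quotient.mk _ f *
        (fiberBasis hn hp x μ * fiberBasis hn hp x ν)) := by
    intro f x
    ext μ ν
    simp only [Hm, ht, fiberBasis_apply, Matrix.map_apply, Matrix.of_apply, map_mul]
  have hcoef : ∀ f x k, eval x ((Hm f).charpoly.coeff k) =
      ((Hm f).map (eval x)).charpoly.coeff k := by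
    intro f x k
    rw [Matrix.charpoly_map, Polynomial.coeff_map]
  refine ⟨⋃ a ∈ I, ((Hm (pr a)).charpoly.coeffs : Set _), ?_, ?_, ?_, ?_⟩
  · exact (Set.toFinite I).biUnion fun a _ => Finset.finite_toSet _
  · intro g hg
    simp only [Set.mem_iUnion] at hg
    obtain ⟨a, ha, hg⟩ := hg
    obtain ⟨k, -, rfl⟩ := Polynomial.mem_coeffs_iff.1 hg
    refine CoeffDegreeLE.charpoly (fun μ ν => (ht1 _).trans ?_) k
    have h1 : (pr a).totalDegree ≤ L * (2 * b) := by
      refine (totalDegree_finsetProd _ _).trans ?_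
      rw [← Finset.sum_filter_add_sum_filter_not Finset.univ (fun f => (a f : ℕ) ≠ 0)]
      rw [Finset.sum_eq_zero (s := Finset.univ.filter fun f => ¬ (a f : ℕ) ≠ 0), add_zero]
      · refine (Finset.sum_le_card_nsmul _ _ (2 * b) fun f _ => ?_).trans ?_
        · refine (totalDegree_pow _ _).trans (Nat.mul_le_mul ?_ (hb _ f.2))
          omega
        · exact Nat.mul_le_mul_right _ ha
      · intro f hf
        have := (Finset.mem_filter.1 hf).2
        rw [not_not.1 this, pow_zero, totalDegree_one]
    have h2 : ∀ μ : FiberIdx m i n,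
        (monomial (fiberMon μ) (1 : ℝ)).totalDegree ≤ m * n :=
      fun μ => (totalDegree_monomial_le _ _).trans (fiberMon_degree_le μ)
    refine (totalDegree_mul _ _).trans (add_le_add h1 ((totalDegree_mul _ _).trans ?_))
    have := h2 μ
    have := h2 ν
    omega
  · intro g hg
    simp only [Set.mem_iUnion] at hg
    obtain ⟨a, ha, hg⟩ := hg
    obtain ⟨k, -, rfl⟩ := Polynomial.mem_coeffs_iff.1 hg
    intro x y hxy
    have : (Hm (pr a)).map (eval x) = (Hm (pr a)).map (eval y) := by
      ext μ ν
      simp only [Matrix.map_apply, Hm, Matrix.of_apply, ht]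
      exact congrArg (fun J : Ideal (MvPolynomial (Fin m) ℝ) =>
        Algebra.trace ℝ (MvPolynomial (Fin m) ℝ ⧸ J) (Ideal.Quotient.mk J
          (pr a * (monomial (fiberMon μ) 1 * monomial (fiberMon ν) 1))))
        (fiberIdeal_congr n p hxy)
    rw [hcoef, hcoef, this]
  · intro x x' hsign ξ hξ
    have hfin : ∀ x, Module.Finite ℝ (FiberAlg i n p x) := fun x =>
      Module.Finite.of_basis (fiberBasis hn hp x)
    have := hfin x
    have := hfin x'
    have : Finite (FiberAlg i n p x →ₐ[ℝ] ℝ) := inferInstance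
    have : Finite (FiberAlg i n p x' →ₐ[ℝ] ℝ) := inferInstance
    have := Fintype.ofFinite (FiberAlg i n p x →ₐ[ℝ] ℝ)
    have := Fintype.ofFinite (FiberAlg i n p x' →ₐ[ℝ] ℝ)
    have hcard : ∀ x [Fintype (FiberAlg i n p x →ₐ[ℝ] ℝ)],
        Fintype.card (FiberAlg i n p x →ₐ[ℝ] ℝ) ≤ Fintype.card (FiberIdx m i n) := by
      intro x _
      have := hfin x
      rw [← Module.finrank_eq_card_basis (fiberBasis hn hp x), ← Nat.card_eq_fintype_card]
      exact card_algHom_le_finrank _ _ _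
    have hsum : ∀ x [Fintype (FiberAlg i n p x →ₐ[ℝ] ℝ)] (a : Fam → Fin 3),
        ∑ φ : FiberAlg i n p x →ₐ[ℝ] ℝ, ∏ f : Fam,
          (SignType.sign (eval (fiberPoint φ) f.1) : ℤ) ^ (a f : ℕ) =
        (sigPos ((Hm (pr a)).map (eval x)).toQuadraticForm' : ℤ) -
          sigNeg ((Hm (pr a)).map (eval x)).toQuadraticForm' := by
      intro x _ a
      have := hfin x
      rw [hmap, sigPos_sub_sigNeg_trace]
      refine Finset.sum_congr rfl fun φ _ => ?_
      rw [apply_mk_eq_eval_fiberPoint, map_prod]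
      have h1 : SignType.sign (∏ f : Fam, eval (fiberPoint φ) (f.1 ^ (a f : ℕ))) =
          ∏ f : Fam, SignType.sign (eval (fiberPoint φ) f.1) ^ (a f : ℕ) := by
        have := map_prod (signHom : ℝ →*₀ SignType)
          (fun f : Fam => eval (fiberPoint φ) (f.1 ^ (a f : ℕ))) Finset.univ
        refine this.trans (Finset.prod_congr rfl fun f _ => ?_)
        rw [map_pow, map_pow]; rfl
      rw [h1]
      have h2 := map_prod (SignType.castHom : SignType →*₀ ℤ)
        (fun f : Fam => SignType.sign (eval (fiberPoint φ) f.1) ^ (a f : ℕ)) Finset.univ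
      refine (Eq.symm (h2.trans (Finset.prod_congr rfl fun f _ => ?_)))
      rw [map_pow]; rfl
    have hsymm : ∀ f x, ((Hm f).map (eval x)).IsHermitian := by
      intro f x
      ext μ ν
      simp only [Hm, Matrix.conjTranspose_apply, Matrix.map_apply, Matrix.of_apply, star_trivial]
      rw [mul_comm (monomial (fiberMon ν) (1 : ℝ))]
    obtain ⟨φ, rfl⟩ := exists_fiberPoint_eq n hξ
    obtain ⟨φ', hφ'⟩ := exists_eq_of_sum_prod_sign
      (fun (φ : FiberAlg i n p x →ₐ[ℝ] ℝ) (f : Fam) => SignType.sign (eval (fiberPoint φ) f.1))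
      (fun (φ : FiberAlg i n p x' →ₐ[ℝ] ℝ) (f : Fam) => SignType.sign (eval (fiberPoint φ) f.1))
      L (by have := hcard x; have := hcard x'; omega) (fun a ha2 haL => by
        let a' : Fam → Fin 3 := fun f => ⟨a f, Nat.lt_succ_iff.2 (ha2 f)⟩
        have h1 := hsum x a'
        have h2 := hsum x' a'
        have h3 := sigPos_sigNeg_congr (hsymm (pr a') x) (hsymm (pr a') x') (fun k => by
          rw [← hcoef, ← hcoef]
          by_cases h0 : (Hm (pr a')).charpoly.coeff k = 0
          · simp only [h0, map_zero (eval _)]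
          · refine hsign _ ?_
            simp only [Set.mem_iUnion]
            exact ⟨a', haL, Polynomial.coeff_mem_coeffs h0⟩)
        rw [← h3.1, ← h3.2, ← h1] at h2
        exact h2.symm) φ
    exact ⟨fiberPoint φ', fiberPoint_mem hn φ', fun f hf => congrFun hφ' ⟨f, hf⟩⟩

theorem Dep.eval_coeff_charpoly {m i : ℕ} {ι : Type*} [Fintype ι] [DecidableEq ι]
    {A : Matrix ι ι (MvPolynomial (Fin m) ℝ)} (hA : ∀ a b, Dep i (A a b)) (k : ℕ) :
    Dep i (A.charpoly.coeff k) := by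
  intro x y hxy
  have h : ∀ x, eval x (A.charpoly.coeff k) = (A.map (eval x)).charpoly.coeff k := fun x => by
    rw [Matrix.charpoly_map, Polynomial.coeff_map]
  rw [h, h]
  congr 2
  ext a b
  exact hA a b x y hxy

/-- A monic polynomial vanishing on a coordinate of the points of the fibres. -/
theorem exists_coordinate_polynomial {m i n : ℕ} (hn : n ≠ 0)
    {p : Fin m → MvPolynomial (Fin m) ℝ}
    (hp : ∀ l : Fin m, i ≤ (l : ℕ) → p l - X l ^ n ∈ degreeLT (Fin m) n) (l : Fin m) :
    ∃ χ : Polynomial (MvPolynomial (Fin m) ℝ), χ.Monic ∧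
      χ.natDegree = Fintype.card (FiberIdx m i n) ∧
      CoeffDegreeLE (Fintype.card (FiberIdx m i n) * (1 + m * n)) χ ∧
      (∀ k, Dep i (χ.coeff k)) ∧
      ∀ x, ∀ ξ ∈ fiberSet i p x, (χ.map (eval x)).eval (ξ l) = 0 := by
  classical
  choose r hdeg hdep hr using fun μ : FiberIdx m i n =>
    exists_fiber_reduction hn hp (X l * monomial (fiberMon μ) 1)
  let A : Matrix (FiberIdx m i n) (FiberIdx m i n) (MvPolynomial (Fin m) ℝ) :=
    Matrix.of fun μ ν => r ν μ
  refine ⟨A.charpoly, A.charpoly_monic, A.charpoly_natDegree_eq_dim,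
    CoeffDegreeLE.charpoly fun μ ν => ?_,
    fun k => Dep.eval_coeff_charpoly (fun μ ν => hdep ν μ) k, fun x ξ hξ => ?_⟩
  · by_cases h : r ν μ = 0
    · simp [A, h]
    · have h1 := hdeg ν μ h
      have h2 : (X l * monomial (fiberMon ν) (1 : ℝ)).totalDegree ≤ 1 + m * n :=
        (totalDegree_mul _ _).trans (add_le_add (totalDegree_X l).le
          ((totalDegree_monomial_le _ _).trans (fiberMon_degree_le ν)))
      exact (Nat.le_of_add_right_le h1).trans h2
  · have hA : A.map (eval x) = Algebra.leftMulMatrix (fiberBasis hn hp x)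
        (Ideal.Quotient.mk (fiberIdeal i n p x) (X l)) := by
      ext μ ν
      rw [Algebra.leftMulMatrix_eq_repr_mul, fiberBasis_apply, ← map_mul, hr]
      simp_rw [← fiberBasis_apply hn hp x]
      rw [Module.Basis.repr_sum_self]
      rfl
    rw [← Matrix.charpoly_map, hA]
    set M := Algebra.leftMulMatrix (fiberBasis hn hp x)
      (Ideal.Quotient.mk (fiberIdeal i n p x) (X l)) with hM
    have h1 := Matrix.aeval_self_charpoly M
    rw [hM, Polynomial.aeval_algHom_apply, ← hM] at h1
    have h2 := Algebra.leftMulMatrix_injective (fiberBasis hn hp x) (h1.trans (map_zero _).symm)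
    obtain ⟨φ, rfl⟩ := exists_fiberPoint_eq n hξ
    have h3 := congrArg φ h2
    rw [← Polynomial.aeval_algHom_apply, map_zero, apply_mk_eq_eval_fiberPoint, eval_X,
      Polynomial.coe_aeval_eq_eval] at h3
    exact h3

end Elimination

section Filtration

/-- A multiplicative increasing filtration of a ring by additive subgroups. -/
structure RingFiltration (R : Type*) [CommRing R] where
  /-- The subgroups of the filtration. -/
  level : ℕ → AddSubgroup R
  mono : Monotone level
  one_mem : 1 ∈ level 0
  mul_mem : ∀ {a b : ℕ} {f g : R}, f ∈ level a → g ∈ level b → f * g ∈ level (a + b)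

namespace RingFiltration

variable {R : Type*} [CommRing R] (F : RingFiltration R)

theorem prod_mem {τ : Type*} (s : Finset τ) {D : τ → ℕ} {f : τ → R}
    (hf : ∀ l ∈ s, f l ∈ F.level (D l)) : ∏ l ∈ s, f l ∈ F.level (∑ l ∈ s, D l) := by
  classical
  induction s using Finset.induction_on with
  | empty => simpa using F.one_mem
  | insert l s hl ih =>
    rw [Finset.sum_insert hl, Finset.prod_insert hl]
    exact F.mul_mem (hf l (Finset.mem_insert_self _ _))
      (ih fun j hj => hf j (Finset.mem_insert_of_mem hj))

theorem pow_mem {a : ℕ} {f : R} (hf : f ∈ F.level a) (r : ℕ) : f ^ r ∈ F.level (r * a) := by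
  have := F.prod_mem (Finset.range r) (D := fun _ => a) (f := fun _ => f) fun _ _ => hf
  simpa using this

theorem det_mem {ι : Type*} [Fintype ι] [DecidableEq ι] {A : Matrix ι ι R} {r c : ι → ℕ}
    (hA : ∀ i j, A i j ∈ F.level (r i + c j)) : A.det ∈ F.level (∑ i, r i + ∑ i, c i) := by
  rw [Matrix.det_apply]
  refine sum_mem fun τ _ => ?_
  have h : ∏ i, A (τ i) i ∈ F.level (∑ i, r i + ∑ i, c i) := by
    have := F.prod_mem Finset.univ fun i _ => hA (τ i) i
    rwa [Finset.sum_add_distrib, Equiv.sum_comp τ r] at this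
  rcases Int.units_eq_one_or (Equiv.Perm.sign τ) with h1 | h1 <;> rw [h1]
  · simpa using h
  · simpa [Units.smul_def] using h

/-- The filtration of a polynomial ring by the filtration of the coefficients. -/
def polynomial : RingFiltration (Polynomial R) where
  level a :=
    { carrier := {f | ∀ k, f.coeff k ∈ F.level a}
      add_mem' := fun hf hg k => by rw [Polynomial.coeff_add]; exact add_mem (hf k) (hg k)
      zero_mem' := fun k => by rw [Polynomial.coeff_zero]; exact zero_mem _
      neg_mem' := fun hf k => by rw [Polynomial.coeff_neg]; exact neg_mem (hf k) }
  mono a b h f hf k := F.mono h (hf k)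
  one_mem k := by
    rw [Polynomial.coeff_one]
    split_ifs
    · exact F.one_mem
    · exact zero_mem _
  mul_mem hf hg k := by
    rw [Polynomial.coeff_mul]
    exact sum_mem fun x _ => F.mul_mem (hf _) (hg _)

theorem mem_polynomial {a : ℕ} {f : Polynomial R} :
    f ∈ F.polynomial.level a ↔ ∀ k, f.coeff k ∈ F.level a := Iff.rfl

/-- The filtration of a multivariate polynomial ring by the filtration of the coefficients. -/
def mvPolynomial (τ : Type*) : RingFiltration (MvPolynomial τ R) where
  level a :=
    { carrier := {f | ∀ k, coeff k f ∈ F.level a}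
      add_mem' := fun hf hg k => by rw [coeff_add]; exact add_mem (hf k) (hg k)
      zero_mem' := fun k => by rw [coeff_zero]; exact zero_mem _
      neg_mem' := fun hf k => by rw [coeff_neg]; exact neg_mem (hf k) }
  mono a b h f hf k := F.mono h (hf k)
  one_mem k := by
    classical
    rw [coeff_one]
    split_ifs
    · exact F.one_mem
    · exact zero_mem _
  mul_mem hf hg k := by
    classical
    rw [coeff_mul]
    exact sum_mem fun x _ => F.mul_mem (hf _) (hg _)

theorem C_mem_mvPolynomial {τ : Type*} {a : ℕ} {r : R} (hr : r ∈ F.level a) :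
    (C r : MvPolynomial τ R) ∈ (F.mvPolynomial τ).level a := by
  classical
  intro k
  rw [coeff_C]
  split_ifs
  · exact hr
  · exact zero_mem _

theorem X_mem_mvPolynomial {τ : Type*} (i : τ) :
    (X i : MvPolynomial τ R) ∈ (F.mvPolynomial τ).level 0 := by
  classical
  intro k
  rw [coeff_X]
  split_ifs
  · exact F.one_mem
  · exact zero_mem _

theorem charpoly_mem {ι : Type*} [Fintype ι] [DecidableEq ι] {A : Matrix ι ι R} {r c : ι → ℕ}
    (hA : ∀ i j, A i j ∈ F.level (r i + c j)) (k : ℕ) :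
    A.charpoly.coeff k ∈ F.level (∑ i, r i + ∑ i, c i) := by
  refine F.polynomial.det_mem (A := A.charmatrix) (fun i j k => ?_) k
  rw [Matrix.charmatrix_apply, Polynomial.coeff_sub, Polynomial.coeff_C]
  refine sub_mem ?_ ?_
  · rw [Matrix.diagonal_apply]
    split_ifs
    · rw [Polynomial.coeff_X]
      split_ifs
      · exact F.mono (Nat.zero_le _) F.one_mem
      · exact zero_mem _
    · exact zero_mem _
  · split_ifs
    · exact hA _ _
    · exact zero_mem _

/-- The filtration of a multivariate polynomial ring by the total degree. -/
def totalDegree (σ : Type*) : RingFiltration (MvPolynomial σ ℝ) where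
  level a :=
    { carrier := {f | f.totalDegree ≤ a}
      add_mem' := fun hf hg => (totalDegree_add _ _).trans (max_le hf hg)
      zero_mem' := by simp
      neg_mem' := fun hf => by simpa using hf }
  mono a b h f hf := le_trans (α := ℕ) hf h
  one_mem := by simp [← SetLike.mem_coe]
  mul_mem hf hg := (totalDegree_mul _ _).trans (add_le_add hf hg)

theorem mem_totalDegree {σ : Type*} {a : ℕ} {f : MvPolynomial σ ℝ} :
    f ∈ (totalDegree σ).level a ↔ f.totalDegree ≤ a := Iff.rfl

/-- The filtration of a multivariate polynomial ring by the degree in one variable. -/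
def degreeOf {τ : Type*} (A : Type*) [CommRing A] (i : τ) :
    RingFiltration (MvPolynomial τ A) where
  level a :=
    { carrier := {f | f.degreeOf i ≤ a}
      add_mem' := fun hf hg => (degreeOf_add_le _ _ _).trans (max_le hf hg)
      zero_mem' := by simp
      neg_mem' := fun hf => by simpa [degreeOf_neg] using hf }
  mono a b h f hf := le_trans (α := ℕ) hf h
  one_mem := by
    change MvPolynomial.degreeOf i 1 ≤ 0
    rw [← C_1, degreeOf_C]
  mul_mem hf hg := (degreeOf_mul_le _ _ _).trans (add_le_add hf hg)

theorem mem_degreeOf {τ A : Type*} [CommRing A] {i : τ} {a : ℕ} {f : MvPolynomial τ A} :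
    f ∈ (degreeOf A i).level a ↔ f.degreeOf i ≤ a := Iff.rfl

end RingFiltration

end Filtration

section Polarization

variable {A : Type*} [CommRing A] {e : ℕ}

/-- The coefficient of the square-free monomial in the resultant of `c` and `∑ j, z_j T ^ (ν j)`;
up to a power of the leading coefficient of `c`, it is the permanent of the matrix of the powers
`τ_k ^ (ν j)` of the roots of `c`. -/
noncomputable def rootPermanent (c : Polynomial A) (M : ℕ) (ν : Fin e → ℕ) : A :=
  coeff (Finsupp.equivFunOnFinite.symm fun _ => 1)
    (Polynomial.resultant (c.map (C : A →+* MvPolynomial (Fin e) A))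
      (∑ j, Polynomial.monomial (ν j) (X j)) e M)

theorem map_rootPermanent {B : Type*} [CommRing B] (φ : A →+* B) (c : Polynomial A) (M : ℕ)
    (ν : Fin e → ℕ) : φ (rootPermanent c M ν) = rootPermanent (c.map φ) M ν := by
  rw [rootPermanent, rootPermanent, ← coeff_map, ← Polynomial.resultant_map_map]
  congr 3
  · rw [Polynomial.map_map, Polynomial.map_map]
    congr 1
    ext a : 1
    simp
  · simp [Polynomial.map_sum]

theorem rootPermanent_mem (F : RingFiltration A) {c : Polynomial A} {g : ℕ}
    (hc : ∀ k, c.coeff k ∈ F.level g) (M : ℕ) (ν : Fin e → ℕ) :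
    rootPermanent c M ν ∈ F.level (M * g) := by
  have hmem : (Polynomial.sylvester (c.map (C : A →+* MvPolynomial (Fin e) A))
      (∑ j, Polynomial.monomial (ν j) (X j)) e M).det ∈ (F.mvPolynomial (Fin e)).level
        (∑ _i : Fin (e + M), 0 +
          ∑ j : Fin (e + M), Fin.addCases (motive := fun _ => ℕ) (fun _ => 0) (fun _ => g) j) := by
    refine (F.mvPolynomial (Fin e)).det_mem fun i j => ?_
    rw [Polynomial.sylvester, Matrix.of_apply]
    refine Fin.addCases (fun j₁ => ?_) (fun j₁ => ?_) j
    · simp only [Fin.addCases_left]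
      split_ifs
      · rw [Polynomial.finsetSum_coeff]
        refine sum_mem fun l _ => ?_
        rw [Polynomial.coeff_monomial]
        split_ifs
        · exact F.X_mem_mvPolynomial _
        · exact zero_mem _
      · exact zero_mem _
    · simp only [Fin.addCases_right]
      split_ifs
      · rw [Polynomial.coeff_map]
        simpa using F.C_mem_mvPolynomial (hc _)
      · exact zero_mem _
  have := hmem (Finsupp.equivFunOnFinite.symm fun _ => 1)
  simpa [rootPermanent, Polynomial.resultant, Fin.sum_univ_add] using this

theorem coeff_prod_sum_X (u : Fin e → Fin e → A) :
    coeff (Finsupp.equivFunOnFinite.symm fun _ => 1)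
      (∏ k, ∑ j, C (u k j) * (X j : MvPolynomial (Fin e) A)) =
      ∑ π : Equiv.Perm (Fin e), ∏ k, u k (π k) := by
  classical
  rw [Finset.prod_univ_sum, Fintype.piFinset_univ, coeff_sum]
  have h (f : Fin e → Fin e) : coeff (Finsupp.equivFunOnFinite.symm fun _ => 1)
      (∏ k, C (u k (f k)) * (X (f k) : MvPolynomial (Fin e) A)) =
      if Function.Bijective f then ∏ k, u k (f k) else 0 := by
    rw [Finset.prod_mul_distrib, ← map_prod, coeff_C_mul]
    have h1 : ∏ k, (X (f k) : MvPolynomial (Fin e) A) =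
        monomial (∑ k, Finsupp.single (f k) 1) 1 := by
      rw [monomial_sum_one]
      rfl
    rw [h1, coeff_monomial]
    have h2 : (∑ k, Finsupp.single (f k) 1 = Finsupp.equivFunOnFinite.symm fun _ : Fin e => 1) ↔
        Function.Bijective f := by
      have h3 (j) : (∑ k, Finsupp.single (f k) 1) j = (Finset.univ.filter fun k => f k = j).card := by
        rw [Finsupp.finsetSum_apply, Finset.card_filter]
        simp [Finsupp.single_apply]
      constructor
      · intro h
        refine Finite.injective_iff_bijective.mp (Finite.injective_iff_surjective.mpr fun j => ?_)
        have h4 := h3 j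
        rw [h] at h4
        obtain ⟨k, hk⟩ := Finset.card_pos.mp (show 0 < (Finset.univ.filter fun k => f k = j).card by
          rw [← h4]; simp)
        exact ⟨k, by simpa using hk⟩
      · intro h
        ext j
        rw [h3]
        obtain ⟨k, rfl⟩ := h.2 j
        simp only [h.1.eq_iff, Finset.filter_eq', Finset.mem_univ, if_true, Finset.card_singleton]
        simp
    by_cases hf : Function.Bijective f
    · rw [if_pos (h2.mpr hf), if_pos hf, mul_one]
    · rw [if_neg (mt h2.mp hf), if_neg hf, mul_zero]
  rw [Finset.sum_congr rfl fun f _ => h f, ← Finset.sum_filter]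
  symm
  refine Finset.sum_bij (fun π _ => π) (fun π _ => Finset.mem_filter.mpr ⟨Finset.mem_univ _, π.bijective⟩)
    (fun π _ ρ _ h => Equiv.coe_fn_injective h) (fun f hf => ?_) fun π _ => rfl
  exact ⟨Equiv.ofBijective f (Finset.mem_filter.mp hf).2, Finset.mem_univ _, rfl⟩

theorem rootPermanent_eq {K : Type*} [Field K] {a : K} (ha : a ≠ 0) (τ : Fin e → K) {M : ℕ}
    {ν : Fin e → ℕ} (hν : ∀ j, ν j ≤ M) :
    rootPermanent (Polynomial.C a * ∏ k, (Polynomial.X - Polynomial.C (τ k))) M ν =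
      a ^ M * ∑ π : Equiv.Perm (Fin e), ∏ k, τ k ^ ν (π k) := by
  classical
  set c : Polynomial K := Polynomial.C a * ∏ k, (Polynomial.X - Polynomial.C (τ k)) with hc
  have hprod : (∏ k, (Polynomial.X - Polynomial.C (τ k))).Monic :=
    Polynomial.monic_prod_of_monic _ _ fun k _ => Polynomial.monic_X_sub_C _
  have hroots : c.roots = Finset.univ.val.map τ := by
    rw [hc, Polynomial.roots_C_mul _ ha, ← Polynomial.roots_multiset_prod_X_sub_C (Finset.univ.val.map τ),
      Multiset.map_map]
    rfl
  have hdeg : c.natDegree = e := by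
    rw [hc, Polynomial.natDegree_C_mul ha, Polynomial.natDegree_prod_of_monic _ _
      fun k _ => Polynomial.monic_X_sub_C _]
    simp
  have hlead : c.leadingCoeff = a := by
    rw [hc, Polynomial.leadingCoeff_mul, hprod.leadingCoeff]
    simp
  have hsplit : c.Splits :=
    (Polynomial.Splits.C a).mul (Polynomial.Splits.prod fun k _ => Polynomial.Splits.X_sub_C (τ k))
  set f := c.map (C : K →+* MvPolynomial (Fin e) K) with hf
  have hinj : Function.Injective (C : K →+* MvPolynomial (Fin e) K) := C_injective _ _
  have hfdeg : f.natDegree = e := by rw [hf, Polynomial.natDegree_map_eq_of_injective hinj, hdeg]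
  have hg : (∑ j, Polynomial.monomial (ν j) (X j : MvPolynomial (Fin e) K)).natDegree ≤ M :=
    Polynomial.natDegree_sum_le_of_forall_le _ _ fun j _ =>
      (Polynomial.natDegree_monomial_le _).trans (hν j)
  have key := Polynomial.resultant_eq_prod_eval f _ M hg (hsplit.map _)
  rw [hfdeg] at key
  rw [rootPermanent, key, hsplit.roots_map, hroots, hf,
    Polynomial.leadingCoeff_map_of_injective hinj, hlead, ← map_pow, coeff_C_mul]
  congr 1
  rw [← coeff_prod_sum_X fun k j => τ k ^ ν j]
  rw [Multiset.map_map, Multiset.map_map]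
  change coeff _ (∏ k, _) = _
  simp [Polynomial.eval_finsetSum, mul_comm]

end Polarization

section RootSum

variable {A : Type*} [CommRing A] {e : ℕ}

/-- Up to a power of the leading coefficient of `c`, the sum of the values of `S` at all the
orderings of the roots of `c`. -/
noncomputable def rootSum (c : Polynomial A) (M : ℕ) (S : MvPolynomial (Fin e) A) : A :=
  ∑ ν ∈ S.support, coeff ν S * rootPermanent c M ν

theorem rootSum_mem (F : RingFiltration A) {c : Polynomial A} {g b : ℕ}
    (hc : ∀ k, c.coeff k ∈ F.level g) (M : ℕ) {S : MvPolynomial (Fin e) A}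
    (hS : S ∈ (F.mvPolynomial (Fin e)).level b) : rootSum c M S ∈ F.level (b + M * g) :=
  sum_mem fun _ _ => F.mul_mem (hS _) (rootPermanent_mem F hc M _)

theorem map_rootSum_eq {K : Type*} [Field K] (φ : A →+* K) {c : Polynomial A} {a : K} (ha : a ≠ 0)
    {τ : Fin e → K}
    (hc : c.map φ = Polynomial.C a * ∏ k, (Polynomial.X - Polynomial.C (τ k))) {M : ℕ}
    {S : MvPolynomial (Fin e) A} (hS : ∀ k, S.degreeOf k ≤ M) :
    φ (rootSum c M S) =
      a ^ M * ∑ π : Equiv.Perm (Fin e), eval₂Hom φ (fun k => τ (π k)) S := by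
  rw [rootSum, map_sum]
  have h (ν) (hν : ν ∈ S.support) : φ (coeff ν S * rootPermanent c M ν) =
      ∑ π : Equiv.Perm (Fin e), a ^ M * (φ (coeff ν S) * ∏ k, τ k ^ ν (π k)) := by
    rw [map_mul, map_rootPermanent, hc,
      rootPermanent_eq ha τ fun j => (monomial_le_degreeOf j hν).trans (hS j),
      ← Finset.mul_sum, ← Finset.mul_sum]
    ring
  rw [Finset.sum_congr rfl h, Finset.sum_comm, Finset.mul_sum, ← Equiv.sum_comp (Equiv.inv _)]
  refine Finset.sum_congr rfl fun π _ => ?_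
  rw [coe_eval₂Hom, eval₂_eq', Finset.mul_sum]
  refine Finset.sum_congr rfl fun ν _ => ?_
  congr 2
  rw [← Equiv.prod_comp π]
  simp

/-- The matrix over the ring of polynomials in the roots which is similar to the Hermite matrix
of `h`. -/
noncomputable def hermiteRootMatrix (e : ℕ) (h : Polynomial A) :
    Matrix (Fin e) (Fin e) (MvPolynomial (Fin e) A) :=
  Matrix.of fun k l => Polynomial.aeval (X k) h * ∑ r : Fin e, X k ^ (r : ℕ) * X l ^ (r : ℕ)

theorem charpoly_hermiteRootMatrix_mem (F : RingFiltration A) {h : Polynomial A} {b : ℕ}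
    (hh : ∀ k, h.coeff k ∈ F.level b) (j : ℕ) :
    (hermiteRootMatrix e h).charpoly.coeff j ∈ (F.mvPolynomial (Fin e)).level (e * b) := by
  have := (F.mvPolynomial (Fin e)).charpoly_mem (A := hermiteRootMatrix e h)
    (r := fun _ => b) (c := fun _ => 0) (fun k l => ?_) j
  · simpa using this
  rw [hermiteRootMatrix, Matrix.of_apply]
  have hX (k : Fin e) (r : ℕ) : (X k : MvPolynomial (Fin e) A) ^ r ∈
      (F.mvPolynomial (Fin e)).level 0 := by
    simpa using (F.mvPolynomial (Fin e)).pow_mem (F.X_mem_mvPolynomial k) r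
  refine (F.mvPolynomial (Fin e)).mul_mem ?_ (sum_mem fun r _ => ?_)
  · rw [Polynomial.aeval_eq_sum_range]
    refine sum_mem fun r _ => ?_
    rw [Algebra.smul_def, algebraMap_eq]
    simpa using (F.mvPolynomial (Fin e)).mul_mem (F.C_mem_mvPolynomial (hh r)) (hX k r)
  · simpa using (F.mvPolynomial (Fin e)).mul_mem (hX k r) (hX l r)

theorem degreeOf_charpoly_hermiteRootMatrix {h : Polynomial A} {b : ℕ}
    (hh : h.natDegree ≤ b) (i : Fin e) (j : ℕ) :
    ((hermiteRootMatrix e h).charpoly.coeff j).degreeOf i ≤ b + 2 * e := by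
  classical
  set F := RingFiltration.degreeOf A i with hF
  have := F.charpoly_mem (A := hermiteRootMatrix e h)
    (r := fun k => if k = i then b + e else 0) (c := fun k => if k = i then e else 0)
    (fun k l => ?_) j
  · rw [Finset.sum_ite_eq' Finset.univ i, Finset.sum_ite_eq' Finset.univ i] at this
    simp only [Finset.mem_univ, if_true] at this
    refine le_trans (RingFiltration.mem_degreeOf.mp this) (by omega)
  rw [hermiteRootMatrix, Matrix.of_apply]
  have hX (k : Fin e) (r D : ℕ) (hr : r ≤ D) : (X k : MvPolynomial (Fin e) A) ^ r ∈
      F.level (if k = i then D else 0) := by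
    have h1 : (X k : MvPolynomial (Fin e) A) ∈ F.level (if k = i then 1 else 0) := by
      rw [RingFiltration.mem_degreeOf]
      rcases subsingleton_or_nontrivial A with hA | hA
      · rw [Subsingleton.elim (X k : MvPolynomial (Fin e) A) 0, degreeOf_zero]
        exact Nat.zero_le _
      rw [degreeOf_X]
      simp only [eq_comm]
      exact le_rfl
    refine F.mono ?_ (F.pow_mem h1 r)
    split_ifs <;> simp [hr]
  have hmem := F.mul_mem (f := Polynomial.aeval (X k) h)
    (g := ∑ r : Fin e, X k ^ (r : ℕ) * X l ^ (r : ℕ)) (a := if k = i then b else 0)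
    (b := (if k = i then e else 0) + if l = i then e else 0) ?_ (sum_mem fun r _ => ?_)
  · refine F.mono (le_of_eq ?_) hmem
    split_ifs <;> omega
  · rw [Polynomial.aeval_eq_sum_range]
    refine sum_mem fun r hr => ?_
    rw [Algebra.smul_def, algebraMap_eq]
    have hr' := Finset.mem_range.mp hr
    have hC : (C (h.coeff r) : MvPolynomial (Fin e) A) ∈ F.level 0 := by
      rw [RingFiltration.mem_degreeOf, degreeOf_C]
    simpa using F.mul_mem hC (hX k r b (by omega))
  · exact F.mul_mem (hX k r e r.2.le) (hX l r e r.2.le)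

/-- The Hermite matrix of `h` with respect to the points `τ`. -/
noncomputable def hermiteMatrix {K : Type*} [Field K] (h : Polynomial K) (τ : Fin e → K) :
    Matrix (Fin e) (Fin e) K :=
  Matrix.of fun r s => ∑ k, h.eval (τ k) * τ k ^ ((r : ℕ) + s)

theorem hermiteMatrix_perm {K : Type*} [Field K] (h : Polynomial K) (τ : Fin e → K)
    (π : Equiv.Perm (Fin e)) : hermiteMatrix h (fun k => τ (π k)) = hermiteMatrix h τ := by
  ext r s
  simp only [hermiteMatrix, Matrix.of_apply]
  exact Equiv.sum_comp π fun k => h.eval (τ k) * τ k ^ ((r : ℕ) + s)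

theorem charpoly_map_hermiteRootMatrix {K : Type*} [Field K] (φ : A →+* K) (h : Polynomial A)
    (τ : Fin e → K) :
    ((hermiteRootMatrix e h).map (eval₂Hom φ τ)).charpoly =
      (hermiteMatrix (h.map φ) τ).charpoly := by
  set V : Matrix (Fin e) (Fin e) K := Matrix.of fun k r => τ k ^ (r : ℕ) with hV
  set D : Matrix (Fin e) (Fin e) K := Matrix.diagonal fun k => (h.map φ).eval (τ k) with hD
  have h1 : (hermiteRootMatrix e h).map (eval₂Hom φ τ) = D * V * V.transpose := by
    ext k l
    rw [Matrix.map_apply, hermiteRootMatrix, Matrix.of_apply, map_mul, Matrix.mul_assoc, hD,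
      Matrix.diagonal_mul]
    congr 1
    · rw [Polynomial.aeval_def, Polynomial.hom_eval₂, Polynomial.eval_map]
      congr 1
      · ext; simp
      · simp
    · simp [Matrix.mul_apply, hV]
  have h2 : hermiteMatrix (h.map φ) τ = V.transpose * (D * V) := by
    ext r s
    rw [Matrix.mul_apply]
    simp only [hermiteMatrix, Matrix.of_apply, hD, Matrix.diagonal_mul, hV, Matrix.transpose_apply,
      pow_add]
    exact Finset.sum_congr rfl fun k _ => by ring
  rw [h1, h2, Matrix.charpoly_mul_comm]

theorem map_rootSum_charpoly_hermiteRootMatrix {K : Type*} [Field K] (φ : A →+* K)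
    {c h : Polynomial A} {a : K} (ha : a ≠ 0) {τ : Fin e → K}
    (hc : c.map φ = Polynomial.C a * ∏ k, (Polynomial.X - Polynomial.C (τ k))) {b : ℕ}
    (hh : h.natDegree ≤ b) (j : ℕ) :
    φ (rootSum c (b + 2 * e) ((hermiteRootMatrix e h).charpoly.coeff j)) =
      a ^ (b + 2 * e) * (e.factorial * (hermiteMatrix (h.map φ) τ).charpoly.coeff j) := by
  rw [map_rootSum_eq φ ha hc fun k => degreeOf_charpoly_hermiteRootMatrix hh k j]
  congr 1
  have h1 (π : Equiv.Perm (Fin e)) : eval₂Hom φ (fun k => τ (π k))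
      ((hermiteRootMatrix e h).charpoly.coeff j) =
      (hermiteMatrix (h.map φ) τ).charpoly.coeff j := by
    rw [← Polynomial.coeff_map, ← Matrix.charpoly_map, ← hermiteMatrix_perm _ τ π,
      ← charpoly_map_hermiteRootMatrix]
  rw [Finset.sum_congr rfl fun π _ => h1 π]
  simp [Fintype.card_perm]

end RootSum

section UnivariateHermite

open scoped ComplexConjugate

theorem exists_hermiteMatrix_signature {c : Polynomial ℝ} (hc : c ≠ 0) {e : ℕ}
    (he : c.natDegree = e) :
    ∃ τ : Fin e → ℂ, c.map Complex.ofRealHom = Polynomial.C (c.leadingCoeff : ℂ) *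
        ∏ k, (Polynomial.X - Polynomial.C (τ k)) ∧
      ∀ h : Polynomial ℝ, ∃ H : Matrix (Fin e) (Fin e) ℝ, H.IsHermitian ∧
        H.map Complex.ofRealHom = hermiteMatrix (h.map Complex.ofRealHom) τ ∧
        (sigPos H.toQuadraticForm' : ℤ) - sigNeg H.toQuadraticForm' =
          ∑ t ∈ c.roots.toFinset, (SignType.sign (h.eval t) : ℤ) := by
  classical
  set cC := c.map Complex.ofRealHom with hcC
  have hcC0 : cC ≠ 0 := (Polynomial.map_ne_zero_iff Complex.ofRealHom.injective).mpr hc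
  have hsplit : cC.Splits := IsAlgClosed.splits cC
  have hcard : cC.roots.card = e := by
    rw [← hsplit.natDegree_eq_card_roots, hcC, Polynomial.natDegree_map, he]
  obtain ⟨l, hl⟩ := Quot.exists_rep cC.roots
  change (l : Multiset ℂ) = _ at hl
  have hlen : l.length = e := by rw [← hcard, ← hl, Multiset.coe_card]
  subst hlen
  have hmap : Finset.univ.val.map l.get = cC.roots := by
    rw [← hl]
    change (((List.finRange l.length).map l.get : List ℂ) : Multiset ℂ) = _
    simp
  have hsum (f : ℂ → ℂ) : ∑ k, f (l.get k) =
      ∑ ω : {z // z ∈ cC.roots.toFinset}, (cC.roots.count (ω : ℂ) : ℂ) * f ω := by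
    have h1 : ∑ k, f (l.get k) = (cC.roots.map f).sum := by
      rw [← hmap, Multiset.map_map]; rfl
    rw [h1, Finset.sum_multiset_map_count, ← Finset.sum_coe_sort]
    simp
  have hmapC : cC.map (starRingEnd ℂ) = cC := by
    rw [hcC, Polynomial.map_map]
    congr 1
    ext; simp
  have hconj : cC.roots.map (starRingEnd ℂ) = cC.roots := by
    conv_rhs => rw [← hmapC]
    rw [hsplit.roots_map]
  refine ⟨l.get, ?_, fun h => ?_⟩
  · have := hsplit.eq_prod_roots
    rw [← hmap, Multiset.map_map] at this
    rw [this]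
    congr 2
    rw [hcC, Polynomial.leadingCoeff_map]; rfl
  set hC := h.map Complex.ofRealHom with hhC
  have hhconj (z : ℂ) : conj (hC.eval z) = hC.eval (conj z) := by
    have : hC.map (starRingEnd ℂ) = hC := by
      rw [hhC, Polynomial.map_map]
      congr 1
      ext; simp
    conv_rhs => rw [← this]
    rw [Polynomial.eval_map (starRingEnd ℂ), Polynomial.eval₂_at_apply]
  have hcount (z : ℂ) : cC.roots.count (conj z) = cC.roots.count z := by
    conv_lhs => rw [← hconj]
    exact Multiset.count_map_eq_count' _ _ (starRingEnd ℂ).injective _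
  have hreal (r s : Fin l.length) :
      conj (hermiteMatrix hC l.get r s) = hermiteMatrix hC l.get r s := by
    have h1 : ∀ f : ℂ → ℂ, ∑ k, f (l.get k) = (cC.roots.map f).sum := fun f => by
      rw [← hmap, Multiset.map_map]; rfl
    rw [hermiteMatrix, Matrix.of_apply, map_sum, h1 fun z => hC.eval z * z ^ ((r : ℕ) + s),
      h1 fun z => conj (hC.eval z * z ^ ((r : ℕ) + s))]
    conv_rhs => rw [← hconj, Multiset.map_map]
    congr 1
    refine Multiset.map_congr rfl fun z _ => ?_
    simp [hhconj]
  set H : Matrix (Fin l.length) (Fin l.length) ℝ :=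
    (hermiteMatrix hC l.get).map Complex.re with hH
  have hHC (r s) : (H r s : ℂ) = hermiteMatrix hC l.get r s := by
    rw [hH, Matrix.map_apply]
    exact Complex.conj_eq_iff_re.mp (hreal r s)
  have hHherm : H.IsHermitian := by
    ext r s
    simp [hH, hermiteMatrix, add_comm]
  refine ⟨H, hHherm, by ext r s; simpa using hHC r s, ?_⟩
  set ψ : {z // z ∈ cC.roots.toFinset} → (Fin l.length → ℝ) →ₗ[ℝ] ℂ := fun ω =>
    ∑ r, (LinearMap.proj r : (Fin l.length → ℝ) →ₗ[ℝ] ℝ).smulRight ((ω : ℂ) ^ (r : ℕ)) with hψ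
  have hψa (ω v) : ψ ω v = ∑ r, (v r : ℂ) * (ω : ℂ) ^ (r : ℕ) := by
    simp [hψ, LinearMap.sum_apply]
  have hmem (z : ℂ) (hz : z ∈ cC.roots.toFinset) : conj z ∈ cC.roots.toFinset := by
    rw [Multiset.mem_toFinset, ← Multiset.one_le_count_iff_mem] at hz ⊢
    rwa [hcount]
  have key := sigPos_sub_sigNeg_of_conj (H.toQuadraticForm')
    (fun ω : {z // z ∈ cC.roots.toFinset} => (cC.roots.count (ω : ℂ) : ℂ) * hC.eval (ω : ℂ)) ψ ?_
    (fun ω => ⟨conj (ω : ℂ), hmem _ ω.2⟩) (fun ω => by simp) (fun ω v => ?_) (fun ω => ?_)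
    (fun v => ?_)
  · rw [key]
    symm
    refine Finset.sum_bij (fun t ht => ⟨(t : ℂ), ?_⟩) (fun t ht => ?_) (fun t _ t' _ htt => ?_)
      (fun ω hω => ?_) fun t ht => ?_
    · rw [Multiset.mem_toFinset, Polynomial.mem_roots hc] at ht
      rw [Multiset.mem_toFinset, Polynomial.mem_roots hcC0, Polynomial.IsRoot.def, hcC,
        Polynomial.eval_map, show (t : ℂ) = Complex.ofRealHom t from rfl,
        Polynomial.eval₂_at_apply, ht.eq_zero, map_zero]
    · simp
    · simpa using htt
    · obtain ⟨z, hz⟩ := ω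
      have hz1 : conj z = z := by simpa using hω
      have hz2 : (z.re : ℂ) = z := Complex.conj_eq_iff_re.mp hz1
      refine ⟨z.re, ?_, Subtype.ext hz2⟩
      rw [Multiset.mem_toFinset, Polynomial.mem_roots hcC0, Polynomial.IsRoot.def, hcC,
        Polynomial.eval_map, ← hz2, show (z.re : ℂ) = Complex.ofRealHom z.re from rfl,
        Polynomial.eval₂_at_apply] at hz
      rw [Multiset.mem_toFinset, Polynomial.mem_roots hc]
      exact Complex.ofRealHom.injective (by rw [hz, map_zero])
    · have h1 : hC.eval (t : ℂ) = (h.eval t : ℝ) := by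
        rw [hhC, Polynomial.eval_map, show (t : ℂ) = Complex.ofRealHom t from rfl,
          Polynomial.eval₂_at_apply]
        rfl
      have h2 : 0 < (cC.roots.count (t : ℂ) : ℝ) := by
        rw [Nat.cast_pos, Multiset.count_pos, Polynomial.mem_roots hcC0, Polynomial.IsRoot.def, hcC,
          Polynomial.eval_map, show (t : ℂ) = Complex.ofRealHom t from rfl,
          Polynomial.eval₂_at_apply]
        rw [Multiset.mem_toFinset, Polynomial.mem_roots hc] at ht
        rw [ht.eq_zero, map_zero]
      change _ = (SignType.sign (((cC.roots.count (t : ℂ) : ℕ) : ℂ) * hC.eval (t : ℂ)).re : ℤ)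
      rw [h1, ← Complex.ofReal_natCast, ← Complex.ofReal_mul, Complex.ofReal_re, sign_mul,
        sign_pos h2, one_mul]
  · rw [Fintype.linearIndependent_iff]
    intro g hg ω
    have hpow (r : Fin l.length) : ∑ ω, g ω * (ω : ℂ) ^ (r : ℕ) = 0 := by
      have := LinearMap.congr_fun hg (Pi.single r 1)
      simpa [LinearMap.sum_apply, hψa, Pi.single_apply, apply_ite Complex.ofReal] using this
    have hpoly (p : Polynomial ℂ) (hp : p.natDegree < l.length) : ∑ ω, g ω * p.eval (ω : ℂ) = 0 := by
      simp only [Polynomial.eval_eq_sum_range' hp, Finset.mul_sum]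
      rw [Finset.sum_comm]
      refine Finset.sum_eq_zero fun r hr => ?_
      have := hpow ⟨r, Finset.mem_range.mp hr⟩
      rw [← mul_zero (p.coeff r), ← this, Finset.mul_sum]
      exact Finset.sum_congr rfl fun _ _ => by ring
    have h1 := hpoly (∏ ω' ∈ Finset.univ.erase ω, (Polynomial.X - Polynomial.C (ω' : ℂ))) (by
      rw [Polynomial.natDegree_prod_of_monic _ _ fun _ _ => Polynomial.monic_X_sub_C _]
      simp only [Polynomial.natDegree_X_sub_C, Finset.sum_const, smul_eq_mul, mul_one]
      have h2 : Fintype.card {z // z ∈ cC.roots.toFinset} ≤ l.length := by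
        rw [Fintype.card_coe, ← hcard]
        exact Multiset.toFinset_card_le _
      have h3 := Finset.card_erase_lt_of_mem (Finset.mem_univ ω)
      exact lt_of_lt_of_le h3 h2)
    rw [Finset.sum_eq_single ω] at h1
    · refine (mul_eq_zero.mp h1).resolve_right ?_
      rw [Polynomial.eval_prod]
      refine Finset.prod_ne_zero_iff.mpr ?_
      intro ω' hω'
      simp only [Polynomial.eval_sub, Polynomial.eval_X, Polynomial.eval_C]
      rw [sub_ne_zero]
      exact fun h => (Finset.ne_of_mem_erase hω') (Subtype.ext h.symm)
    · intro ω' _ hω'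
      rw [Polynomial.eval_prod, Finset.prod_eq_zero (Finset.mem_erase.mpr ⟨hω', Finset.mem_univ _⟩)
        (by simp), mul_zero]
    · simp
  · rw [hψa, hψa, map_sum]
    simp
  · simp [hcount, hhconj]
  · rw [toQuadraticForm'_apply]
    push_cast
    have h1 := hsum fun z => hC.eval z * (∑ r, (v r : ℂ) * z ^ (r : ℕ)) ^ 2
    simp only [hψa, mul_assoc]
    rw [← h1]
    simp only [hHC, hermiteMatrix, Matrix.of_apply, Finset.sum_mul]
    rw [Finset.sum_congr rfl fun i _ => Finset.sum_comm, Finset.sum_comm]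
    refine Finset.sum_congr rfl fun k _ => ?_
    rw [sq, Finset.sum_mul_sum, Finset.mul_sum]
    refine Finset.sum_congr rfl fun r _ => ?_
    rw [Finset.mul_sum]
    refine Finset.sum_congr rfl fun s _ => ?_
    rw [pow_add]
    ring

end UnivariateHermite

section RootElimination

variable {A : Type*} [CommRing A]

theorem rootSum_eq_sum {e : ℕ} (c : Polynomial A) (M : ℕ) {S : MvPolynomial (Fin e) A}
    {s : Finset (Fin e →₀ ℕ)} (hs : S.support ⊆ s) :
    rootSum c M S = ∑ ν ∈ s, coeff ν S * rootPermanent c M ν := by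
  refine Finset.sum_subset hs fun ν _ hν => ?_
  rw [notMem_support_iff.mp hν, zero_mul]

theorem map_rootSum {B : Type*} [CommRing B] (φ : A →+* B) {e : ℕ} (c : Polynomial A) (M : ℕ)
    (S : MvPolynomial (Fin e) A) :
    φ (rootSum c M S) = rootSum (c.map φ) M (MvPolynomial.map φ S) := by
  rw [rootSum_eq_sum (c.map φ) M (support_map_subset φ S), rootSum, map_sum]
  simp only [map_mul, map_rootPermanent, coeff_map]

theorem map_hermiteRootMatrix {B : Type*} [CommRing B] (φ : A →+* B) (e : ℕ) (h : Polynomial A) :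
    (hermiteRootMatrix e h).map (MvPolynomial.map φ) = hermiteRootMatrix e (h.map φ) := by
  ext k l : 2
  simp only [hermiteRootMatrix, Matrix.map_apply, Matrix.of_apply, map_mul, map_sum, map_pow, map_X]
  congr 1
  rw [Polynomial.aeval_def, Polynomial.aeval_def, Polynomial.hom_eval₂, Polynomial.eval₂_map, map_X]
  congr 1
  ext a : 1
  simp [algebraMap_eq]

theorem sum_sign_congr {φ φ' : A →+* ℝ} {c h : Polynomial A} {e β : ℕ}
    (hφ : c.map φ ≠ 0) (hφ' : c.map φ' ≠ 0) (he : (c.map φ).natDegree = e)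
    (he' : (c.map φ').natDegree = e) (hh : h.natDegree ≤ 2 * β)
    (hsign : ∀ j ≤ e,
      SignType.sign (φ (rootSum c (2 * β + 2 * e) ((hermiteRootMatrix e h).charpoly.coeff j))) =
      SignType.sign (φ' (rootSum c (2 * β + 2 * e) ((hermiteRootMatrix e h).charpoly.coeff j)))) :
    ∑ t ∈ (c.map φ).roots.toFinset, (SignType.sign ((h.map φ).eval t) : ℤ) =
      ∑ t ∈ (c.map φ').roots.toFinset, (SignType.sign ((h.map φ').eval t) : ℤ) := by
  have key (φ : A →+* ℝ) (hφ : c.map φ ≠ 0) (he : (c.map φ).natDegree = e) :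
      ∃ H : Matrix (Fin e) (Fin e) ℝ, H.IsHermitian ∧
        (∀ j, SignType.sign (H.charpoly.coeff j) = SignType.sign (φ (rootSum c (2 * β + 2 * e)
          ((hermiteRootMatrix e h).charpoly.coeff j)))) ∧
        (sigPos H.toQuadraticForm' : ℤ) - sigNeg H.toQuadraticForm' =
          ∑ t ∈ (c.map φ).roots.toFinset, (SignType.sign ((h.map φ).eval t) : ℤ) := by
    obtain ⟨τ, hτ, hH⟩ := exists_hermiteMatrix_signature hφ he
    obtain ⟨H, hherm, hmap, hsig⟩ := hH (h.map φ)
    refine ⟨H, hherm, fun j => ?_, hsig⟩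
    have ha : (c.map φ).leadingCoeff ≠ 0 := Polynomial.leadingCoeff_ne_zero.mpr hφ
    have h1 := map_rootSum_charpoly_hermiteRootMatrix (Complex.ofRealHom.comp φ)
      (a := ((c.map φ).leadingCoeff : ℂ)) (by exact_mod_cast ha) (τ := τ) (c := c)
      (by rw [← Polynomial.map_map, hτ]) hh j
    rw [← Polynomial.map_map, ← hmap, Matrix.charpoly_map, Polynomial.coeff_map] at h1
    have h2 : φ (rootSum c (2 * β + 2 * e) ((hermiteRootMatrix e h).charpoly.coeff j)) =
        (c.map φ).leadingCoeff ^ (2 * β + 2 * e) * (e.factorial * H.charpoly.coeff j) := by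
      apply Complex.ofRealHom.injective
      rw [RingHom.comp_apply] at h1
      rw [h1]
      simp
    have h3 : 0 < (c.map φ).leadingCoeff ^ (2 * β + 2 * e) :=
      (Even.pow_pos ⟨β + e, by ring⟩ ha)
    have h4 : (0 : ℝ) < e.factorial := by exact_mod_cast Nat.factorial_pos e
    rw [h2, sign_mul, sign_mul, sign_pos h3, sign_pos h4, one_mul, one_mul]
  obtain ⟨H, hH, hs, hsig⟩ := key φ hφ he
  obtain ⟨H', hH', hs', hsig'⟩ := key φ' hφ' he'
  have h1 := sigPos_sigNeg_congr hH hH' fun j => by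
    by_cases hj : j ≤ e
    · rw [hs, hs', hsign j hj]
    · have h0 (H : Matrix (Fin e) (Fin e) ℝ) : H.charpoly.coeff j = 0 :=
        Polynomial.coeff_eq_zero_of_natDegree_lt (by
          rw [Matrix.charpoly_natDegree_eq_dim, Fintype.card_fin]; omega)
      rw [h0, h0]
  rw [← hsig, ← hsig', h1.1, h1.2]

/-- The signs of finitely many elements of the coefficient ring determine the sign vectors realized
by a finite family of polynomials at the roots of a polynomial. -/
theorem exists_sign_determination_roots (F : RingFiltration A) {c : Polynomial A} {g : ℕ}
    (hc : ∀ k, c.coeff k ∈ F.level g) (hcg : c.natDegree ≤ g) {I : Type*} [Fintype I]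
    {f : I → Polynomial A} {b : ℕ} (hf : ∀ i k, (f i).coeff k ∈ F.level b)
    (hfb : ∀ i, (f i).natDegree ≤ b) {L : ℕ} (hL : 2 * g ≤ 2 ^ L) :
    ∃ G : Set A, G.Finite ∧ (∀ w ∈ G, w ∈ F.level (g * (1 + 2 * (L * b)) + (2 * (L * b) + 2 * g) * g)) ∧
      (∀ w ∈ G, ∀ φ φ' : A →+* ℝ, c.map φ = c.map φ' → (∀ i, (f i).map φ = (f i).map φ') →
        φ w = φ' w) ∧
      ∀ φ φ' : A →+* ℝ, (∀ w ∈ G, SignType.sign (φ w) = SignType.sign (φ' w)) → c.map φ ≠ 0 →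
        c.map φ' ≠ 0 ∧ ∀ t, (c.map φ).eval t = 0 → ∃ t', (c.map φ').eval t' = 0 ∧
          ∀ i, SignType.sign (((f i).map φ').eval t') = SignType.sign (((f i).map φ).eval t) := by
  classical
  let pr : (I → Fin 3) → Polynomial A := fun a => ∏ i, f i ^ (a i : ℕ)
  let J : Set (I → Fin 3) := {a | (Finset.univ.filter fun i => (a i : ℕ) ≠ 0).card ≤ L}
  let W : (I → Fin 3) → ℕ → ℕ → A := fun a e j =>
    rootSum c (2 * (L * b) + 2 * e) ((hermiteRootMatrix e (pr a)).charpoly.coeff j)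
  have hsumle (a : I → Fin 3) (ha : a ∈ J) : ∑ i, (a i : ℕ) * b ≤ 2 * (L * b) := by
    have h1 : ∑ i, (a i : ℕ) * b =
        ∑ i ∈ Finset.univ.filter (fun i => (a i : ℕ) ≠ 0), (a i : ℕ) * b := by
      rw [Finset.sum_filter]
      refine Finset.sum_congr rfl fun i _ => ?_
      split_ifs with h
      · rfl
      · rw [not_not.mp h, zero_mul]
    rw [h1]
    refine (Finset.sum_le_card_nsmul _ _ (2 * b) fun i _ => ?_).trans ?_
    · exact Nat.mul_le_mul_right _ (by omega)
    · rw [smul_eq_mul]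
      calc _ ≤ L * (2 * b) := Nat.mul_le_mul_right _ ha
        _ = _ := by ring
  have hprdeg (a) (ha : a ∈ J) : (pr a).natDegree ≤ 2 * (L * b) :=
    (Polynomial.natDegree_prod_le _ _).trans ((Finset.sum_le_sum fun i _ =>
      Polynomial.natDegree_pow_le.trans (Nat.mul_le_mul_left _ (hfb i))).trans (hsumle a ha))
  have hprcoeff (a) (ha : a ∈ J) : ∀ k, (pr a).coeff k ∈ F.level (2 * (L * b)) := by
    have h1 : pr a ∈ F.polynomial.level (∑ i, (a i : ℕ) * b) :=
      F.polynomial.prod_mem _ fun i _ => F.polynomial.pow_mem (hf i) _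
    exact F.polynomial.mono (hsumle a ha) h1
  refine ⟨(Set.range c.coeff) ∪
    (fun q : (I → Fin 3) × ℕ × ℕ => W q.1 q.2.1 q.2.2) '' (J ×ˢ Set.Iic g ×ˢ Set.Iic g), ?_, ?_, ?_,
    ?_⟩
  · refine Set.Finite.union ?_ ?_
    · refine (Set.Finite.subset ((Set.finite_Iic g).image c.coeff |>.union (Set.finite_singleton 0)) ?_)
      rintro _ ⟨k, rfl⟩
      by_cases hk : k ≤ g
      · exact Or.inl ⟨k, hk, rfl⟩
      · exact Or.inr (Polynomial.coeff_eq_zero_of_natDegree_lt (by omega))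
    · exact ((Set.toFinite J).prod ((Set.finite_Iic g).prod (Set.finite_Iic g))).image _
  · rintro w (⟨k, rfl⟩ | ⟨⟨a, e, j⟩, ⟨ha, he, -⟩, rfl⟩)
    · refine F.mono ?_ (hc k)
      nlinarith [Nat.zero_le (g * (2 * (L * b))), Nat.zero_le ((2 * (L * b) + 2 * g) * g)]
    · have he' : e ≤ g := he
      refine F.mono ?_ (rootSum_mem F hc _ (charpoly_hermiteRootMatrix_mem F (hprcoeff a ha) j))
      have h1 : e * (2 * (L * b)) ≤ g * (1 + 2 * (L * b)) := Nat.mul_le_mul he' (by omega)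
      have h2 : (2 * (L * b) + 2 * e) * g ≤ (2 * (L * b) + 2 * g) * g :=
        Nat.mul_le_mul_right _ (by omega)
      exact add_le_add h1 h2
  · rintro w (⟨k, rfl⟩ | ⟨⟨a, e, j⟩, -, rfl⟩) φ φ' hcφ hfφ
    · rw [← Polynomial.coeff_map, ← Polynomial.coeff_map, hcφ]
    · have h1 (φ : A →+* ℝ) : φ (W a e j) = rootSum (c.map φ) (2 * (L * b) + 2 * e)
          ((hermiteRootMatrix e ((pr a).map φ)).charpoly.coeff j) := by
        rw [map_rootSum, ← Polynomial.coeff_map, ← Matrix.charpoly_map, map_hermiteRootMatrix]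
      have h2 : (pr a).map φ = (pr a).map φ' := by
        simp only [pr, Polynomial.map_prod, Polynomial.map_pow, hfφ]
      change φ (W a e j) = φ' (W a e j)
      rw [h1, h1, hcφ, h2]
  · intro φ φ' hsign hφ
    have hzero (k : ℕ) : (c.map φ).coeff k = 0 ↔ (c.map φ').coeff k = 0 := by
      rw [Polynomial.coeff_map, Polynomial.coeff_map, ← sign_eq_zero_iff, hsign _ (Or.inl ⟨k, rfl⟩),
        sign_eq_zero_iff]
    have hsupp : (c.map φ).support = (c.map φ').support := by
      ext k
      rw [Polynomial.mem_support_iff, Polynomial.mem_support_iff, not_iff_not]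
      exact hzero k
    have hφ' : c.map φ' ≠ 0 := by
      rw [Ne, ← Polynomial.support_eq_empty, ← hsupp, Polynomial.support_eq_empty]
      exact hφ
    refine ⟨hφ', fun t ht => ?_⟩
    obtain ⟨e, he⟩ : ∃ e, e = (c.map φ).natDegree := ⟨_, rfl⟩
    have he' : e = (c.map φ').natDegree := by
      rw [he, Polynomial.natDegree_eq_support_max' hφ, Polynomial.natDegree_eq_support_max' hφ']
      simp only [hsupp]
    have heg : e ≤ g := he ▸ Polynomial.natDegree_map_le.trans hcg
    have hcard (φ : A →+* ℝ) (h : e = (c.map φ).natDegree) :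
        Fintype.card {t // t ∈ (c.map φ).roots.toFinset} ≤ g := by
      rw [Fintype.card_coe]
      exact (Multiset.toFinset_card_le _).trans ((Polynomial.card_roots' _).trans (by omega))
    have hprod (φ : A →+* ℝ) (a : I → Fin 3) (t : ℝ) :
        (SignType.sign (((pr a).map φ).eval t) : ℤ) =
          ∏ i, (SignType.sign (((f i).map φ).eval t) : ℤ) ^ (a i : ℕ) := by
      have h1 : SignType.sign (((pr a).map φ).eval t) =
          ∏ i, SignType.sign (((f i).map φ).eval t) ^ (a i : ℕ) := by
        simp only [pr, Polynomial.map_prod, Polynomial.map_pow, Polynomial.eval_prod,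
          Polynomial.eval_pow]
        have := map_prod (signHom : ℝ →*₀ SignType)
          (fun i => (((f i).map φ).eval t) ^ (a i : ℕ)) Finset.univ
        refine this.trans (Finset.prod_congr rfl fun i _ => ?_)
        rw [map_pow]; rfl
      rw [h1]
      have h2 := map_prod (SignType.castHom : SignType →*₀ ℤ)
        (fun i => SignType.sign (((f i).map φ).eval t) ^ (a i : ℕ)) Finset.univ
      refine h2.trans (Finset.prod_congr rfl fun i _ => ?_)
      rw [map_pow]; rfl
    have htmem : t ∈ (c.map φ).roots.toFinset := by
      rw [Multiset.mem_toFinset, Polynomial.mem_roots hφ]; exact ht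
    obtain ⟨⟨t', ht'⟩, hs⟩ := exists_eq_of_sum_prod_sign
      (fun (t : {t // t ∈ (c.map φ).roots.toFinset}) i => SignType.sign (((f i).map φ).eval t.1))
      (fun (t : {t // t ∈ (c.map φ').roots.toFinset}) i => SignType.sign (((f i).map φ').eval t.1))
      L (by have := hcard φ he; have := hcard φ' he'; omega) (fun a ha2 haL => by
        let a' : I → Fin 3 := fun i => ⟨a i, Nat.lt_succ_iff.2 (ha2 i)⟩
        have h1 := sum_sign_congr (h := pr a') hφ hφ' he.symm he'.symm (hprdeg a' haL) fun j hj =>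
          hsign _ (Or.inr ⟨⟨a', e, j⟩, ⟨haL, heg, hj.trans heg⟩, rfl⟩)
        rw [← Finset.sum_coe_sort, ← Finset.sum_coe_sort (c.map φ').roots.toFinset] at h1
        simpa only [hprod] using h1) ⟨t, htmem⟩
    refine ⟨t', ?_, fun i => congrFun hs i⟩
    rw [Multiset.mem_toFinset, Polynomial.mem_roots hφ'] at ht'
    exact ht'

end RootElimination

section LineElimination

variable {m : ℕ}

/-- A polynomial seen as a univariate polynomial in the variable of index `i`; the variables of
larger index are specialized to `0`. -/
noncomputable def linePoly (i : Fin m) :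
    MvPolynomial (Fin m) ℝ →ₐ[ℝ] Polynomial (MvPolynomial (Fin m) ℝ) :=
  aeval fun l => if l < i then Polynomial.C (X l) else if l = i then Polynomial.X else 0

theorem eval_map_linePoly (i : Fin m) {f : MvPolynomial (Fin m) ℝ} (hf : Dep (i + 1) f)
    (x : Fin m → ℝ) (t : ℝ) :
    ((linePoly i f).map (eval x)).eval t = eval (Function.update x i t) f := by
  have h1 : ((linePoly i f).map (eval x)).eval t =
      eval (fun l => if l < i then x l else if l = i then t else 0) f := by
    clear hf
    induction f using MvPolynomial.induction_on with
    | C a => simp [linePoly, Polynomial.algebraMap_apply]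
    | add p q hp hq => rw [map_add, Polynomial.map_add, Polynomial.eval_add, hp, hq, map_add]
    | mul_X p l hp =>
      rw [map_mul, Polynomial.map_mul, Polynomial.eval_mul, hp, map_mul, eval_X]
      congr 1
      simp only [linePoly, aeval_X]
      split_ifs <;> simp
  rw [h1]
  refine hf _ _ fun l hl => ?_
  rcases lt_or_eq_of_le (Nat.lt_succ_iff.mp hl) with h | h
  · have h2 : l < i := h
    simp [h2, h2.ne]
  · have h2 : l = i := Fin.ext h
    simp [h2]

theorem map_linePoly_congr (i : Fin m) (f : MvPolynomial (Fin m) ℝ) {x y : Fin m → ℝ}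
    (h : Agr i x y) : (linePoly i f).map (eval x) = (linePoly i f).map (eval y) := by
  induction f using MvPolynomial.induction_on with
  | C a => simp [linePoly, Polynomial.algebraMap_apply]
  | add p q hp hq => rw [map_add, Polynomial.map_add, Polynomial.map_add, hp, hq]
  | mul_X p l hp =>
    rw [map_mul, Polynomial.map_mul, Polynomial.map_mul, hp]
    congr 1
    simp only [linePoly, aeval_X]
    split_ifs with h1 h2
    · simp [h l h1]
    · simp
    · simp

theorem linePoly_mem (i : Fin m) (f : MvPolynomial (Fin m) ℝ) :
    (linePoly i f).natDegree ≤ f.totalDegree ∧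
      ∀ k, (linePoly i f).coeff k ∈ (RingFiltration.totalDegree (Fin m)).level f.totalDegree := by
  set F := RingFiltration.totalDegree (Fin m)
  have hC (r : ℝ) : (C r : MvPolynomial (Fin m) ℝ) ∈ F.level 0 := by
    rw [RingFiltration.mem_totalDegree, totalDegree_C]
  have hval (l : Fin m) (k) : ((if l < i then Polynomial.C (X l) else if l = i then Polynomial.X else 0 :
      Polynomial (MvPolynomial (Fin m) ℝ)).coeff k) ∈ F.level 1 := by
    split_ifs
    · rw [Polynomial.coeff_C]
      split_ifs
      · rw [RingFiltration.mem_totalDegree, totalDegree_X]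
      · exact zero_mem _
    · rw [Polynomial.coeff_X]
      split_ifs
      · exact F.mono (Nat.zero_le _) F.one_mem
      · exact zero_mem _
    · exact zero_mem _
  have hdeg (l : Fin m) : (if l < i then Polynomial.C (X l) else if l = i then Polynomial.X else 0 :
      Polynomial (MvPolynomial (Fin m) ℝ)).natDegree ≤ 1 := by
    split_ifs <;> simp
  have heq : linePoly i f = ∑ ν ∈ f.support, Polynomial.C (C (coeff ν f)) *
      ∏ l, (if l < i then Polynomial.C (X l) else if l = i then Polynomial.X else 0 :
        Polynomial (MvPolynomial (Fin m) ℝ)) ^ ν l := by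
    rw [linePoly, aeval_def, eval₂_eq']
    rfl
  have hν (ν) (h : ν ∈ f.support) : ∑ l, ν l * 1 ≤ f.totalDegree := by
    have := le_totalDegree h
    rw [Finsupp.sum_fintype _ _ fun _ => rfl] at this
    simpa using this
  constructor
  · rw [heq]
    refine Polynomial.natDegree_sum_le_of_forall_le _ _ fun ν h => ?_
    refine (Polynomial.natDegree_C_mul_le _ _).trans ((Polynomial.natDegree_prod_le _ _).trans
      ((Finset.sum_le_sum fun l _ => ?_).trans (hν ν h)))
    exact Polynomial.natDegree_pow_le.trans (Nat.mul_le_mul_left _ (hdeg l))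
  · rw [heq, ← RingFiltration.mem_polynomial]
    refine sum_mem fun ν h => ?_
    have h1 : (Polynomial.C (C (coeff ν f)) : Polynomial (MvPolynomial (Fin m) ℝ)) ∈
        F.polynomial.level 0 := by
      intro k
      rw [Polynomial.coeff_C]
      split_ifs
      · exact hC _
      · exact zero_mem _
    refine F.polynomial.mono ?_ (F.polynomial.mul_mem h1
      (F.polynomial.prod_mem Finset.univ fun l _ => F.polynomial.pow_mem (a := 1) (hval l) (ν l)))
    rw [zero_add]
    exact hν ν h

/-- The signs of finitely many polynomials in the first `i` variables determine the sign vectors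
realized by a finite family at the zeros of `c` on the line parallel to the `i`-th axis. -/
theorem exists_sign_determination_line (i : Fin m) {c : MvPolynomial (Fin m) ℝ} (hc : Dep (i + 1) c)
    {g : ℕ} (hcg : c.totalDegree ≤ g) {Fam : Set (MvPolynomial (Fin m) ℝ)} (hF : Fam.Finite)
    (hdep : ∀ f ∈ Fam, Dep (i + 1) f) {b : ℕ} (hb : ∀ f ∈ Fam, f.totalDegree ≤ b) {L : ℕ}
    (hL : 2 * g ≤ 2 ^ L) :
    ∃ G : Set (MvPolynomial (Fin m) ℝ), G.Finite ∧
      (∀ w ∈ G, w.totalDegree ≤ g * (1 + 2 * (L * b)) + (2 * (L * b) + 2 * g) * g) ∧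
      (∀ w ∈ G, Dep i w) ∧
      ∀ x x' : Fin m → ℝ, (∀ w ∈ G, SignType.sign (eval x w) = SignType.sign (eval x' w)) →
        (∃ s, eval (Function.update x i s) c ≠ 0) → (∃ s, eval (Function.update x' i s) c ≠ 0) ∧
        ∀ t, eval (Function.update x i t) c = 0 → ∃ t', eval (Function.update x' i t') c = 0 ∧
          ∀ f ∈ Fam, SignType.sign (eval (Function.update x' i t') f) =
            SignType.sign (eval (Function.update x i t) f) := by
  have := hF.fintype
  set F := RingFiltration.totalDegree (Fin m)
  obtain ⟨G, hG, hGdeg, hGdep, hGsign⟩ := exists_sign_determination_roots F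
    (c := linePoly i c) (g := g) (fun k => F.mono hcg ((linePoly_mem i c).2 k))
    ((linePoly_mem i c).1.trans hcg) (I := Fam) (f := fun f => linePoly i f.1) (b := b)
    (fun f k => F.mono (hb f f.2) ((linePoly_mem i f.1).2 k))
    (fun f => (linePoly_mem i f.1).1.trans (hb f f.2)) hL
  have hne (x : Fin m → ℝ) :
      (∃ s, eval (Function.update x i s) c ≠ 0) ↔ (linePoly i c).map (eval x) ≠ 0 := by
    simp only [← eval_map_linePoly i hc]
    constructor
    · rintro ⟨s, hs⟩ h
      rw [h, Polynomial.eval_zero] at hs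
      exact hs rfl
    · intro h
      by_contra! h'
      exact h (Polynomial.funext fun t => by rw [h' t, Polynomial.eval_zero])
  refine ⟨G, hG, hGdeg, fun w hw x y hxy => hGdep w hw _ _ (map_linePoly_congr i c hxy)
    fun f => map_linePoly_congr i f.1 hxy, fun x x' hsign hx => ?_⟩
  obtain ⟨h1, h2⟩ := hGsign (eval x) (eval x') hsign ((hne x).mp hx)
  refine ⟨(hne x').mpr h1, fun t ht => ?_⟩
  obtain ⟨t', ht', hs⟩ := h2 t (by rw [eval_map_linePoly i hc, ht])
  refine ⟨t', by rw [← eval_map_linePoly i hc, ht'], fun f hf => ?_⟩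
  have := hs ⟨f, hf⟩
  rwa [eval_map_linePoly i (hdep f hf), eval_map_linePoly i (hdep f hf)] at this

end LineElimination

section Thom

/-- A sign constraint on a univariate polynomial and its derivatives which cuts out intervals. -/
structure IsThomConstraint (S : ℕ → Set SignType) : Prop where
  ordConnected : ∀ k, (S k).OrdConnected
  semidefinite : ∀ k, (∀ σ ∈ S k, 0 ≤ σ) ∨ ∀ σ ∈ S k, σ ≤ 0

/-- The signs of all the derivatives of `p` at `s` satisfy the constraint `S`. -/
def ThomSat (S : ℕ → Set SignType) (p : Polynomial ℝ) (s : ℝ) : Prop :=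
  ∀ k, SignType.sign ((Polynomial.derivative^[k] p).eval s) ∈ S k

theorem IsThomConstraint.tail {S : ℕ → Set SignType} (hS : IsThomConstraint S) :
    IsThomConstraint fun k => S (k + 1) :=
  ⟨fun _ => hS.ordConnected _, fun _ => hS.semidefinite _⟩

theorem ThomSat.derivative {S : ℕ → Set SignType} {p : Polynomial ℝ} {s : ℝ} (h : ThomSat S p s) :
    ThomSat (fun k => S (k + 1)) (Polynomial.derivative p) s := fun k => h (k + 1)

theorem ThomSat.monotoneOn_or {S : ℕ → Set SignType} (hS : IsThomConstraint S) {p : Polynomial ℝ}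
    {s t : ℝ} (h : ∀ u ∈ Icc s t, SignType.sign ((Polynomial.derivative p).eval u) ∈ S 1) :
    (MonotoneOn (fun u => p.eval u) (Icc s t) ∧ ∀ σ ∈ S 1, 0 ≤ σ) ∨
      (AntitoneOn (fun u => p.eval u) (Icc s t) ∧ ∀ σ ∈ S 1, σ ≤ 0) := by
  rcases hS.semidefinite 1 with h1 | h1
  · refine Or.inl ⟨monotoneOn_of_deriv_nonneg (convex_Icc s t) p.continuousOn
      p.differentiable.differentiableOn fun u hu => ?_, h1⟩
    rw [Polynomial.deriv]
    exact sign_nonneg_iff.mp (h1 _ (h u (interior_subset hu)))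
  · refine Or.inr ⟨antitoneOn_of_deriv_nonpos (convex_Icc s t) p.continuousOn
      p.differentiable.differentiableOn fun u hu => ?_, h1⟩
    rw [Polynomial.deriv]
    exact sign_nonpos_iff.mp (h1 _ (h u (interior_subset hu)))

theorem ThomSat.of_mem_Icc {S : ℕ → Set SignType} (hS : IsThomConstraint S) {p : Polynomial ℝ}
    {s t : ℝ} (hs : ThomSat S p s) (ht : ThomSat S p t) {u : ℝ} (hu : u ∈ Icc s t) :
    ThomSat S p u := by
  obtain ⟨N, hN⟩ : ∃ N, p.natDegree < N := ⟨_, Nat.lt_succ_self _⟩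
  induction N generalizing p S u with
  | zero => omega
  | succ N ih =>
    by_cases h0 : p.natDegree = 0
    · rw [Polynomial.natDegree_eq_zero] at h0
      obtain ⟨a, rfl⟩ := h0
      intro k
      have := hs k
      cases k with
      | zero => simpa using this
      | succ k => simpa [Polynomial.iterate_derivative_C (Nat.succ_pos k)] using this
    have hder : ∀ u ∈ Icc s t, ThomSat (fun k => S (k + 1)) (Polynomial.derivative p) u :=
      fun u hu => ih hS.tail hs.derivative ht.derivative hu
        (lt_of_lt_of_le (Polynomial.natDegree_derivative_lt h0) (Nat.lt_succ_iff.mp hN))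
    intro k
    cases k with
    | succ k => exact hder u hu k
    | zero =>
      have hst : s ≤ t := hu.1.trans hu.2
      have h3 := hs 0
      have h4 := ht 0
      rcases ThomSat.monotoneOn_or hS fun u hu => hder u hu 0 with ⟨hm, -⟩ | ⟨hm, -⟩
      · exact (hS.ordConnected 0).out h3 h4
          ⟨SignType.sign.monotone (hm ⟨le_rfl, hst⟩ hu hu.1),
            SignType.sign.monotone (hm hu ⟨hst, le_rfl⟩ hu.2)⟩
      · exact (hS.ordConnected 0).out h4 h3
          ⟨SignType.sign.monotone (hm hu ⟨hst, le_rfl⟩ hu.2),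
            SignType.sign.monotone (hm ⟨le_rfl, hst⟩ hu hu.1)⟩

theorem ThomSat.eq_of_le {S : ℕ → Set SignType} (hS : IsThomConstraint S) {p : Polynomial ℝ}
    (hp : p ≠ 0) {s t : ℝ} (hs : ThomSat S p s) (ht : ThomSat S p t) (hs0 : p.eval s = 0)
    (ht0 : p.eval t = 0) (hst : s ≤ t) : s = t := by
  by_contra hne
  have hlt := lt_of_le_of_ne hst hne
  refine hp (Polynomial.eq_zero_of_infinite_isRoot _ (Set.Infinite.mono (s := Icc s t) ?_
    (Icc_infinite hlt)))
  intro u hu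
  have hder : ∀ u ∈ Icc s t, SignType.sign ((Polynomial.derivative p).eval u) ∈ S 1 :=
    fun u hu => ThomSat.of_mem_Icc hS hs ht hu 1
  rcases ThomSat.monotoneOn_or hS hder with ⟨hm, -⟩ | ⟨hm, -⟩
  · have h1 := hm ⟨le_rfl, hst⟩ hu hu.1
    have h2 := hm hu ⟨hst, le_rfl⟩ hu.2
    simp only [hs0, ht0] at h1 h2
    exact le_antisymm h2 h1
  · have h1 := hm ⟨le_rfl, hst⟩ hu hu.1
    have h2 := hm hu ⟨hst, le_rfl⟩ hu.2
    simp only [hs0, ht0] at h1 h2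
    exact le_antisymm h1 h2

theorem ThomSat.eq {S : ℕ → Set SignType} (hS : IsThomConstraint S) {p : Polynomial ℝ}
    (hp : p ≠ 0) {s t : ℝ} (hs : ThomSat S p s) (ht : ThomSat S p t) (hs0 : p.eval s = 0)
    (ht0 : p.eval t = 0) : s = t := by
  rcases le_total s t with h | h
  · exact ThomSat.eq_of_le hS hp hs ht hs0 ht0 h
  · exact (ThomSat.eq_of_le hS hp ht hs ht0 hs0 h).symm

/-- All the derivatives of `p` at `s` and of `q` at `t` have the same signs. -/
def SameThom (p : Polynomial ℝ) (s : ℝ) (q : Polynomial ℝ) (t : ℝ) : Prop :=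
  ∀ k, SignType.sign ((Polynomial.derivative^[k] p).eval s) =
    SignType.sign ((Polynomial.derivative^[k] q).eval t)

theorem SameThom.symm {p q : Polynomial ℝ} {s t : ℝ} (h : SameThom p s q t) : SameThom q t p s :=
  fun k => (h k).symm

theorem SameThom.derivative {p q : Polynomial ℝ} {s t : ℝ} (h : SameThom p s q t) :
    SameThom (Polynomial.derivative p) s (Polynomial.derivative q) t := fun k => h (k + 1)

theorem isThomConstraint_singleton (σ : ℕ → SignType) : IsThomConstraint fun k => {σ k} :=
  ⟨fun _ => ordConnected_singleton, fun k => by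
    rcases le_total 0 (σ k) with h | h
    · exact Or.inl fun τ hτ => by rwa [mem_singleton_iff.mp hτ]
    · exact Or.inr fun τ hτ => by rwa [mem_singleton_iff.mp hτ]⟩

theorem isThomConstraint_pair (σ : ℕ → SignType) :
    IsThomConstraint fun k => {τ | τ = 0 ∨ τ = σ k} := by
  constructor
  · intro k
    refine ⟨fun a ha b hb c hc => ?_⟩
    simp only [mem_ofPred_eq, mem_Icc] at *
    revert ha hb hc
    generalize σ k = d
    revert a b c d
    decide
  · intro k
    simp only [mem_ofPred_eq]
    generalize σ k = d
    revert d
    decide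

theorem SameThom.eq {p : Polynomial ℝ} (hp : p ≠ 0) {s t : ℝ} (h : SameThom p s p t)
    (hs : p.eval s = 0) : s = t := by
  refine ThomSat.eq (isThomConstraint_singleton fun k =>
    SignType.sign ((Polynomial.derivative^[k] p).eval s)) hp (fun k => rfl) (fun k => (h k).symm) hs
    ?_
  have := h 0
  simp only [Function.iterate_zero, id] at this
  rw [hs, sign_zero] at this
  exact sign_eq_zero_iff.mp this.symm

theorem lt_of_sameThom_aux {p p' : Polynomial ℝ} {s t s' t' : ℝ} (hs : SameThom p s p' s')
    (ht : SameThom p t p' t') (hst : s < t) (hne : ¬ SameThom p s p t) : s' < t' := by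
  obtain ⟨N, hN⟩ : ∃ N, p.natDegree < N := ⟨_, Nat.lt_succ_self _⟩
  induction N generalizing p p' with
  | zero => omega
  | succ N ih =>
    by_cases h0 : p.natDegree = 0
    · rw [Polynomial.natDegree_eq_zero] at h0
      obtain ⟨a, rfl⟩ := h0
      refine absurd (fun k => ?_) hne
      cases k with
      | zero => simp
      | succ k => simp [Polynomial.iterate_derivative_C (Nat.succ_pos k)]
    by_cases hd : SameThom (Polynomial.derivative p) s (Polynomial.derivative p) t
    swap
    · exact ih hs.derivative ht.derivative hd
        (lt_of_lt_of_le (Polynomial.natDegree_derivative_lt h0) (Nat.lt_succ_iff.mp hN))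
    have hsign : SignType.sign (p.eval s) ≠ SignType.sign (p.eval t) := by
      refine fun h => hne fun k => ?_
      cases k with
      | zero => exact h
      | succ k => exact hd k
    let S : ℕ → Set SignType := fun k => {SignType.sign ((Polynomial.derivative^[k] p).eval s)}
    have hS : IsThomConstraint S := isThomConstraint_singleton fun k =>
      SignType.sign ((Polynomial.derivative^[k] p).eval s)
    have hder : ∀ u ∈ Icc s t, SignType.sign ((Polynomial.derivative p).eval u) ∈ S 1 :=
      fun u hu => ThomSat.of_mem_Icc hS.tail (fun k => rfl) (fun k => (hd k).symm) hu 0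
    by_contra hle
    rw [not_lt] at hle
    have hder' : ∀ u ∈ Icc t' s', SignType.sign ((Polynomial.derivative p').eval u) ∈ S 1 :=
      fun u hu => ThomSat.of_mem_Icc hS.tail (p := Polynomial.derivative p')
        (fun k => ((hd k).trans (ht.derivative k)).symm)
        (fun k => (hs.derivative k).symm) hu 0
    have e1 : SignType.sign (p.eval s) = SignType.sign (p'.eval s') := hs 0
    have e2 : SignType.sign (p.eval t) = SignType.sign (p'.eval t') := ht 0
    have hboth : (∀ σ ∈ S 1, 0 ≤ σ) → (∀ σ ∈ S 1, σ ≤ 0) → False := by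
      intro h1 h2
      have h3 : ∀ u ∈ Icc s t, (Polynomial.derivative p).eval u = 0 := fun u hu =>
        sign_eq_zero_iff.mp (le_antisymm (h2 _ (hder u hu)) (h1 _ (hder u hu)))
      have h4 : Polynomial.derivative p = 0 :=
        Polynomial.eq_zero_of_infinite_isRoot _ (Set.Infinite.mono h3 (Icc_infinite hst))
      exact h0 (Polynomial.derivative_eq_zero.mp h4)
    rcases ThomSat.monotoneOn_or hS hder with ⟨hm, hσ⟩ | ⟨hm, hσ⟩ <;>
    rcases ThomSat.monotoneOn_or hS hder' with ⟨hm', hσ'⟩ | ⟨hm', hσ'⟩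
    · have h1 := SignType.sign.monotone (hm ⟨le_rfl, hst.le⟩ ⟨hst.le, le_rfl⟩ hst.le)
      have h2 := SignType.sign.monotone (hm' ⟨le_rfl, hle⟩ ⟨hle, le_rfl⟩ hle)
      simp only at h1 h2
      rw [← e1, ← e2] at h2
      exact hsign (le_antisymm h1 h2)
    · exact hboth hσ hσ'
    · exact hboth hσ' hσ
    · have h1 := SignType.sign.monotone (hm ⟨le_rfl, hst.le⟩ ⟨hst.le, le_rfl⟩ hst.le)
      have h2 := SignType.sign.monotone (hm' ⟨le_rfl, hle⟩ ⟨hle, le_rfl⟩ hle)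
      simp only at h1 h2
      rw [← e1, ← e2] at h2
      exact hsign (le_antisymm h2 h1)

/-- The signs of the derivatives determine the relative position of two points, provided one of
them is a root. -/
theorem lt_of_sameThom {p p' : Polynomial ℝ} (hp : p ≠ 0) {s t s' t' : ℝ}
    (hs : SameThom p s p' s') (ht : SameThom p t p' t') (h0 : p.eval s = 0 ∨ p.eval t = 0)
    (hst : s < t) : s' < t' := by
  refine lt_of_sameThom_aux hs ht hst fun h => hst.ne ?_
  rcases h0 with h0 | h0
  · exact h.eq hp h0
  · exact (h.symm.eq hp h0).symm

/-- The signs of the derivatives at a point determine the sign just after this point. -/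
theorem exists_sign_right {p p' : Polynomial ℝ} {s s' : ℝ} (h : SameThom p s p' s') :
    ∃ σ : SignType, ∃ ε > 0, ∀ u, 0 < u → u < ε →
      SignType.sign (p.eval (s + u)) = σ ∧ SignType.sign (p'.eval (s' + u)) = σ := by
  have hcont (p : Polynomial ℝ) (s : ℝ) (hs : p.eval s ≠ 0) : ∃ ε > 0, ∀ u, 0 < u → u < ε →
      SignType.sign (p.eval (s + u)) = SignType.sign (p.eval s) := by
    have h1 : Filter.Tendsto (fun u => p.eval (s + u)) (nhds 0) (nhds (p.eval s)) := by
      have : Continuous fun u => p.eval (s + u) := p.continuous.comp (by fun_prop)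
      simpa using this.tendsto 0
    have h2 : ∀ᶠ u in nhds (0 : ℝ), SignType.sign (p.eval (s + u)) = SignType.sign (p.eval s) := by
      rcases lt_or_gt_of_ne hs with h3 | h3
      · filter_upwards [h1.eventually (gt_mem_nhds h3)] with u hu
        rw [sign_neg hu, sign_neg h3]
      · filter_upwards [h1.eventually (lt_mem_nhds h3)] with u hu
        rw [sign_pos hu, sign_pos h3]
    obtain ⟨ε, hε, h4⟩ := Metric.eventually_nhds_iff.mp h2
    exact ⟨ε, hε, fun u hu hu' => h4 (by rw [Real.dist_eq, sub_zero, abs_of_pos hu]; exact hu')⟩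
  have hmvt (p : Polynomial ℝ) (s ε : ℝ) (σ : SignType) (h0 : p.eval s = 0)
      (hd : ∀ u, 0 < u → u < ε → SignType.sign ((Polynomial.derivative p).eval (s + u)) = σ) :
      ∀ u, 0 < u → u < ε → SignType.sign (p.eval (s + u)) = σ := by
    intro u hu hu'
    obtain ⟨ξ, hξ, h1⟩ := exists_deriv_eq_slope (fun u => p.eval u) (lt_add_of_pos_right s hu)
      p.continuousOn p.differentiable.differentiableOn
    rw [Polynomial.deriv, h0, sub_zero, add_sub_cancel_left] at h1
    have h2 := hd (ξ - s) (by linarith [hξ.1]) (by linarith [hξ.2])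
    rw [add_sub_cancel, h1, div_eq_mul_inv, sign_mul, sign_pos (inv_pos.mpr hu), mul_one] at h2
    exact h2
  obtain ⟨N, hN⟩ : ∃ N, p.natDegree < N ∧ p'.natDegree < N :=
    ⟨max p.natDegree p'.natDegree + 1, by omega, by omega⟩
  induction N generalizing p p' with
  | zero => omega
  | succ N ih =>
    have e : SignType.sign (p.eval s) = SignType.sign (p'.eval s') := h 0
    by_cases h0 : p.eval s = 0
    · have h0' : p'.eval s' = 0 := by
        rw [h0, sign_zero] at e
        exact sign_eq_zero_iff.mp e.symm
      by_cases hp : p = 0 ∧ p' = 0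
      · exact ⟨0, 1, one_pos, by simp [hp.1, hp.2]⟩
      have hdeg (p : Polynomial ℝ) (s : ℝ) (h0 : p.eval s = 0) (hN : p.natDegree < N + 1) (hN0 : N ≠ 0) :
          (Polynomial.derivative p).natDegree < N := by
        by_cases h1 : p.natDegree = 0
        · rw [Polynomial.natDegree_eq_zero] at h1
          obtain ⟨a, rfl⟩ := h1
          simpa using Nat.pos_of_ne_zero hN0
        · exact lt_of_lt_of_le (Polynomial.natDegree_derivative_lt h1) (Nat.lt_succ_iff.mp hN)
      have hN0 : N ≠ 0 := by
        rintro rfl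
        have hz (p : Polynomial ℝ) (s : ℝ) (h0 : p.eval s = 0) (hN : p.natDegree < 0 + 1) :
            p = 0 := by
          obtain ⟨a, rfl⟩ := Polynomial.natDegree_eq_zero.mp (Nat.lt_one_iff.mp hN)
          simpa using h0
        exact hp ⟨hz p s h0 hN.1, hz p' s' h0' hN.2⟩
      obtain ⟨σ, ε, hε, h1⟩ := ih h.derivative ⟨hdeg p s h0 hN.1 hN0, hdeg p' s' h0' hN.2 hN0⟩
      exact ⟨σ, ε, hε, fun u hu hu' => ⟨hmvt p s ε σ h0 (fun u hu hu' => (h1 u hu hu').1) u hu hu',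
        hmvt p' s' ε σ h0' (fun u hu hu' => (h1 u hu hu').2) u hu hu'⟩⟩
    · have h0' : p'.eval s' ≠ 0 := by
        rw [← sign_ne_zero, ← e, sign_ne_zero]; exact h0
      obtain ⟨ε, hε, h1⟩ := hcont p s h0
      obtain ⟨ε', hε', h1'⟩ := hcont p' s' h0'
      exact ⟨_, min ε ε', lt_min hε hε', fun u hu hu' => ⟨h1 u hu (lt_min_iff.mp hu').1,
        (h1' u hu (lt_min_iff.mp hu').2).trans e.symm⟩⟩

end Thom

section Topology

open Filter Topology

theorem isPreconnected_ultrafilter_limit {X ι : Type*} [TopologicalSpace X] [T2Space X]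
    (u : Ultrafilter ι) {Y : Set X} (hY : IsCompact Y) {C : ι → Set X}
    (hC : ∀ᶠ w in u, IsPreconnected (C w) ∧ C w ⊆ Y) :
    IsPreconnected {z | ∀ W ∈ 𝓝 z, ∀ᶠ w in u, (C w ∩ W).Nonempty} := by
  set D : Set X := {z | ∀ W ∈ 𝓝 z, ∀ᶠ w in u, (C w ∩ W).Nonempty} with hD
  have hDc : IsClosed D := by
    refine isClosed_of_closure_subset fun z hz W hW => ?_
    obtain ⟨z', hz', hz'D⟩ := mem_closure_iff_nhds.mp hz _ (interior_mem_nhds.mpr hW)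
    exact hz'D W (mem_interior_iff_mem_nhds.mp hz')
  have hDY : D ⊆ Y := by
    intro z hz
    by_contra hzY
    obtain ⟨w, hw, hw'⟩ := ((hz Yᶜ (hY.isClosed.isOpen_compl.mem_nhds hzY)).and hC).exists
    obtain ⟨p, hp, hp'⟩ := hw
    exact hp' (hw'.2 hp)
  have hDk : IsCompact D := hY.of_isClosed_subset hDc hDY
  rw [isPreconnected_closed_iff]
  intro t t' ht ht' htt ⟨z, hz, hzt⟩ ⟨z', hz', hzt'⟩
  by_contra hne
  have hdisj : Disjoint (D ∩ t) (D ∩ t') := by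
    rw [Set.disjoint_left]
    exact fun p hp hp' => hne ⟨p, hp.1, hp.2, hp'.2⟩
  obtain ⟨U, V, hU, hV, htU, htV, hUV⟩ :=
    SeparatedNhds.of_isCompact_isCompact (hDk.inter_right ht) (hDk.inter_right ht') hdisj
  have hex : ∀ᶠ w in u, ∃ p, p ∈ Y ∧ p ∈ C w ∧ p ∉ U ∪ V := by
    filter_upwards [hC, hz U (hU.mem_nhds (htU ⟨hz, hzt⟩)), hz' V (hV.mem_nhds (htV ⟨hz', hzt'⟩))]
      with w hw h1 h2
    by_contra hcon
    push Not at hcon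
    have h3 : C w ⊆ U := hw.1.subset_left_of_subset_union hU hV hUV
      (fun p hp => hcon p (hw.2 hp) hp) h1
    obtain ⟨p, hp, hpV⟩ := h2
    exact Set.disjoint_left.mp hUV (h3 hp) hpV
  classical
  have : Nonempty X := ⟨z⟩
  let c : ι → X := fun w => if h : ∃ p, p ∈ Y ∧ p ∈ C w ∧ p ∉ U ∪ V then h.choose else z
  have hc : ∀ᶠ w in u, c w ∈ Y ∧ c w ∈ C w ∧ c w ∉ U ∪ V := by
    filter_upwards [hex] with w hw
    simp only [c, dif_pos hw]
    exact hw.choose_spec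
  obtain ⟨p, -, hp⟩ := hY.ultrafilter_le_nhds (u.map c)
    (le_principal_iff.mpr (hc.mono fun w hw => hw.1))
  have hp' : Tendsto c u (𝓝 p) := hp
  have hpD : p ∈ D := by
    intro W hW
    filter_upwards [hc, hp'.eventually hW] with w h1 h2
    exact ⟨c w, h1.2.1, h2⟩
  have hpUV : p ∉ U ∪ V := by
    intro h
    obtain ⟨w, h1, h2⟩ := ((hp'.eventually ((hU.union hV).mem_nhds h)).and hc).exists
    exact h2.2.2 h1
  rcases htt hpD with h | h
  · exact hpUV (Or.inl (htU ⟨hpD, h⟩))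
  · exact hpUV (Or.inr (htV ⟨hpD, h⟩))

/-- `y` and `z` are joined by a connected subset of the slice of `T` through `y` obtained by
fixing the first `i` coordinates. -/
def Conn {m : ℕ} (T : Set (Fin m → ℝ)) (i : ℕ) (y z : Fin m → ℝ) : Prop :=
  ∃ C : Set (Fin m → ℝ), IsPreconnected C ∧ C ⊆ T ∧ (∀ w ∈ C, Agr i y w) ∧ y ∈ C ∧ z ∈ C

namespace Conn

variable {m i : ℕ} {T : Set (Fin m → ℝ)} {x y z : Fin m → ℝ}

theorem refl (i : ℕ) (hx : x ∈ T) : Conn T i x x :=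
  ⟨{x}, isPreconnected_singleton, by simpa using hx, by simp [Agr.refl], rfl, rfl⟩

theorem agr (h : Conn T i x y) : Agr i x y := by
  obtain ⟨C, -, -, h1, -, h3⟩ := h
  exact h1 y h3

theorem left_mem (h : Conn T i x y) : x ∈ T := by
  obtain ⟨C, -, h1, -, h2, -⟩ := h
  exact h1 h2

theorem symm (h : Conn T i x y) : Conn T i y x := by
  have h0 := h.agr
  obtain ⟨C, h1, h2, h3, h4, h5⟩ := h
  exact ⟨C, h1, h2, fun w hw => h0.symm.trans (h3 w hw), h5, h4⟩

theorem right_mem (h : Conn T i x y) : y ∈ T := h.symm.left_mem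

theorem trans (h : Conn T i x y) (h' : Conn T i y z) : Conn T i x z := by
  have h0 := h.agr
  obtain ⟨C, h1, h2, h3, h4, h5⟩ := h
  obtain ⟨C', h1', h2', h3', h4', h5'⟩ := h'
  exact ⟨C ∪ C', IsPreconnected.union y h5 h4' h1 h1', union_subset h2 h2',
    fun w hw => hw.elim (h3 w) fun hw => h0.trans (h3' w hw), Or.inl h4, Or.inr h5'⟩

theorem mono {j : ℕ} (hij : i ≤ j) (h : Conn T j x y) : Conn T i x y := by
  obtain ⟨C, h1, h2, h3, h4, h5⟩ := h
  exact ⟨C, h1, h2, fun w hw => (h3 w hw).mono hij, h4, h5⟩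

theorem of_segment (h : ∀ t ∈ Icc (0 : ℝ) 1, x + t • (y - x) ∈ T) (hxy : Agr i x y) :
    Conn T i x y := by
  refine ⟨(fun t : ℝ => x + t • (y - x)) '' Icc 0 1, ?_, ?_, ?_, ⟨0, by simp⟩, ⟨1, by simp⟩⟩
  · exact isPreconnected_Icc.image _ (by fun_prop)
  · rintro _ ⟨t, ht, rfl⟩
    exact h t ht
  · rintro _ ⟨t, ht, rfl⟩ l hl
    simp [hxy l hl]

theorem of_limit {ι : Type*} (u : Ultrafilter ι) (hT : IsCompact T) {a b : ι → Fin m → ℝ}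
    (h : ∀ᶠ w in u, Conn T i (a w) (b w)) (ha : Tendsto a u (𝓝 x)) (hb : Tendsto b u (𝓝 y)) :
    Conn T i x y := by
  classical
  let C : ι → Set (Fin m → ℝ) := fun w => if h : Conn T i (a w) (b w) then h.choose else ∅
  have hC : ∀ᶠ w in u, IsPreconnected (C w) ∧ C w ⊆ T ∧ (∀ p ∈ C w, Agr i (a w) p) ∧ a w ∈ C w ∧
      b w ∈ C w := by
    filter_upwards [h] with w hw
    simp only [C, dif_pos hw]
    exact hw.choose_spec
  refine ⟨_, isPreconnected_ultrafilter_limit u hT (hC.mono fun w hw => ⟨hw.1, hw.2.1⟩), ?_, ?_,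
    ?_, ?_⟩
  · intro z hz
    by_contra hzT
    obtain ⟨w, ⟨p, hp, hp'⟩, hw⟩ :=
      ((hz Tᶜ (hT.isClosed.isOpen_compl.mem_nhds hzT)).and hC).exists
    exact hp' (hw.2.1 hp)
  · intro z hz l hl
    by_contra hne
    obtain ⟨U, V, hU, hV, hxU, hzV, hUV⟩ := t2_separation hne
    have h1 : ∀ᶠ w in u, a w l ∈ U :=
      ((continuous_apply l).continuousAt.tendsto.comp ha).eventually (hU.mem_nhds hxU)
    have h2 := hz ((fun p => p l) ⁻¹' V) ((continuous_apply l).continuousAt (hV.mem_nhds hzV))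
    obtain ⟨w, h3, ⟨p, hp, hpV⟩, hw⟩ := (h1.and (h2.and hC)).exists
    rw [hw.2.2.1 p hp l hl] at h3
    exact Set.disjoint_left.mp hUV h3 hpV
  · intro W hW
    filter_upwards [hC, ha.eventually hW] with w hw h1
    exact ⟨a w, hw.2.2.2.1, h1⟩
  · intro W hW
    filter_upwards [hC, hb.eventually hW] with w hw h1
    exact ⟨b w, hw.2.2.2.2, h1⟩

end Conn

theorem hasFDerivAt_eval {m : ℕ} (p : MvPolynomial (Fin m) ℝ) (x : Fin m → ℝ) :
    HasFDerivAt (fun y => eval y p)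
      (∑ l, eval x (pderiv l p) • ContinuousLinearMap.proj (R := ℝ) (φ := fun _ : Fin m => ℝ) l)
      x := by
  induction p using MvPolynomial.induction_on with
  | C a => simpa using hasFDerivAt_const a x
  | add p q hp hq =>
    simp only [map_add, add_smul, Finset.sum_add_distrib]
    exact hp.add hq
  | mul_X p i hp =>
    have h1 := hp.mul (hasFDerivAt_apply (𝕜 := ℝ) i x)
    simp only [map_mul, eval_X]
    refine h1.congr_fderiv ?_
    ext v
    simp [Derivation.leibniz, pderiv_X, Pi.single_apply, add_mul, Finset.sum_add_distrib,
      Finset.mul_sum, apply_ite, ite_mul]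
    ring_nf

theorem hasDerivAt_eval_line {m : ℕ} (p : MvPolynomial (Fin m) ℝ) (x v : Fin m → ℝ) (t : ℝ) :
    HasDerivAt (fun s : ℝ => eval (x + s • v) p) (∑ l, eval (x + t • v) (pderiv l p) * v l) t := by
  have h1 : HasDerivAt (fun s : ℝ => x + s • v) v t := by
    simpa using ((hasDerivAt_id t).smul_const v).const_add x
  have h2 := (hasFDerivAt_eval p (x + t • v)).comp_hasDerivAt t h1
  refine HasDerivAt.congr_deriv h2 ?_
  simp

end Topology

section Sublevel

open Filter Topology

/-- The points at which all the partial derivatives of `P` with index at least `i` vanish. -/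
def IsCrit {m : ℕ} (P : MvPolynomial (Fin m) ℝ) (i : ℕ) (ξ : Fin m → ℝ) : Prop :=
  ∀ l : Fin m, i ≤ (l : ℕ) → eval ξ (pderiv l P) = 0

/-- The slice through `o` of the sublevel set `P ≤ 0` obtained by fixing the first `a`
coordinates. -/
def sublevel {m : ℕ} (P : MvPolynomial (Fin m) ℝ) (a : ℕ) (o : Fin m → ℝ) : Set (Fin m → ℝ) :=
  {w | Agr a o w ∧ eval w P ≤ 0}

variable {m : ℕ} {P : MvPolynomial (Fin m) ℝ} {a i : ℕ} {o z : Fin m → ℝ}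

theorem exists_strictAntiOn_eval {l : Fin m} (hl : eval z (pderiv l P) ≠ 0) :
    ∃ v : Fin m → ℝ, (∀ k, k ≠ l → v k = 0) ∧ ∃ δ > 0, ∀ u ∈ Metric.ball z δ,
      StrictAntiOn (fun s : ℝ => eval (u + s • v) P) (Icc 0 δ) := by
  set c := eval z (pderiv l P) with hc
  refine ⟨Pi.single l (-c), fun k hk => Pi.single_eq_of_ne hk _, ?_⟩
  set v : Fin m → ℝ := Pi.single l (-c) with hv
  have hsum (y : Fin m → ℝ) : ∑ k, eval y (pderiv k P) * v k = -c * eval y (pderiv l P) := by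
    rw [Finset.sum_eq_single l]
    · rw [hv, Pi.single_eq_same, mul_comm]
    · intro k _ hk
      rw [hv, Pi.single_eq_of_ne hk, mul_zero]
    · simp
  have hcont : Continuous fun q : (Fin m → ℝ) × ℝ => -c * eval (q.1 + q.2 • v) (pderiv l P) :=
    continuous_const.mul ((MvPolynomial.continuous_eval _).comp (by fun_prop))
  have hneg : ∀ᶠ q in 𝓝 (z, (0 : ℝ)), -c * eval (q.1 + q.2 • v) (pderiv l P) < 0 := by
    refine hcont.continuousAt.eventually_lt continuousAt_const ?_
    simp only [zero_smul, add_zero, ← hc, neg_mul]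
    exact neg_neg_of_pos (mul_self_pos.mpr hl)
  obtain ⟨ε, hε, h⟩ := Metric.eventually_nhds_iff.mp hneg
  refine ⟨ε / 2, by positivity, fun u hu => strictAntiOn_of_deriv_neg (convex_Icc _ _) ?_ ?_⟩
  · exact ((MvPolynomial.continuous_eval P).comp (by fun_prop)).continuousOn
  · intro s hs
    rw [interior_Icc] at hs
    rw [(hasDerivAt_eval_line P u v s).deriv, hsum]
    refine @h (u, s) ?_
    rw [Prod.dist_eq, Real.dist_eq, sub_zero]
    refine max_lt (lt_trans (Metric.mem_ball.mp hu) (by linarith)) ?_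
    rw [abs_of_pos hs.1]
    linarith [hs.2]

theorem Agr.add_smul {y z v : Fin m → ℝ} (h : Agr i y z) (hv : ∀ k : Fin m, (k : ℕ) < i → v k = 0)
    (s : ℝ) : Agr i y (z + s • v) := fun k hk => by simp [hv k hk, h k hk]

theorem isClosed_conn {T : Set (Fin m → ℝ)} (hT : IsCompact T) (i : ℕ) (z : Fin m → ℝ) :
    IsClosed {w | Conn T i z w} := by
  rw [isClosed_iff_ultrafilter]
  intro x u hu hs
  by_cases hz : z ∈ T
  · exact Conn.of_limit u hT (a := fun _ => z) (b := id) hs tendsto_const_nhds hu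
  · obtain ⟨w, hw⟩ := u.nonempty_of_mem hs
    exact absurd (Conn.left_mem hw) hz

/-- Every point of the sublevel set is joined, within its slice, to a critical point. -/
theorem exists_isCrit_conn (hT : IsCompact (sublevel P a o)) (hai : a ≤ i)
    (hz : z ∈ sublevel P a o) : ∃ ξ, IsCrit P i ξ ∧ Conn (sublevel P a o) i z ξ := by
  have hK : IsCompact {w | Conn (sublevel P a o) i z w} :=
    hT.of_isClosed_subset (isClosed_conn hT i z) fun w hw => Conn.right_mem hw
  obtain ⟨ξ, hξ, hmin⟩ := hK.exists_isMinOn ⟨z, Conn.refl i hz⟩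
    (MvPolynomial.continuous_eval P).continuousOn
  refine ⟨ξ, fun l hl => ?_, hξ⟩
  by_contra hne
  obtain ⟨v, hv, δ, hδ, h⟩ := exists_strictAntiOn_eval hne
  have h1 := h ξ (Metric.mem_ball_self hδ)
  have hξT : ξ ∈ sublevel P a o := Conn.right_mem hξ
  have hvk : ∀ k : Fin m, (k : ℕ) < i → v k = 0 := fun k hk =>
    hv k (by rintro rfl; omega)
  have h0 : (0 : ℝ) ∈ Icc 0 δ := ⟨le_rfl, hδ.le⟩
  have hconn : Conn (sublevel P a o) i ξ (ξ + δ • v) := by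
    refine Conn.of_segment (fun t ht => ?_) ((Agr.refl i ξ).add_smul hvk δ)
    rw [add_sub_cancel_left, smul_smul]
    refine ⟨hξT.1.add_smul (fun k hk => hvk k (hk.trans_le hai)) _, le_trans ?_ hξT.2⟩
    have := h1.antitoneOn h0 (b := t * δ) ⟨by have := ht.1; positivity, by nlinarith [ht.2]⟩
      (by have := ht.1; positivity)
    simpa using this
  have h2 : eval ξ P ≤ eval (ξ + δ • v) P := hmin (Conn.trans hξ hconn)
  have h3 := h1 h0 ⟨hδ.le, le_rfl⟩ hδ
  simp only [zero_smul, add_zero] at h3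
  exact absurd h2 (not_le.mpr h3)

/-- Near a regular point, the sublevel set can be pushed into its interior. -/
theorem exists_push (hz : z ∈ sublevel P a o) (hreg : eval z P < 0 ∨ ¬ IsCrit P i z) {r : ℝ}
    (hr : 0 < r) :
    ∃ v : Fin m → ℝ, (∀ k : Fin m, (k : ℕ) < i → v k = 0) ∧ ‖v‖ < r ∧ ∃ δ > 0,
      ∀ u ∈ Metric.ball z δ, eval (u + v) P < 0 ∧
        (eval u P ≤ 0 → ∀ t ∈ Icc (0 : ℝ) 1, eval (u + t • v) P ≤ 0) := by
  have hopen (v : Fin m → ℝ) (h : eval (z + v) P < 0) :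
      ∃ δ > 0, ∀ u ∈ Metric.ball z δ, eval (u + v) P < 0 := by
    have hcont : Continuous fun u => eval (u + v) P :=
      (MvPolynomial.continuous_eval P).comp (by fun_prop)
    obtain ⟨δ, hδ, h1⟩ := Metric.eventually_nhds_iff.mp
      (hcont.continuousAt.eventually_lt continuousAt_const h)
    exact ⟨δ, hδ, fun u hu => h1 hu⟩
  by_cases hneg : eval z P < 0
  · obtain ⟨δ, hδ, h⟩ := hopen 0 (by simpa using hneg)
    exact ⟨0, by simp, by simpa using hr, δ, hδ, fun u hu => ⟨h u hu, fun h1 t _ => by simpa using h1⟩⟩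
  · have hcr := hreg.resolve_left hneg
    unfold IsCrit at hcr
    push Not at hcr
    obtain ⟨l, hl, hne⟩ := hcr
    obtain ⟨v, hv, δ, hδ, h⟩ := exists_strictAntiOn_eval hne
    have h0 : (0 : ℝ) ∈ Icc 0 δ := ⟨le_rfl, hδ.le⟩
    obtain ⟨s, hs, hsδ, hsr⟩ : ∃ s : ℝ, 0 < s ∧ s ≤ δ ∧ ‖s • v‖ < r := by
      have h1 : ∀ᶠ s in 𝓝[>] (0 : ℝ), ‖s • v‖ < r := by
        refine Filter.Eventually.filter_mono nhdsWithin_le_nhds ?_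
        have : Continuous fun s : ℝ => ‖s • v‖ := by fun_prop
        exact this.continuousAt.eventually_lt continuousAt_const (by simpa using hr)
      obtain ⟨s, h2, h3⟩ := (h1.and (Ioc_mem_nhdsGT hδ)).exists
      exact ⟨s, h3.1, h3.2, h2⟩
    have h1 := h z (Metric.mem_ball_self hδ) h0 ⟨hs.le, hsδ⟩ hs
    simp only [zero_smul, add_zero] at h1
    obtain ⟨δ', hδ', h2⟩ := hopen (s • v) (h1.trans_le hz.2)
    refine ⟨s • v, fun k hk => ?_, hsr, min δ δ', lt_min hδ hδ', fun u hu => ⟨?_, ?_⟩⟩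
    · rw [Pi.smul_apply, hv k (by rintro rfl; omega), smul_zero]
    · exact h2 u (Metric.ball_subset_ball (min_le_right _ _) hu)
    · intro h3 t ht
      rw [smul_smul]
      have := (h u (Metric.ball_subset_ball (min_le_left _ _) hu)).antitoneOn h0 (b := t * s)
        ⟨by have := ht.1; positivity, by nlinarith [ht.2]⟩ (by have := ht.1; positivity)
      refine le_trans this ?_
      simpa using h3

theorem exists_ball_conn (hai : a ≤ i) (hz : z ∈ sublevel P a o)
    (hreg : eval z P < 0 ∨ ¬ IsCrit P i z) :
    ∃ δ > 0, ∀ u ∈ Metric.ball z δ, ∀ w ∈ Metric.ball z δ, u ∈ sublevel P a o →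
      w ∈ sublevel P a o → Agr i u w → Conn (sublevel P a o) i u w := by
  obtain ⟨v, hv, -, δ, hδ, h⟩ := exists_push hz hreg one_pos
  have hva : ∀ k : Fin m, (k : ℕ) < a → v k = 0 := fun k hk => hv k (hk.trans_le hai)
  have hpush (u) (hu : u ∈ Metric.ball z δ) (huT : u ∈ sublevel P a o) :
      Conn (sublevel P a o) i u (u + v) := by
    refine Conn.of_segment (fun t ht => ?_) ?_
    · rw [add_sub_cancel_left]
      exact ⟨huT.1.add_smul hva t, (h u hu).2 huT.2 t ht⟩
    · simpa using (Agr.refl i u).add_smul hv 1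
  refine ⟨δ, hδ, fun u hu w hw huT hwT huw => ?_⟩
  refine (hpush u hu huT).trans (Conn.trans ?_ (hpush w hw hwT).symm)
  refine Conn.of_segment (fun t ht => ?_) ?_
  · have h1 : u + v + t • (w + v - (u + v)) = (u + t • (w - u)) + v := by
      rw [add_sub_add_right_eq_sub]; abel
    have h2 : u + t • (w - u) ∈ Metric.ball z δ := by
      have := (convex_ball z δ).add_smul_sub_mem hu hw ht
      exact this
    rw [h1]
    refine ⟨?_, ((h _ h2).1).le⟩
    have h3 := (huT.1.add_smul (v := w - u) (fun k hk => ?_) t).add_smul hva 1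
    · simpa using h3
    · simp [huw k (hk.trans_le hai)]
  · intro k hk
    simp [huw k hk]

theorem exists_ball_neg (hz : z ∈ sublevel P a o) (hreg : eval z P < 0 ∨ ¬ IsCrit P i z) {r : ℝ}
    (hr : 0 < r) : ∃ w ∈ Metric.ball z r, Agr i z w ∧ eval w P < 0 := by
  obtain ⟨v, hv, hvr, δ, hδ, h⟩ := exists_push hz hreg hr
  refine ⟨z + v, by simpa using hvr, ?_, (h z (Metric.mem_ball_self hδ)).1⟩
  simpa using (Agr.refl i z).add_smul hv 1

end Sublevel

section FirstOrder

open Filter Topology Asymptotics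

/-- A curve of critical points in the zero set of `P` which is cut out by simple equations
consists of points which are also critical in the direction of the parameter. -/
theorem eval_pderiv_eq_zero_of_curve {m : ℕ} {P : MvPolynomial (Fin m) ℝ} {j : Fin m} {t₀ : ℝ}
    {g : ℝ → Fin m → ℝ} (hg : ContinuousAt g t₀)
    (hagr : ∀ᶠ t in 𝓝 t₀, Agr j (g t₀) (g t) ∧ g t j = t)
    (hP : ∀ᶠ t in 𝓝 t₀, eval (g t) P = 0) (hcrit : IsCrit P (j + 1) (g t₀))
    (hsimple : ∀ l : Fin m, (j : ℕ) + 1 ≤ l → ∃ f : MvPolynomial (Fin m) ℝ,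
      (∀ᶠ t in 𝓝 t₀, eval (g t) f = 0) ∧ eval (g t₀) (pderiv l f) ≠ 0 ∧
        ∀ l' : Fin m, (j : ℕ) + 1 ≤ l' → l' ≠ l → eval (g t₀) (pderiv l' f) = 0) :
    eval (g t₀) (pderiv j P) = 0 := by
  have hlin (f : MvPolynomial (Fin m) ℝ) (hf : ∀ᶠ t in 𝓝 t₀, eval (g t) f = 0) :
      (fun t => ∑ l, eval (g t₀) (pderiv l f) * (g t l - g t₀ l)) =o[𝓝 t₀]
        fun t => g t - g t₀ := by
    have h1 := (hasFDerivAt_eval f (g t₀)).isLittleO.comp_tendsto hg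
    have h2 := h1.neg_left
    refine h2.congr' ?_ EventuallyEq.rfl
    filter_upwards [hf] with t ht
    simp [ht, hf.self_of_nhds]
  choose! F hF using hsimple
  set c : Fin m → ℝ := fun l => eval (g t₀) (pderiv j (F l)) / eval (g t₀) (pderiv l (F l)) with hc
  set e : ℝ → Fin m → ℝ := fun t l =>
    if (j : ℕ) + 1 ≤ l then (g t l - g t₀ l) + c l * (t - t₀) else 0 with he
  have hsplit (f : MvPolynomial (Fin m) ℝ) : ∀ᶠ t in 𝓝 t₀,
      ∑ l, eval (g t₀) (pderiv l f) * (g t l - g t₀ l) =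
        eval (g t₀) (pderiv j f) * (t - t₀) +
        ∑ l : Fin m, if (j : ℕ) + 1 ≤ l then eval (g t₀) (pderiv l f) * (g t l - g t₀ l) else 0 := by
    filter_upwards [hagr] with t ht
    have h0 : g t₀ j = t₀ := hagr.self_of_nhds.2
    rw [← Finset.add_sum_erase _ _ (Finset.mem_univ j), ht.2, h0,
      ← Finset.add_sum_erase (a := j) _ _ (Finset.mem_univ j), if_neg (by omega), zero_add]
    congr 1
    refine Finset.sum_congr rfl fun l hl => ?_
    have hlj : l ≠ j := Finset.ne_of_mem_erase hl
    split_ifs with h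
    · rfl
    · rw [ht.1 l (by have := Fin.val_ne_of_ne hlj; omega), sub_self, mul_zero]
  have heo : e =o[𝓝 t₀] fun t => g t - g t₀ := by
    rw [isLittleO_pi]
    intro l
    by_cases hl : (j : ℕ) + 1 ≤ l
    · obtain ⟨h1, h2, h3⟩ := hF l hl
      refine ((hlin (F l) h1).const_mul_left (eval (g t₀) (pderiv l (F l)))⁻¹).congr' ?_
        EventuallyEq.rfl
      filter_upwards [hsplit (F l)] with t ht
      rw [ht, Finset.sum_eq_single l]
      · simp only [he, hc, if_pos hl]
        field_simp
        ring
      · intro l' _ hl'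
        split_ifs with h
        · rw [h3 l' h hl', zero_mul]
        · rfl
      · simp
    · simp only [he, if_neg hl]
      exact isLittleO_zero _ _
  have hδ : (fun t => g t - g t₀) =O[𝓝 t₀] fun t => t - t₀ := by
    refine heo.right_isBigO_sub.trans ?_
    rw [isBigO_pi]
    intro l
    by_cases hl : (j : ℕ) + 1 ≤ l
    · refine ((isBigO_refl (fun t => t - t₀) _).const_mul_left (-c l)).congr' ?_ EventuallyEq.rfl
      refine Eventually.of_forall fun t => ?_
      simp only [he, Pi.sub_apply, if_pos hl]
      ring
    · by_cases hlj : l = j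
      · subst hlj
        refine (isBigO_refl (fun t => t - t₀) _).congr' ?_ EventuallyEq.rfl
        filter_upwards [hagr] with t ht
        simp [he, ht.2, hagr.self_of_nhds.2]
      · refine (isBigO_zero (fun t => t - t₀) _).congr' ?_ EventuallyEq.rfl
        filter_upwards [hagr] with t ht
        simp only [he, Pi.sub_apply, if_neg hl]
        rw [ht.1 l (by have := Fin.val_ne_of_ne hlj; omega), sub_self, sub_zero]
  have hfin : (fun t => eval (g t₀) (pderiv j P) * (t - t₀)) =o[𝓝 t₀] fun t => t - t₀ := by
    refine ((hlin P hP).trans_isBigO hδ).congr' ?_ EventuallyEq.rfl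
    filter_upwards [hsplit P] with t ht
    rw [ht, Finset.sum_eq_zero, add_zero]
    intro l _
    split_ifs with h
    · rw [hcrit l h, zero_mul]
    · rfl
  by_contra hne
  rw [isLittleO_const_mul_left_iff hne] at hfin
  refine isLittleO_irrefl ?_ hfin
  have h1 : ∃ᶠ t in 𝓝[≠] t₀, t - t₀ ≠ 0 :=
    Filter.Eventually.frequently (eventually_nhdsWithin_of_forall fun t ht => sub_ne_zero.mpr ht)
  exact h1.filter_mono nhdsWithin_le_nhds

end FirstOrder

section Line

variable {m : ℕ}

/-- The univariate polynomial obtained by restricting `c` to the line through `x` in the direction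
of the `j`-th coordinate, for a polynomial `c` in the first `j + 1` variables. -/
noncomputable def restrictLine (j : Fin m) (c : MvPolynomial (Fin m) ℝ) (x : Fin m → ℝ) :
    Polynomial ℝ :=
  (linePoly j c).map (eval x)

theorem eval_restrictLine {j : Fin m} {c : MvPolynomial (Fin m) ℝ} (hc : Dep ((j : ℕ) + 1) c)
    (x : Fin m → ℝ) (t : ℝ) :
    (restrictLine j c x).eval t = eval (Function.update x j t) c :=
  eval_map_linePoly j hc x t

theorem agr_update (j : Fin m) (x : Fin m → ℝ) (t : ℝ) : Agr j x (Function.update x j t) :=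
  fun _ hl => (Function.update_of_ne (Fin.ne_of_val_ne hl.ne) _ _).symm

theorem Agr.update_left {j : Fin m} {x y : Fin m → ℝ} (h : Agr j x y) :
    Agr (j + 1) (Function.update x j (y j)) y := by
  intro l hl
  by_cases hlj : l = j
  · subst hlj; simp
  · rw [Function.update_of_ne hlj]
    exact h l (by have := Fin.val_ne_of_ne hlj; omega)

theorem Agr.succ {j : Fin m} {x y : Fin m → ℝ} (h : Agr j x y) (hj : x j = y j) :
    Agr (j + 1) x y := by
  have := h.update_left
  rwa [← hj, Function.update_eq_self] at this

theorem eval_restrictLine_self {j : Fin m} {c : MvPolynomial (Fin m) ℝ} (hc : Dep ((j : ℕ) + 1) c)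
    {x y : Fin m → ℝ} (h : Agr j x y) : (restrictLine j c x).eval (y j) = eval y c := by
  rw [eval_restrictLine hc]
  exact hc _ _ h.update_left

theorem restrictLine_congr {j : Fin m} (c : MvPolynomial (Fin m) ℝ) {x y : Fin m → ℝ}
    (h : Agr j x y) : restrictLine j c x = restrictLine j c y :=
  map_linePoly_congr j c h

theorem derivative_restrictLine {j : Fin m} {c : MvPolynomial (Fin m) ℝ}
    (hc : Dep ((j : ℕ) + 1) c) (hc' : Dep ((j : ℕ) + 1) (pderiv j c)) (x : Fin m → ℝ) :
    Polynomial.derivative (restrictLine j c x) = restrictLine j (pderiv j c) x := by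
  refine Polynomial.funext fun t => ?_
  rw [eval_restrictLine hc']
  have hu (s : ℝ) : Function.update x j 0 + s • Pi.single j 1 = Function.update x j s := by
    ext l
    by_cases hl : l = j
    · subst hl; simp
    · simp [hl]
  have h1 := hasDerivAt_eval_line c (Function.update x j 0) (Pi.single j 1) t
  simp only [hu] at h1
  rw [Finset.sum_eq_single j (fun _ _ hl => by simp [hl]) (by simp), Pi.single_eq_same,
    mul_one] at h1
  have h2 := (restrictLine j c x).hasDerivAt t
  simp only [eval_restrictLine hc] at h2
  exact h2.unique h1

end Line

section Adapted

variable {m : ℕ}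

/-- `x` and `y` give the same signs to all the elements of `F`. -/
def SameSign (F : Set (MvPolynomial (Fin m) ℝ)) (x y : Fin m → ℝ) : Prop :=
  ∀ f ∈ F, SignType.sign (eval x f) = SignType.sign (eval y f)

theorem SameSign.refl (F : Set (MvPolynomial (Fin m) ℝ)) (x : Fin m → ℝ) : SameSign F x x :=
  fun _ _ => rfl

theorem SameSign.symm {F : Set (MvPolynomial (Fin m) ℝ)} {x y : Fin m → ℝ} (h : SameSign F x y) :
    SameSign F y x := fun f hf => (h f hf).symm

theorem SameSign.trans {F : Set (MvPolynomial (Fin m) ℝ)} {x y z : Fin m → ℝ}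
    (h : SameSign F x y) (h' : SameSign F y z) : SameSign F x z :=
  fun f hf => (h f hf).trans (h' f hf)

theorem SameSign.mono {F F' : Set (MvPolynomial (Fin m) ℝ)} (hF : F' ⊆ F) {x y : Fin m → ℝ}
    (h : SameSign F x y) : SameSign F' x y := fun f hf => h f (hF hf)

theorem SameSign.of_agr {F : Set (MvPolynomial (Fin m) ℝ)} {i : ℕ} (hF : ∀ f ∈ F, Dep i f)
    {x y : Fin m → ℝ} (h : Agr i x y) : SameSign F x y :=
  fun f hf => by rw [hF f hf x y h]

/-- The signs at `y` of the elements of `F` are obtained from those at `x` by replacing some of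
them by zero. -/
def Relaxed (F : Set (MvPolynomial (Fin m) ℝ)) (x y : Fin m → ℝ) : Prop :=
  ∀ f ∈ F, eval y f = 0 ∨ SignType.sign (eval y f) = SignType.sign (eval x f)

theorem SameSign.relaxed {F : Set (MvPolynomial (Fin m) ℝ)} {x y : Fin m → ℝ}
    (h : SameSign F x y) : Relaxed F x y := fun f hf => Or.inr (h f hf).symm

theorem Relaxed.congr {F : Set (MvPolynomial (Fin m) ℝ)} {x y x' y' : Fin m → ℝ}
    (h : Relaxed F x y) (hx : SameSign F x x') (hy : SameSign F y y') : Relaxed F x' y' := by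
  intro f hf
  rcases h f hf with h1 | h1
  · left
    have := hy f hf
    rw [h1, sign_zero] at this
    exact sign_eq_zero_iff.mp this.symm
  · exact Or.inr (by rw [← hy f hf, h1, hx f hf])

theorem isClosed_relaxed (F : Set (MvPolynomial (Fin m) ℝ)) (x : Fin m → ℝ) :
    IsClosed {y | Relaxed F x y} := by
  have h (f : MvPolynomial (Fin m) ℝ) : IsClosed {y : Fin m → ℝ |
      eval y f = 0 ∨ SignType.sign (eval y f) = SignType.sign (eval x f)} := by
    have hc := MvPolynomial.continuous_eval f
    rcases lt_trichotomy (eval x f) 0 with hx | hx | hx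
    · convert isClosed_le hc (continuous_const (y := (0 : ℝ))) using 3 with y
      rw [sign_neg hx, sign_eq_neg_one_iff, le_iff_eq_or_lt]
    · convert isClosed_eq hc (continuous_const (y := (0 : ℝ))) using 3 with y
      rw [hx, sign_zero, sign_eq_zero_iff, or_self]
    · convert isClosed_le (continuous_const (y := (0 : ℝ))) hc using 3 with y
      rw [sign_pos hx, sign_eq_one_iff, le_iff_eq_or_lt, eq_comm]
  have : {y | Relaxed F x y} = ⋂ f ∈ F, {y : Fin m → ℝ |
      eval y f = 0 ∨ SignType.sign (eval y f) = SignType.sign (eval x f)} := by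
    ext y; simp [Relaxed]
  rw [this]
  exact isClosed_biInter fun f _ => h f

theorem Relaxed.nonpos {F : Set (MvPolynomial (Fin m) ℝ)} {x y : Fin m → ℝ} (h : Relaxed F x y)
    {f : MvPolynomial (Fin m) ℝ} (hf : f ∈ F) (hx : eval x f ≤ 0) : eval y f ≤ 0 := by
  rcases h f hf with h1 | h1
  · exact h1.le
  · rw [← sign_nonpos_iff] at hx ⊢
    rwa [h1]

/-- A family `A` of polynomials which controls the critical points of the restrictions of `P` to
the slices obtained by fixing the first `i` coordinates, for `i ≥ a`. The polynomials `Lab i` serve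
as labels for these critical points and the polynomials `G i`, in the first `i` variables, control
which labels occur. -/
structure IsAdapted (P : MvPolynomial (Fin m) ℝ) (a : ℕ) (Lab G : ℕ → Set (MvPolynomial (Fin m) ℝ))
    (A : Set (MvPolynomial (Fin m) ℝ)) : Prop where
  finite_lab : ∀ i, (Lab i).Finite
  finite_G : ∀ i, (G i).Finite
  dep : ∀ i, ∀ c ∈ G i, Dep i c
  pderiv_mem : ∀ j : Fin m, ∀ c ∈ G (j + 1), pderiv j c ∈ G (j + 1)
  G_subset : ∀ i, a ≤ i → i ≤ m → G i ⊆ A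
  self_mem : ∀ i, P ∈ Lab i
  relaxed_unique : ∀ i, a ≤ i → i ≤ m → ∀ ξ η η' : Fin m → ℝ, IsCrit P i η →
    IsCrit P i η' → Agr i η η' → Relaxed (Lab i) ξ η → Relaxed (Lab i) ξ η' → η = η'
  exists_simple : ∀ i, a ≤ i → i ≤ m → ∀ ξ, IsCrit P i ξ → ∀ l : Fin m, i ≤ l → ∃ f ∈ Lab i,
    eval ξ f = 0 ∧ eval ξ (pderiv l f) ≠ 0 ∧
      ∀ l' : Fin m, i ≤ l' → l' ≠ l → eval ξ (pderiv l' f) = 0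
  exists_root : ∀ j : Fin m, a ≤ j → ∀ x x', SameSign {f | f ∈ A ∧ Dep j f} x x' →
    ∀ c ∈ G (j + 1), restrictLine j c x ≠ 0 → ∀ t, (restrictLine j c x).eval t = 0 →
    restrictLine j c x' ≠ 0 ∧ ∃ t', (restrictLine j c x').eval t' = 0 ∧
      SameSign {f | f ∈ A ∧ Dep (j + 1) f} (Function.update x j t) (Function.update x' j t')
  exists_crit : ∀ i, a ≤ i → i ≤ m → ∀ x x', SameSign {f | f ∈ A ∧ Dep i f} x x' →
    ∀ ξ, Agr i x ξ → IsCrit P i ξ → ∃ ξ', Agr i x' ξ' ∧ IsCrit P i ξ' ∧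
      SameSign A ξ ξ' ∧ SameSign (Lab i) ξ ξ'
  exists_label : ∀ i, a ≤ i → i ≤ m → ∀ x x', SameSign (G i) x x' →
    ∀ ξ, Agr i x ξ → IsCrit P i ξ → ∃ ξ', Agr i x' ξ' ∧ IsCrit P i ξ' ∧ SameSign (Lab i) ξ ξ'

end Adapted

section Heights

variable {m : ℕ} {j : Fin m} {C : Set (MvPolynomial (Fin m) ℝ)} {x y : Fin m → ℝ}

/-- The roots of the nonzero restrictions of the elements of `C` to the line through `x` in the
direction of the `j`-th coordinate. -/
def heights (C : Set (MvPolynomial (Fin m) ℝ)) (j : Fin m) (x : Fin m → ℝ) : Set ℝ :=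
  {t | ∃ c ∈ C, restrictLine j c x ≠ 0 ∧ (restrictLine j c x).eval t = 0}

theorem finite_heights (hC : C.Finite) (j : Fin m) (x : Fin m → ℝ) : (heights C j x).Finite := by
  have : heights C j x ⊆ ⋃ c ∈ C, {t | restrictLine j c x ≠ 0 ∧ (restrictLine j c x).eval t = 0} := by
    rintro t ⟨c, hc, h⟩
    simp only [mem_iUnion]
    exact ⟨c, hc, h⟩
  refine (hC.biUnion fun c _ => ?_).subset this
  by_cases h : restrictLine j c x = 0
  · simp [h]
  · refine (Polynomial.finite_setOfPred_isRoot h).subset fun t ht => ht.2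

theorem heights_congr (h : Agr j x y) : heights C j x = heights C j y := by
  unfold heights
  simp only [restrictLine_congr _ h]

theorem sign_eval_eq_of_ne_zero {p : Polynomial ℝ} {s t : ℝ} (h : ∀ u ∈ uIcc s t, p.eval u ≠ 0) :
    SignType.sign (p.eval s) = SignType.sign (p.eval t) := by
  have h0 : (0 : ℝ) ∉ uIcc (p.eval s) (p.eval t) := by
    intro h0
    obtain ⟨u, hu, h1⟩ := intermediate_value_uIcc (f := fun u => p.eval u) p.continuousOn h0
    exact h u hu h1
  have hs := h s left_mem_uIcc
  have ht := h t right_mem_uIcc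
  rw [mem_uIcc] at h0
  push Not at h0
  rcases lt_or_gt_of_ne hs with h1 | h1 <;> rcases lt_or_gt_of_ne ht with h2 | h2
  · rw [sign_neg h1, sign_neg h2]
  · exact absurd (h0.1 h1.le) (not_lt.mpr h2.le)
  · exact absurd (h0.2 h2.le) (not_lt.mpr h1.le)
  · rw [sign_pos h1, sign_pos h2]

theorem sign_restrictLine_eq {s t : ℝ} (h : ∀ u ∈ uIcc s t, u ∉ heights C j x) :
    ∀ c ∈ C, SignType.sign ((restrictLine j c x).eval s) =
      SignType.sign ((restrictLine j c x).eval t) := by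
  intro c hc
  by_cases h0 : restrictLine j c x = 0
  · simp [h0]
  · exact sign_eval_eq_of_ne_zero fun u hu hu0 => h u hu ⟨c, hc, h0, hu0⟩

theorem sameSign_update_of_notMem (hC : ∀ c ∈ C, Dep ((j : ℕ) + 1) c) {s t : ℝ}
    (h : ∀ u ∈ uIcc s t, u ∉ heights C j x) :
    SameSign C (Function.update x j s) (Function.update x j t) := by
  intro c hc
  rw [← eval_restrictLine (hC c hc), ← eval_restrictLine (hC c hc)]
  exact sign_restrictLine_eq h c hc

theorem iterate_derivative_restrictLine (hC : ∀ c ∈ C, Dep ((j : ℕ) + 1) c)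
    (hd : ∀ c ∈ C, pderiv j c ∈ C) {c : MvPolynomial (Fin m) ℝ} (hc : c ∈ C) (x : Fin m → ℝ)
    (k : ℕ) : (pderiv j)^[k] c ∈ C ∧
      Polynomial.derivative^[k] (restrictLine j c x) = restrictLine j ((pderiv j)^[k] c) x := by
  induction k with
  | zero => exact ⟨hc, rfl⟩
  | succ k ih =>
    rw [Function.iterate_succ_apply', Function.iterate_succ_apply', ih.2,
      derivative_restrictLine (hC _ ih.1) (hC _ (hd _ ih.1))]
    exact ⟨hd _ ih.1, rfl⟩

theorem sameThom_restrictLine (hC : ∀ c ∈ C, Dep ((j : ℕ) + 1) c) (hd : ∀ c ∈ C, pderiv j c ∈ C)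
    {x' y' : Fin m → ℝ} (hxy : Agr j x y) (hxy' : Agr j x' y') (h : SameSign C y y')
    {c : MvPolynomial (Fin m) ℝ} (hc : c ∈ C) :
    SameThom (restrictLine j c x) (y j) (restrictLine j c x') (y' j) := by
  intro k
  obtain ⟨h1, h2⟩ := iterate_derivative_restrictLine hC hd hc x k
  rw [h2, (iterate_derivative_restrictLine hC hd hc x' k).2,
    eval_restrictLine_self (hC _ h1) hxy, eval_restrictLine_self (hC _ h1) hxy']
  exact h _ h1

theorem SameThom.ne_zero {p q : Polynomial ℝ} {s t : ℝ} (h : SameThom p s q t) (hp : p ≠ 0) :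
    q ≠ 0 := by
  rintro rfl
  have h1 : p.natDegree < p.rootMultiplicity s := by
    refine Polynomial.lt_rootMultiplicity_of_isRoot_iterate_derivative hp fun k _ => ?_
    have := h k
    rw [Polynomial.iterate_derivative_zero, Polynomial.eval_zero, sign_zero] at this
    exact sign_eq_zero_iff.mp this
  rw [← Polynomial.count_roots] at h1
  exact absurd h1 (not_lt.mpr ((Multiset.count_le_card _ _).trans p.card_roots'))

theorem SameThom.eval_eq_zero {p q : Polynomial ℝ} {s t : ℝ} (h : SameThom p s q t)
    (hp : p.eval s = 0) : q.eval t = 0 := by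
  have h1 := h 0
  simp only [Function.iterate_zero, id, hp, sign_zero] at h1
  exact sign_eq_zero_iff.mp h1.symm

/-- Order comparison with a common root is determined by the signs of the derivatives. -/
theorem lt_iff_lt_of_sameThom {p p' : Polynomial ℝ} (hp : p ≠ 0) {s t s' t' : ℝ}
    (hs : SameThom p s p' s') (ht : SameThom p t p' t') (h0 : p.eval s = 0) :
    (s < t ↔ s' < t') ∧ (t < s ↔ t' < s') := by
  have hp' := hs.ne_zero hp
  have h0' := hs.eval_eq_zero h0
  exact ⟨⟨lt_of_sameThom hp hs ht (Or.inl h0), lt_of_sameThom hp' hs.symm ht.symm (Or.inl h0')⟩,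
    ⟨lt_of_sameThom hp ht hs (Or.inr h0), lt_of_sameThom hp' ht.symm hs.symm (Or.inr h0')⟩⟩

end Heights

section Branches

open Filter Topology

theorem continuousOn_invFunOn {X Y : Type*} [TopologicalSpace X] [TopologicalSpace Y] [T2Space Y]
    [Nonempty X] {f : X → Y} {K : Set X} (hK : IsCompact K) (hf : ContinuousOn f K)
    (hinj : InjOn f K) : ContinuousOn (Function.invFunOn f K) (f '' K) := by
  rw [continuousOn_iff_isClosed]
  intro t ht
  refine ⟨f '' (K ∩ t), ((hK.inter_right ht).image_of_continuousOn
    (hf.mono inter_subset_left)).isClosed, ?_⟩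
  ext y
  constructor
  · rintro ⟨h1, x, hx, rfl⟩
    have h2 : Function.invFunOn f K (f x) = x := hinj.leftInvOn_invFunOn hx
    rw [mem_preimage, h2] at h1
    exact ⟨⟨x, ⟨hx, h1⟩, rfl⟩, x, hx, rfl⟩
  · rintro ⟨⟨x, ⟨hx, hxt⟩, rfl⟩, h⟩
    have h2 : Function.invFunOn f K (f x) = x := hinj.leftInvOn_invFunOn hx
    exact ⟨by rwa [mem_preimage, h2], h⟩

theorem mem_closure_uIcc_diff {s v : ℝ} (h : s ≠ v) : v ∈ closure (uIcc s v \ {v}) := by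
  rcases lt_or_gt_of_ne h with h | h
  · have h1 : v ∈ closure (Ioo s v) := by rw [closure_Ioo h.ne]; exact ⟨h.le, le_rfl⟩
    have h2 : Ioo s v ⊆ uIcc s v \ {v} := fun t ht =>
      ⟨by rw [uIcc_of_le h.le]; exact Ioo_subset_Icc_self ht, ht.2.ne⟩
    exact closure_mono h2 h1
  · have h1 : v ∈ closure (Ioo v s) := by rw [closure_Ioo h.ne]; exact ⟨le_rfl, h.le⟩
    have h2 : Ioo v s ⊆ uIcc s v \ {v} := fun t ht =>
      ⟨by rw [uIcc_of_ge h.le]; exact Ioo_subset_Icc_self ht, ht.1.ne'⟩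
    exact closure_mono h2 h1

theorem notMem_uIcc_of_mem {s t v : ℝ} (ht : t ∈ uIcc s v) (h : t ≠ v) : v ∉ uIcc s t := by
  intro hv
  refine h (le_antisymm ?_ ?_)
  all_goals
    rw [mem_uIcc] at ht hv
    rcases ht with ht | ht <;> rcases hv with hv | hv <;> linarith [ht.1, ht.2, hv.1, hv.2]

theorem isClosed_agr {m : ℕ} (i : ℕ) (x : Fin m → ℝ) : IsClosed {w | Agr i x w} := by
  have : {w | Agr i x w} = ⋂ l : Fin m, ⋂ _ : (l : ℕ) < i, {w | x l = w l} := by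
    ext w; simp [Agr]
  rw [this]
  exact isClosed_iInter fun l => isClosed_iInter fun _ =>
    isClosed_eq continuous_const (continuous_apply l)

theorem isClosed_isCrit {m : ℕ} (P : MvPolynomial (Fin m) ℝ) (i : ℕ) :
    IsClosed {w | IsCrit P i w} := by
  have : {w | IsCrit P i w} = ⋂ l : Fin m, ⋂ _ : i ≤ (l : ℕ), {w | eval w (pderiv l P) = 0} := by
    ext w; simp [IsCrit]
  rw [this]
  exact isClosed_iInter fun l => isClosed_iInter fun _ =>
    isClosed_eq (MvPolynomial.continuous_eval _) continuous_const

variable {m : ℕ} {P : MvPolynomial (Fin m) ℝ} {a : ℕ} {o : Fin m → ℝ}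
  {Lab G : ℕ → Set (MvPolynomial (Fin m) ℝ)} {A : Set (MvPolynomial (Fin m) ℝ)}

theorem IsAdapted.finite_crit (hA : IsAdapted P a Lab G A) {i : ℕ} (hai : a ≤ i) (him : i ≤ m)
    (x : Fin m → ℝ) : {η | Agr i x η ∧ IsCrit P i η}.Finite := by
  have : Finite (Lab i) := hA.finite_lab i
  let φ : (Fin m → ℝ) → Lab i → SignType := fun η f => SignType.sign (eval η f.1)
  refine Set.Finite.of_finite_image (f := φ) (Set.toFinite _) fun η hη η' hη' h => ?_
  exact hA.relaxed_unique i hai him η η η' hη.2 hη'.2 (hη.1.symm.trans hη'.1)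
    (SameSign.refl _ _).relaxed (SameSign.relaxed fun f hf => congrFun h ⟨f, hf⟩)

theorem IsAdapted.mem_of_relaxed (hA : IsAdapted P a Lab G A) {i k : ℕ} (hai : a ≤ i)
    {ξ η : Fin m → ℝ} (hξ : ξ ∈ sublevel P a o) (h : Agr i ξ η) (hr : Relaxed (Lab k) ξ η) :
    η ∈ sublevel P a o :=
  ⟨hξ.1.trans (h.mono hai), hr.nonpos (hA.self_mem k) hξ.2⟩

/-- A critical point of a slice can be followed along the heights at which the labels do not
change, up to the first exceptional height. -/
theorem IsAdapted.exists_branch (hA : IsAdapted P a Lab G A) (hT : IsCompact (sublevel P a o))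
    {j : Fin m} (haj : a ≤ j) {ξ : Fin m → ℝ} (hξT : ξ ∈ sublevel P a o)
    (hξ : IsCrit P (j + 1) ξ) {v : ℝ}
    (hfree : ∀ t ∈ uIcc (ξ j) v, t ∈ heights (G (j + 1)) j ξ → t = v) :
    ∃ g : ℝ → Fin m → ℝ, ContinuousOn g (uIcc (ξ j) v) ∧ g (ξ j) = ξ ∧
      ∀ t ∈ uIcc (ξ j) v, g t ∈ sublevel P a o ∧ Agr j ξ (g t) ∧ g t j = t ∧
        IsCrit P (j + 1) (g t) ∧ Relaxed (Lab (j + 1)) ξ (g t) ∧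
        (t ≠ v → SameSign (Lab (j + 1)) ξ (g t)) := by
  set K : Set (Fin m → ℝ) := {w | w ∈ sublevel P a o ∧ Agr j ξ w ∧ w j ∈ uIcc (ξ j) v ∧
    IsCrit P (j + 1) w ∧ Relaxed (Lab (j + 1)) ξ w} with hK
  have hKc : IsCompact K := by
    refine hT.of_isClosed_subset ?_ fun w hw => hw.1
    exact hT.isClosed.inter ((isClosed_agr _ _).inter
      ((isClosed_Icc.preimage (continuous_apply j)).inter
        ((isClosed_isCrit _ _).inter (isClosed_relaxed _ _))))
  have hinj : InjOn (fun w : Fin m → ℝ => w j) K := by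
    intro w hw w' hw' h
    exact hA.relaxed_unique (j + 1) (by omega) j.2 ξ w w' hw.2.2.2.1 hw'.2.2.2.1
      ((hw.2.1.symm.trans hw'.2.1).succ h) hw.2.2.2.2 hw'.2.2.2.2
  have hξK : ξ ∈ K := ⟨hξT, Agr.refl _ _, left_mem_uIcc, hξ, (SameSign.refl _ _).relaxed⟩
  have hsame : ∀ t ∈ uIcc (ξ j) v, t ≠ v → ∃ w ∈ K, w j = t ∧ SameSign (Lab (j + 1)) ξ w := by
    intro t ht htv
    have h1 : SameSign (G (j + 1)) ξ (Function.update ξ j t) := by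
      have := sameSign_update_of_notMem (hA.dep (j + 1)) (x := ξ) (s := ξ j) (t := t)
        fun u hu huh => by
          have := hfree u (uIcc_subset_uIcc left_mem_uIcc ht hu) huh
          subst this
          exact notMem_uIcc_of_mem ht htv hu
      rwa [Function.update_eq_self] at this
    obtain ⟨w, h2, h3, h4⟩ := hA.exists_label (j + 1) (by omega) j.2 _ _ h1 ξ (Agr.refl _ _) hξ
    have h5 : Agr j ξ w := (agr_update j ξ t).trans (h2.mono (Nat.le_succ _))
    have h6 : w j = t := by rw [← h2 j (Nat.lt_succ_self _), Function.update_self]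
    exact ⟨w, ⟨hA.mem_of_relaxed haj hξT h5 h4.relaxed, h5, h6 ▸ ht, h3, h4.relaxed⟩, h6, h4⟩
  have himg : (fun w : Fin m → ℝ => w j) '' K = uIcc (ξ j) v := by
    refine Subset.antisymm ?_ fun t ht => ?_
    · rintro _ ⟨w, hw, rfl⟩
      exact hw.2.2.1
    · by_cases htv : t = v
      · subst htv
        by_cases hs : ξ j = t
        · exact ⟨ξ, hξK, hs⟩
        · have hcl : IsClosed ((fun w : Fin m → ℝ => w j) '' K) :=
            (hKc.image (continuous_apply j)).isClosed
          refine hcl.closure_subset_iff.mpr ?_ (mem_closure_uIcc_diff hs)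
          rintro u ⟨hu, hut⟩
          obtain ⟨w, hw, h1, -⟩ := hsame u hu hut
          exact ⟨w, hw, h1⟩
      · obtain ⟨w, hw, h1, -⟩ := hsame t ht htv
        exact ⟨w, hw, h1⟩
  have hg := continuousOn_invFunOn hKc (continuous_apply j).continuousOn hinj
  have hginv (w) (hw : w ∈ K) : Function.invFunOn (fun w : Fin m → ℝ => w j) K (w j) = w :=
    hinj.leftInvOn_invFunOn hw
  refine ⟨Function.invFunOn (fun w : Fin m → ℝ => w j) K, himg ▸ hg, hginv ξ hξK, fun t ht => ?_⟩
  rw [← himg] at ht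
  obtain ⟨w, hw, rfl⟩ := ht
  rw [hginv w hw]
  refine ⟨hw.1, hw.2.1, rfl, hw.2.2.2.1, hw.2.2.2.2, fun hv => ?_⟩
  obtain ⟨w', hw', h1, h2⟩ := hsame _ hw.2.2.1 hv
  rwa [hinj hw' hw h1] at h2

/-- `η` is an end point of the branch of critical points starting at `ξ`. -/
def IsEnd (P : MvPolynomial (Fin m) ℝ) (Lab G : ℕ → Set (MvPolynomial (Fin m) ℝ)) (j : Fin m)
    (ξ η : Fin m → ℝ) : Prop :=
  Agr j ξ η ∧ IsCrit P (j + 1) η ∧ Relaxed (Lab (j + 1)) ξ η ∧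
    ∀ t ∈ uIcc (ξ j) (η j), t ∈ heights (G (j + 1)) j ξ → t = η j

theorem IsAdapted.conn_of_isEnd (hA : IsAdapted P a Lab G A) (hT : IsCompact (sublevel P a o))
    {j : Fin m} (haj : a ≤ j) {ξ η : Fin m → ℝ} (hξT : ξ ∈ sublevel P a o)
    (hξ : IsCrit P (j + 1) ξ) (h : IsEnd P Lab G j ξ η) : Conn (sublevel P a o) j ξ η := by
  obtain ⟨h1, h2, h3, h4⟩ := h
  obtain ⟨g, hg, hg0, hgt⟩ := hA.exists_branch hT haj hξT hξ h4
  obtain ⟨h5, h6, h7, h8, h9, -⟩ := hgt (η j) right_mem_uIcc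
  have hη : g (η j) = η := hA.relaxed_unique (j + 1) (by omega) j.2 ξ _ _ h8 h2
    ((h6.symm.trans h1).succ h7) h9 h3
  refine ⟨g '' uIcc (ξ j) (η j), isPreconnected_uIcc.image g hg, ?_, ?_, ⟨_, left_mem_uIcc, hg0⟩,
    ⟨_, right_mem_uIcc, hη⟩⟩
  · rintro _ ⟨t, ht, rfl⟩
    exact (hgt t ht).1
  · rintro _ ⟨t, ht, rfl⟩
    exact (hgt t ht).2.1

/-- Two ends of the same branch at the same height coincide. -/
theorem IsAdapted.isEnd_unique (hA : IsAdapted P a Lab G A) {j : Fin m} (haj : a ≤ j)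
    {ξ η η' : Fin m → ℝ} (h : IsEnd P Lab G j ξ η) (h' : IsEnd P Lab G j ξ η')
    (hj : η j = η' j) : η = η' :=
  hA.relaxed_unique (j + 1) (by omega) j.2 ξ _ _ h.2.1 h'.2.1 ((h.1.symm.trans h'.1).succ hj)
    h.2.2.1 h'.2.2.1

theorem isEnd_self {j : Fin m} {ξ : Fin m → ℝ} (hξ : IsCrit P (j + 1) ξ) :
    IsEnd P Lab G j ξ ξ :=
  ⟨Agr.refl _ _, hξ, (SameSign.refl _ _).relaxed, fun t ht _ => by simpa using ht⟩

theorem IsAdapted.exists_isEnd (hA : IsAdapted P a Lab G A) (hT : IsCompact (sublevel P a o))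
    {j : Fin m} (haj : a ≤ j) {ξ : Fin m → ℝ} (hξT : ξ ∈ sublevel P a o)
    (hξ : IsCrit P (j + 1) ξ) {v : ℝ}
    (hfree : ∀ t ∈ uIcc (ξ j) v, t ∈ heights (G (j + 1)) j ξ → t = v) :
    ∃ η, IsEnd P Lab G j ξ η ∧ η j = v := by
  obtain ⟨g, hg, hg0, hgt⟩ := hA.exists_branch hT haj hξT hξ hfree
  obtain ⟨h5, h6, h7, h8, h9, -⟩ := hgt v right_mem_uIcc
  exact ⟨g v, ⟨h6, h8, h9, by rwa [h7]⟩, h7⟩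

theorem IsAdapted.exists_isEnd_heights (hA : IsAdapted P a Lab G A)
    (hT : IsCompact (sublevel P a o)) {j : Fin m} (haj : a ≤ j) {ξ : Fin m → ℝ}
    (hξT : ξ ∈ sublevel P a o) (hξ : IsCrit P (j + 1) ξ) :
    ∃ η, IsEnd P Lab G j ξ η ∧ η j ∈ heights (G (j + 1)) j ξ := by
  by_cases hne : ({t | t ∈ heights (G (j + 1)) j ξ ∧ ξ j ≤ t}).Nonempty
  · obtain ⟨v, hv, hmin⟩ := Set.exists_min_image _ id
      ((finite_heights (hA.finite_G (j + 1)) j ξ).subset fun t ht => ht.1) hne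
    obtain ⟨η, h1, rfl⟩ := hA.exists_isEnd hT haj hξT hξ (v := v) fun t ht hth => by
      rw [uIcc_of_le hv.2] at ht
      exact le_antisymm ht.2 (hmin t ⟨hth, ht.1⟩)
    exact ⟨η, h1, hv.1⟩
  · exfalso
    obtain ⟨B, hB⟩ := (hT.image (continuous_apply j)).bddAbove
    have hlt : ξ j ≤ B := hB ⟨ξ, hξT, rfl⟩
    obtain ⟨η, h1, h2⟩ := hA.exists_isEnd hT haj hξT hξ (v := B + 1) fun t ht hth => by
      rw [uIcc_of_le (by linarith)] at ht
      exact absurd ⟨t, hth, ht.1⟩ hne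
    have h3 : η j ≤ B := hB ⟨η, hA.mem_of_relaxed haj hξT h1.1 h1.2.2.1, rfl⟩
    linarith

end Branches

section ConnectedBranches

open Filter Topology

theorem exists_ultrafilter_of_frequently {X : Type*} {l : Filter X} {p : X → Prop}
    (h : ∃ᶠ x in l, p x) : ∃ u : Ultrafilter X, (u : Filter X) ≤ l ∧ ∀ᶠ x in (u : Filter X), p x := by
  have : NeBot (l ⊓ 𝓟 {x | p x}) := frequently_mem_iff_neBot.mp h
  obtain ⟨u, hu⟩ := exists_ultrafilter_iff.mpr this
  exact ⟨u, hu.trans inf_le_left, le_principal_iff.mp (hu.trans inf_le_right)⟩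

variable {m : ℕ} {P : MvPolynomial (Fin m) ℝ} {a : ℕ} {o : Fin m → ℝ}
  {Lab G : ℕ → Set (MvPolynomial (Fin m) ℝ)} {A : Set (MvPolynomial (Fin m) ℝ)}

theorem IsAdapted.eval_neg_of_isCrit (hA : IsAdapted P a Lab G A)
    (hT : IsCompact (sublevel P a o)) {j : Fin m} (haj : a ≤ j) {z : Fin m → ℝ}
    (hzT : z ∈ sublevel P a o) (hz : IsCrit P (j + 1) z)
    (hfree : z j ∉ heights (G (j + 1)) j z) : eval z P < 0 := by
  refine lt_of_le_of_ne hzT.2 fun hP => ?_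
  obtain ⟨r, hr, hball⟩ := Metric.isOpen_iff.mp
    (finite_heights (hA.finite_G (j + 1)) j z).isClosed.isOpen_compl _ hfree
  have hlt : z j < z j + r := by linarith
  have hnot : ∀ t ∈ Ico (z j) (z j + r), t ∉ heights (G (j + 1)) j z := fun t ht => by
    refine hball ?_
    rw [Metric.mem_ball, Real.dist_eq, abs_lt]
    constructor <;> linarith [ht.1, ht.2]
  obtain ⟨g, hg, -, hgt⟩ := hA.exists_branch hT haj hzT hz (v := z j + r) fun t ht hth => by
    rw [uIcc_of_le hlt.le] at ht
    by_contra hne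
    exact hnot t ⟨ht.1, lt_of_le_of_ne ht.2 hne⟩ hth
  rw [uIcc_of_le hlt.le] at hg hgt
  have hcrit : ∀ t ∈ Ioo (z j) (z j + r), IsCrit P j (g t) := by
    intro t ht
    have hev : ∀ᶠ s in 𝓝 t, s ∈ Ioo (z j) (z j + r) := Ioo_mem_nhds ht.1 ht.2
    obtain ⟨h1, h2, h3, h4, -, h5⟩ := hgt t (Ioo_subset_Icc_self ht)
    have hsame : ∀ s ∈ Ioo (z j) (z j + r), SameSign (Lab (j + 1)) z (g s) := fun s hs =>
      (hgt s (Ioo_subset_Icc_self hs)).2.2.2.2.2 hs.2.ne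
    have hzero : ∀ f ∈ Lab (j + 1), eval (g t) f = 0 → ∀ᶠ s in 𝓝 t, eval (g s) f = 0 := by
      intro f hf h0
      filter_upwards [hev] with s hs
      rw [← sign_eq_zero_iff, ← hsame s hs f hf, hsame t ht f hf, h0, sign_zero]
    have hP0 : eval (g t) P = 0 := by
      rw [← sign_eq_zero_iff, ← hsame t ht P (hA.self_mem _), hP, sign_zero]
    have := eval_pderiv_eq_zero_of_curve (hg.continuousAt (Icc_mem_nhds ht.1 ht.2))
      (by
        filter_upwards [hev] with s hs
        have h6 := hgt s (Ioo_subset_Icc_self hs)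
        exact ⟨h2.symm.trans h6.2.1, h6.2.2.1⟩)
      (hzero P (hA.self_mem _) hP0) h4
      (fun l hl => by
        obtain ⟨f, hf, hf0, hf1, hf2⟩ := hA.exists_simple (j + 1) (by omega) j.2 (g t) h4 l hl
        exact ⟨f, hzero f hf hf0, hf1, hf2⟩)
    intro l hl
    rcases hl.eq_or_lt with hl | hl
    · rwa [← Fin.ext hl]
    · exact h4 l hl
  have hinf : ({η | Agr j z η ∧ IsCrit P j η}).Infinite := by
    refine ((Ioo_infinite hlt).image (f := g) ?_).mono ?_
    · intro s hs t ht hst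
      rw [← (hgt s (Ioo_subset_Icc_self hs)).2.2.1, hst, (hgt t (Ioo_subset_Icc_self ht)).2.2.1]
    · rintro _ ⟨t, ht, rfl⟩
      exact ⟨(hgt t (Ioo_subset_Icc_self ht)).2.1, hcrit t ht⟩
  exact hinf (hA.finite_crit haj j.2.le z)

/-- If a connected set in a slice consists of regular points, then nearby points in the same slice
which are close to two points of this set are still connected. -/
theorem eventually_conn_of_isPreconnected {i : ℕ} (hai : a ≤ i) {C : Set (Fin m → ℝ)}
    (hC : IsPreconnected C) {x y : Fin m → ℝ} (hCi : ∀ w ∈ C, Agr i x w)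
    (hreg : ∀ w ∈ C, w ∈ sublevel P a o ∧ (eval w P < 0 ∨ ¬ IsCrit P i w)) (hx : x ∈ C)
    (hy : y ∈ C) : ∃ U ∈ 𝓝 x, ∃ V ∈ 𝓝 y, ∀ u ∈ U, ∀ w ∈ V, u ∈ sublevel P a o →
      w ∈ sublevel P a o → Agr i u w → Conn (sublevel P a o) i u w := by
  refine hC.induction₂ (fun x y => ∃ U ∈ 𝓝 x, ∃ V ∈ 𝓝 y, ∀ u ∈ U, ∀ w ∈ V,
    u ∈ sublevel P a o → w ∈ sublevel P a o → Agr i u w → Conn (sublevel P a o) i u w)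
    ?_ ?_ ?_ hx hy
  · intro z hz
    obtain ⟨δ, hδ, h⟩ := exists_ball_conn hai (hreg z hz).1 (hreg z hz).2
    filter_upwards [mem_nhdsWithin_of_mem_nhds (Metric.ball_mem_nhds z hδ)] with w hw
    exact ⟨_, Metric.ball_mem_nhds z hδ, _, Metric.isOpen_ball.mem_nhds hw, h⟩
  · rintro z₁ z₂ z₃ h1 h2 h3 ⟨U, hU, V, hV, h⟩ ⟨U', hU', V', hV', h'⟩
    obtain ⟨r, hr, hball⟩ := Metric.mem_nhds_iff.mp (inter_mem hV hU')
    obtain ⟨p, hp, hp1, hp2⟩ := exists_ball_neg (hreg z₂ h2).1 (hreg z₂ h2).2 hr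
    let φ : (Fin m → ℝ) → Fin m → ℝ := fun u l => if (l : ℕ) < i then u l else p l
    have hφ : Continuous φ := by
      refine continuous_pi fun l => ?_
      by_cases hl : (l : ℕ) < i
      · simpa only [φ, hl, if_true] using continuous_apply l
      · simpa only [φ, hl, if_false] using continuous_const
    have hφz : φ z₁ = p := by
      funext l
      by_cases hl : (l : ℕ) < i
      · simp only [φ, hl, if_true]
        exact (((hCi z₁ h1).symm.trans (hCi z₂ h2)).trans hp1) l hl
      · simp only [φ, hl, if_false]
    have hφt : Tendsto φ (𝓝 z₁) (𝓝 p) := by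
      have h4 := hφ.tendsto z₁
      rwa [hφz] at h4
    have hev1 : ∀ᶠ u in 𝓝 z₁, φ u ∈ Metric.ball z₂ r :=
      hφt.eventually (Metric.isOpen_ball.mem_nhds hp)
    have hPt : Tendsto (fun u => eval (φ u) P) (𝓝 z₁) (𝓝 (eval p P)) :=
      ((MvPolynomial.continuous_eval P).tendsto p).comp hφt
    have hev2 : ∀ᶠ u in 𝓝 z₁, eval (φ u) P < 0 := hPt.eventually (Iio_mem_nhds hp2)
    refine ⟨_, (hev1.and hev2).and hU, V', hV', fun u hu w hw huT hwT huw => ?_⟩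
    obtain ⟨⟨h4, h5⟩, h6⟩ := hu
    have h7 : Agr i u (φ u) := fun l hl => by simp only [φ, hl, if_true]
    have h8 : φ u ∈ sublevel P a o := ⟨huT.1.trans (h7.mono hai), h5.le⟩
    exact (h u h6 _ (hball h4).1 huT h8 h7).trans
      (h' _ (hball h4).2 w hw h8 hwT (h7.symm.trans huw))
  · rintro z w - - ⟨U, hU, V, hV, h⟩
    exact ⟨V, hV, U, hU, fun u hu v hv huT hvT huv => (h v hv u hu hvT huT huv.symm).symm⟩

/-- Connectedness in slices propagates along branches. -/
theorem IsAdapted.conn_isEnd (hA : IsAdapted P a Lab G A) (hT : IsCompact (sublevel P a o))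
    {j : Fin m} (haj : a ≤ j) {ξ ξ' η η' : Fin m → ℝ} (hξ : IsCrit P (j + 1) ξ)
    (hξ' : IsCrit P (j + 1) ξ') (hc : Conn (sublevel P a o) (j + 1) ξ ξ')
    (h : IsEnd P Lab G j ξ η) (h' : IsEnd P Lab G j ξ' η') (hj : η j = η' j) :
    Conn (sublevel P a o) (j + 1) η η' := by
  have hagr := hc.agr
  have hs : ξ j = ξ' j := hagr j (Nat.lt_succ_self _)
  have hagrj : Agr j ξ ξ' := hagr.mono (Nat.le_succ _)
  by_cases hne : ξ j = η j
  · rwa [← hA.isEnd_unique haj (isEnd_self hξ) h hne,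
      ← hA.isEnd_unique haj (isEnd_self hξ') h' (by rw [← hs, hne, hj])]
  obtain ⟨g, hg, hg0, hgt⟩ := hA.exists_branch hT haj hc.left_mem hξ h.2.2.2
  obtain ⟨g', hg', hg0', hgt'⟩ := hA.exists_branch hT haj hc.right_mem hξ' h'.2.2.2
  rw [← hs, ← hj] at hg' hgt'
  rw [← hs] at hg0'
  set I := uIcc (ξ j) (η j) with hI
  set I' := I \ {η j} with hI'
  have hI'c : IsPreconnected I' := by
    rw [hI', hI]
    rcases lt_or_gt_of_ne hne with hlt | hlt
    · rw [uIcc_of_le hlt.le, Icc_sdiff_right]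
      exact isPreconnected_Ico
    · rw [uIcc_of_ge hlt.le, Icc_sdiff_left]
      exact isPreconnected_Ioc
  have hlim : ∀ t ∈ I, ∀ u : Ultrafilter ℝ, (u : Filter ℝ) ≤ 𝓝[I'] t →
      (∀ᶠ s in (u : Filter ℝ), Conn (sublevel P a o) (j + 1) (g s) (g' s)) →
      Conn (sublevel P a o) (j + 1) (g t) (g' t) := fun t ht u hu h =>
    Conn.of_limit u hT h (((hg t ht).mono sdiff_subset).mono_left hu)
      (((hg' t ht).mono sdiff_subset).mono_left hu)
  have hagr' : ∀ t ∈ I, Agr (j + 1) (g t) (g' t) := fun t ht =>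
    (((hgt t ht).2.1.symm.trans hagrj).trans (hgt' t ht).2.1).succ
      ((hgt t ht).2.2.1.trans (hgt' t ht).2.2.1.symm)
  have hloc : ∀ t ∈ I', ∀ᶠ s in 𝓝[I'] t, (Conn (sublevel P a o) (j + 1) (g t) (g' t) ↔
      Conn (sublevel P a o) (j + 1) (g s) (g' s)) := by
    intro t ht
    by_cases hct : Conn (sublevel P a o) (j + 1) (g t) (g' t)
    · have hct' := hct
      obtain ⟨C, hC, hCT, hCi, h1, h2⟩ := hct'
      obtain ⟨U, hU, V, hV, h3⟩ := eventually_conn_of_isPreconnected (P := P) (a := a) (o := o)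
        (by omega : a ≤ (j : ℕ) + 1) hC hCi (fun w hw => ⟨hCT hw, by
          by_cases hcr : IsCrit P (j + 1) w
          · left
            refine hA.eval_neg_of_isCrit hT haj (hCT hw) hcr fun hwh => ht.2 ?_
            have h4 := hCi w hw
            have h5 : w j = t := by rw [← h4 j (Nat.lt_succ_self _), (hgt t ht.1).2.2.1]
            rw [h5, ← heights_congr ((hgt t ht.1).2.1.trans (h4.mono (Nat.le_succ _)))] at hwh
            exact h.2.2.2 t ht.1 hwh
          · exact Or.inr hcr⟩) h1 h2
      filter_upwards [((hg t ht.1).mono sdiff_subset).eventually hU,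
        ((hg' t ht.1).mono sdiff_subset).eventually hV, self_mem_nhdsWithin] with s hsU hsV hsI
      exact iff_of_true hct (h3 _ hsU _ hsV (hgt s hsI.1).1 (hgt' s hsI.1).1 (hagr' s hsI.1))
    · have : ∀ᶠ s in 𝓝[I'] t, ¬ Conn (sublevel P a o) (j + 1) (g s) (g' s) := by
        by_contra hcon
        obtain ⟨u, hu, hu'⟩ := exists_ultrafilter_of_frequently hcon
        exact hct (hlim t ht.1 u hu hu')
      filter_upwards [this] with s hs
      exact iff_of_false hct hs
  have hall : ∀ t ∈ I', Conn (sublevel P a o) (j + 1) (g t) (g' t) := by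
    intro t ht
    have h0 : ξ j ∈ I' := ⟨left_mem_uIcc, hne⟩
    refine (hI'c.induction₂ (fun t s => (Conn (sublevel P a o) (j + 1) (g t) (g' t) ↔
      Conn (sublevel P a o) (j + 1) (g s) (g' s))) hloc
      (fun _ _ _ _ _ _ h1 h2 => h1.trans h2) (fun _ _ _ _ h => h.symm) h0 ht).mp ?_
    rwa [hg0, hg0']
  have hend : Conn (sublevel P a o) (j + 1) (g (η j)) (g' (η j)) := by
    have : NeBot (𝓝[I'] (η j)) := mem_closure_iff_nhdsWithin_neBot.mp (mem_closure_uIcc_diff hne)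
    obtain ⟨u, hu⟩ := exists_ultrafilter_iff.mpr this
    refine hlim _ right_mem_uIcc u hu ?_
    exact Filter.mem_of_superset (hu self_mem_nhdsWithin) hall
  have hη := hgt _ (right_mem_uIcc (a := ξ j) (b := η j))
  have hη' := hgt' _ (right_mem_uIcc (a := ξ j) (b := η j))
  rwa [hA.relaxed_unique (j + 1) (by omega) j.2 ξ _ _ hη.2.2.2.1 h.2.1
      ((hη.2.1.symm.trans h.1).succ hη.2.2.1) hη.2.2.2.2.1 h.2.2.1,
    hA.relaxed_unique (j + 1) (by omega) j.2 ξ' _ _ hη'.2.2.2.1 h'.2.1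
      ((hη'.2.1.symm.trans h'.1).succ (hη'.2.2.1.trans hj)) hη'.2.2.2.2.1 h'.2.2.1] at hend

end ConnectedBranches

section Nodes

open Filter Topology

variable {m : ℕ} {P : MvPolynomial (Fin m) ℝ} {a : ℕ} {o : Fin m → ℝ}
  {Lab G : ℕ → Set (MvPolynomial (Fin m) ℝ)} {A : Set (MvPolynomial (Fin m) ℝ)}
  {C : Set (MvPolynomial (Fin m) ℝ)} {j : Fin m}

theorem mem_heights_of_sameSign (hC : ∀ c ∈ C, Dep ((j : ℕ) + 1) c) (hd : ∀ c ∈ C, pderiv j c ∈ C)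
    {η η' : Fin m → ℝ} (hη : η j ∈ heights C j η) (h : SameSign C η η') :
    η' j ∈ heights C j η' := by
  obtain ⟨c, hc, h0, h1⟩ := hη
  have h2 := sameThom_restrictLine hC hd (Agr.refl j η) (Agr.refl j η') h hc
  exact ⟨c, hc, h2.ne_zero h0, h2.eval_eq_zero h1⟩

theorem lt_iff_lt_of_mem_heights (hC : ∀ c ∈ C, Dep ((j : ℕ) + 1) c)
    (hd : ∀ c ∈ C, pderiv j c ∈ C) {η η' : Fin m → ℝ} (hη : η j ∈ heights C j η)
    (h : SameSign C η η') {b b' : Fin m → ℝ} (hb : Agr j η b) (hb' : Agr j η' b')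
    (hs : SameSign C b b') : (η j < b j ↔ η' j < b' j) ∧ (b j < η j ↔ b' j < η' j) := by
  obtain ⟨c, hc, h0, h1⟩ := hη
  exact lt_iff_lt_of_sameThom h0 (sameThom_restrictLine hC hd (Agr.refl j η) (Agr.refl j η') h hc)
    (sameThom_restrictLine hC hd hb hb' hs hc) h1

theorem IsAdapted.sameSign_G (hA : IsAdapted P a Lab G A) {i : ℕ} (hai : a ≤ i) (him : i ≤ m)
    {x y : Fin m → ℝ} (h : SameSign {f | f ∈ A ∧ Dep i f} x y) : SameSign (G i) x y :=
  fun c hc => h c ⟨hA.G_subset i hai him hc, hA.dep i c hc⟩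

theorem IsAdapted.exists_height (hA : IsAdapted P a Lab G A) (haj : a ≤ j) {x x' : Fin m → ℝ}
    (h : SameSign {f | f ∈ A ∧ Dep j f} x x') {t' : ℝ} (ht' : t' ∈ heights (G (j + 1)) j x') :
    ∃ t ∈ heights (G (j + 1)) j x, ∀ b b', Agr j x b → Agr j x' b' → SameSign (G (j + 1)) b b' →
      (t < b j ↔ t' < b' j) ∧ (b j < t ↔ b' j < t') := by
  obtain ⟨c, hc, h0, h1⟩ := ht'
  obtain ⟨h2, t, h3, h4⟩ := hA.exists_root j haj x' x h.symm c hc h0 t' h1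
  refine ⟨t, ⟨c, hc, h2, h3⟩, fun b b' hb hb' hs => ?_⟩
  have h5 := lt_iff_lt_of_mem_heights (hA.dep (j + 1)) (hA.pderiv_mem j)
    (η := Function.update x' j t') (η' := Function.update x j t) (b := b') (b' := b)
    (by rw [← heights_congr (agr_update j x' t'), Function.update_self]; exact ⟨c, hc, h0, h1⟩)
    (hA.sameSign_G (by omega) j.2 h4) ((agr_update j x' t').symm.trans hb')
    ((agr_update j x t).symm.trans hb) hs.symm
  rw [Function.update_self, Function.update_self] at h5
  exact ⟨h5.1.symm, h5.2.symm⟩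

/-- `η` is an exceptional end point of a branch starting in the component of `z` in its slice. -/
def Att (P : MvPolynomial (Fin m) ℝ) (Lab G : ℕ → Set (MvPolynomial (Fin m) ℝ))
    (T : Set (Fin m → ℝ)) (j : Fin m) (z η : Fin m → ℝ) : Prop :=
  ∃ ξ, IsCrit P (j + 1) ξ ∧ Conn T (j + 1) z ξ ∧ IsEnd P Lab G j ξ η ∧ η j ∈ heights (G (j + 1)) j z

/-- `η'` is a critical point of its slice with the same signs as `η`. -/
def Matches (P : MvPolynomial (Fin m) ℝ) (Lab : ℕ → Set (MvPolynomial (Fin m) ℝ))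
    (A : Set (MvPolynomial (Fin m) ℝ)) (j : Fin m) (η η' : Fin m → ℝ) : Prop :=
  IsCrit P (j + 1) η' ∧ SameSign A η η' ∧ SameSign (Lab (j + 1)) η η'

theorem Att.agr {T : Set (Fin m → ℝ)} {z η : Fin m → ℝ} (h : Att P Lab G T j z η) : Agr j z η := by
  obtain ⟨ξ, -, h1, h2, -⟩ := h
  exact (h1.agr.mono (Nat.le_succ _)).trans h2.1

theorem Att.mem_heights {T : Set (Fin m → ℝ)} {z η : Fin m → ℝ} (h : Att P Lab G T j z η) :
    η j ∈ heights (G (j + 1)) j η := by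
  have h0 := h.agr
  obtain ⟨ξ, -, -, -, h1⟩ := h
  rwa [← heights_congr h0]

theorem Att.conn (hA : IsAdapted P a Lab G A) (hT : IsCompact (sublevel P a o)) (haj : a ≤ j)
    {z η : Fin m → ℝ} (h : Att P Lab G (sublevel P a o) j z η) :
    Conn (sublevel P a o) j z η := by
  obtain ⟨ξ, h1, h2, h3, -⟩ := h
  exact (h2.mono (Nat.le_succ _)).trans (hA.conn_of_isEnd hT haj h2.right_mem h1 h3)

theorem IsAdapted.exists_att (hA : IsAdapted P a Lab G A) (hT : IsCompact (sublevel P a o))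
    (haj : a ≤ j) {z : Fin m → ℝ} (hz : z ∈ sublevel P a o) :
    ∃ η, Att P Lab G (sublevel P a o) j z η := by
  obtain ⟨ξ, h1, h2⟩ := exists_isCrit_conn (i := j + 1) hT (by omega) hz
  obtain ⟨η, h3, h4⟩ := hA.exists_isEnd_heights hT haj h2.right_mem h1
  exact ⟨η, ξ, h1, h2, h3, by rwa [heights_congr (h2.agr.mono (Nat.le_succ _))]⟩

theorem IsAdapted.exists_matches (hA : IsAdapted P a Lab G A) (haj : a ≤ j)
    {x x' η : Fin m → ℝ} (h : SameSign {f | f ∈ A ∧ Dep j f} x x') (hx : Agr j x η)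
    (hη : IsCrit P (j + 1) η) (hη' : η j ∈ heights (G (j + 1)) j η) :
    ∃ η', Agr j x' η' ∧ Matches P Lab A j η η' := by
  rw [← heights_congr hx] at hη'
  obtain ⟨c, hc, h0, h1⟩ := hη'
  obtain ⟨-, t', -, h2⟩ := hA.exists_root j haj x x' h c hc h0 _ h1
  obtain ⟨η', h3, h4⟩ := hA.exists_crit (j + 1) (by omega) j.2 _ _ h2 η hx.update_left hη
  exact ⟨η', (agr_update j x' t').trans (h3.mono (Nat.le_succ _)), h4⟩

theorem IsAdapted.mem_of_sameSign (hA : IsAdapted P a Lab G A) {i k : ℕ} (hai : a ≤ i)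
    {x' ξ ξ' : Fin m → ℝ} (hξ : ξ ∈ sublevel P a o) (hx' : x' ∈ sublevel P a o)
    (h : Agr i x' ξ') (hs : SameSign (Lab k) ξ ξ') : ξ' ∈ sublevel P a o :=
  ⟨hx'.1.trans (h.mono hai), hs.relaxed.nonpos (hA.self_mem k) hξ.2⟩

/-- Connectedness in the slices of `T` obtained by fixing the first `i` coordinates is determined
by the signs of the elements of `A`. -/
def Transfers (A : Set (MvPolynomial (Fin m) ℝ)) (T : Set (Fin m → ℝ)) (i : ℕ) : Prop :=
  ∀ x y x' y', Conn T i x y → x' ∈ T → y' ∈ T → Agr i x' y' → SameSign A x x' →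
    SameSign A y y' → Conn T i x' y'

theorem IsAdapted.att_of_matches (hA : IsAdapted P a Lab G A) (haj : a ≤ j)
    (hS : Transfers A (sublevel P a o) (j + 1)) {z z' η η' : Fin m → ℝ}
    (h : Att P Lab G (sublevel P a o) j z η) (hz' : z' ∈ sublevel P a o) (hzz' : SameSign A z z')
    (hη : Matches P Lab A j η η') (hη' : Agr j z' η') :
    Att P Lab G (sublevel P a o) j z' η' := by
  have hhη := h.mem_heights
  obtain ⟨ξ, h1, h2, h3, h4⟩ := h
  obtain ⟨ξ', h5, h6, h7, h8⟩ := hA.exists_crit (j + 1) (by omega) j.2 z z'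
    (hzz'.mono fun f hf => hf.1) ξ h2.agr h1
  have hGA := hA.G_subset (j + 1) (by omega) j.2
  have h9 : ξ' ∈ sublevel P a o :=
    hA.mem_of_sameSign (by omega : a ≤ (j : ℕ) + 1) h2.right_mem hz' h5 h8
  have h10 : Agr j ξ' η' := (h5.mono (Nat.le_succ _)).symm.trans hη'
  have hz'η := mem_heights_of_sameSign (hA.dep _) (hA.pderiv_mem j) hhη (hη.2.1.mono hGA)
  rw [← heights_congr hη'] at hz'η
  refine ⟨ξ', h6, hS _ _ _ _ h2 hz' h9 h5 hzz' h7, ⟨h10, hη.1,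
    h3.2.2.1.congr h8 hη.2.2, fun t' ht' hth => ?_⟩, hz'η⟩
  by_contra hne
  obtain ⟨t, h11, h12⟩ := hA.exists_height haj (x := ξ) (x' := ξ')
    (h7.mono fun f hf => hf.1) hth
  have h13 := h12 ξ ξ' (Agr.refl _ _) (Agr.refl _ _) (h7.mono hGA)
  have h14 := h12 η η' h3.1 h10 (hη.2.1.mono hGA)
  have h15 : t ∈ uIcc (ξ j) (η j) := by
    rw [mem_uIcc] at ht' ⊢
    rw [← not_lt, ← not_lt, ← not_lt, ← not_lt] at ht' ⊢
    rwa [h13.1, h13.2, h14.1, h14.2]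
  have h16 := h3.2.2.2 t h15 h11
  rcases lt_or_gt_of_ne hne with h | h
  · exact absurd (h14.1.mpr h) h16.not_lt
  · exact absurd (h14.2.mpr h) h16.symm.not_lt

theorem IsAdapted.conn_of_matches_of_eq (hA : IsAdapted P a Lab G A)
    (hT : IsCompact (sublevel P a o)) (haj : a ≤ j)
    (hS : Transfers A (sublevel P a o) (j + 1)) {z x' η₁ η₂ η₁' η₂' : Fin m → ℝ}
    (hx' : x' ∈ sublevel P a o)
    (h₁ : Att P Lab G (sublevel P a o) j z η₁) (h₂ : Att P Lab G (sublevel P a o) j z η₂)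
    (hm₁ : Matches P Lab A j η₁ η₁') (hm₂ : Matches P Lab A j η₂ η₂') (hη₁ : Agr j x' η₁')
    (hη₂ : Agr j x' η₂') (heq : η₁ j = η₂ j) : Conn (sublevel P a o) j η₁' η₂' := by
  have hGA := hA.G_subset (j + 1) (by omega) j.2
  have h3 := lt_iff_lt_of_mem_heights (hA.dep _) (hA.pderiv_mem j) h₁.mem_heights
    (hm₁.2.1.mono hGA) (h₁.agr.symm.trans h₂.agr) (hη₁.symm.trans hη₂) (hm₂.2.1.mono hGA)
  rw [heq] at h3
  have h4 : η₁' j = η₂' j := le_antisymm (not_lt.mp fun h => lt_irrefl _ (h3.2.mpr h))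
    (not_lt.mp fun h => lt_irrefl _ (h3.1.mpr h))
  have hc₁ := (h₁.conn hA hT haj).right_mem
  have hc₂ := (h₂.conn hA hT haj).right_mem
  obtain ⟨ξ₁, h5, h6, h7, -⟩ := h₁
  obtain ⟨ξ₂, h8, h9, h10, -⟩ := h₂
  have h11 := hA.conn_isEnd hT haj h5 h8 (h6.symm.trans h9) h7 h10 heq
  exact (hS _ _ _ _ h11 (hA.mem_of_sameSign haj hc₁ hx' hη₁ hm₁.2.2)
    (hA.mem_of_sameSign haj hc₂ hx' hη₂ hm₂.2.2) ((hη₁.symm.trans hη₂).succ h4) hm₁.2.1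
    hm₂.2.1).mono (Nat.le_succ _)

/-- The two ends of a branch are matched with connected points. -/
theorem IsAdapted.conn_of_matches_of_isEnd (hA : IsAdapted P a Lab G A)
    (hT : IsCompact (sublevel P a o)) (haj : a ≤ j) {x x' ξ η₁ η₂ η₁' η₂' : Fin m → ℝ}
    (hx : SameSign {f | f ∈ A ∧ Dep j f} x x') (hx' : x' ∈ sublevel P a o) (hxξ : Agr j x ξ)
    (hξT : ξ ∈ sublevel P a o) (hξ : IsCrit P (j + 1) ξ) (h₁ : IsEnd P Lab G j ξ η₁)
    (h₂ : IsEnd P Lab G j ξ η₂) (hh₁ : η₁ j ∈ heights (G (j + 1)) j η₁)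
    (hlt₁ : η₁ j < ξ j) (hlt₂ : ξ j < η₂ j)
    (hm₁ : Matches P Lab A j η₁ η₁') (hm₂ : Matches P Lab A j η₂ η₂') (hη₁ : Agr j x' η₁')
    (hη₂ : Agr j x' η₂') : Conn (sublevel P a o) j η₁' η₂' := by
  have hGA := hA.G_subset (j + 1) (by omega) j.2
  have hlt : η₁' j < η₂' j :=
    (lt_iff_lt_of_mem_heights (hA.dep _) (hA.pderiv_mem j) hh₁ (hm₁.2.1.mono hGA)
      (h₁.1.symm.trans h₂.1) (hη₁.symm.trans hη₂) (hm₂.2.1.mono hGA)).1.mp (hlt₁.trans hlt₂)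
  have hfree : ∀ t ∈ Ioo (η₁ j) (η₂ j), t ∉ heights (G (j + 1)) j x := by
    intro t ht hth
    rw [heights_congr hxξ] at hth
    rcases le_total t (ξ j) with h | h
    · exact ht.1.ne' (h₁.2.2.2 t (by rw [uIcc_of_ge hlt₁.le]; exact ⟨ht.1.le, h⟩) hth)
    · exact ht.2.ne (h₂.2.2.2 t (by rw [uIcc_of_le hlt₂.le]; exact ⟨h, ht.2.le⟩) hth)
  have hfree' : ∀ t ∈ Ioo (η₁' j) (η₂' j), t ∉ heights (G (j + 1)) j x' := by
    intro t' ht' hth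
    obtain ⟨t, h3, h4⟩ := hA.exists_height haj hx hth
    exact hfree t ⟨(h4 η₁ η₁' (hxξ.trans h₁.1) hη₁ (hm₁.2.1.mono hGA)).2.mpr ht'.1,
      (h4 η₂ η₂' (hxξ.trans h₂.1) hη₂ (hm₂.2.1.mono hGA)).1.mpr ht'.2⟩ h3
  obtain ⟨u', hu'⟩ := exists_between hlt
  have hsame : SameSign (G (j + 1)) ξ (Function.update x' j u') := by
    intro c hc
    have hdep := hA.dep (j + 1) c hc
    rw [← eval_restrictLine_self hdep hxξ, ← eval_restrictLine hdep]
    have hth := sameThom_restrictLine (hA.dep (j + 1)) (hA.pderiv_mem j) (hxξ.trans h₁.1) hη₁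
      (hm₁.2.1.mono hGA) hc
    obtain ⟨σ, ε, hε, hσ⟩ := exists_sign_right hth
    obtain ⟨r, hr0, hr⟩ := exists_between (lt_min hε (lt_min (sub_pos.mpr (hlt₁.trans hlt₂))
      (sub_pos.mpr hlt)))
    rw [lt_min_iff, lt_min_iff] at hr
    rw [sign_restrictLine_eq (t := η₁ j + r) (x := x) (fun u hu => hfree u ?_) c hc,
      (hσ r hr0 hr.1).1, ← (hσ r hr0 hr.1).2,
      sign_restrictLine_eq (t := u') (x := x') (fun u hu => hfree' u ?_) c hc]
    · refine ordConnected_Ioo.uIcc_subset ⟨?_, ?_⟩ hu' hu <;> linarith [hr.2.2]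
    · refine ordConnected_Ioo.uIcc_subset ⟨hlt₁, hlt₂⟩ ⟨?_, ?_⟩ hu <;> linarith [hr.2.1]
  obtain ⟨ξ', h3, h4, h5⟩ := hA.exists_label (j + 1) (by omega) j.2 _ _ hsame ξ (Agr.refl _ _) hξ
  have h6 : Agr j x' ξ' := (agr_update j x' u').trans (h3.mono (Nat.le_succ _))
  have h7 : ξ' j = u' := by rw [← h3 j (Nat.lt_succ_self _), Function.update_self]
  have h8 : ξ' ∈ sublevel P a o := hA.mem_of_sameSign haj hξT hx' h6 h5
  have h9 : IsEnd P Lab G j ξ' η₁' := by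
    refine ⟨h6.symm.trans hη₁, hm₁.1, h₁.2.2.1.congr h5 hm₁.2.2, fun t ht hth => ?_⟩
    rw [h7, uIcc_of_ge hu'.1.le] at ht
    rw [← heights_congr h6] at hth
    by_contra hne
    exact hfree' t ⟨lt_of_le_of_ne ht.1 (Ne.symm hne), ht.2.trans_lt hu'.2⟩ hth
  have h10 : IsEnd P Lab G j ξ' η₂' := by
    refine ⟨h6.symm.trans hη₂, hm₂.1, h₂.2.2.1.congr h5 hm₂.2.2, fun t ht hth => ?_⟩
    rw [h7, uIcc_of_le hu'.2.le] at ht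
    rw [← heights_congr h6] at hth
    by_contra hne
    exact hfree' t ⟨hu'.1.trans_le ht.1, lt_of_le_of_ne ht.2 hne⟩ hth
  exact (hA.conn_of_isEnd hT haj h8 h4 h9).symm.trans (hA.conn_of_isEnd hT haj h8 h4 h10)

end Nodes

section Transfer

open Filter Topology

variable {m : ℕ} {P : MvPolynomial (Fin m) ℝ} {a : ℕ} {o : Fin m → ℝ}
  {Lab G : ℕ → Set (MvPolynomial (Fin m) ℝ)} {A : Set (MvPolynomial (Fin m) ℝ)} {j : Fin m}

theorem IsAdapted.conn_of_matches_of_lt (hA : IsAdapted P a Lab G A)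
    (hT : IsCompact (sublevel P a o)) (haj : a ≤ j)
    (hS : Transfers A (sublevel P a o) (j + 1)) {z x' η₁ η₂ η₁' η₂' : Fin m → ℝ}
    (hzx' : SameSign {f | f ∈ A ∧ Dep j f} z x') (hx' : x' ∈ sublevel P a o)
    (h₁ : Att P Lab G (sublevel P a o) j z η₁) (h₂ : Att P Lab G (sublevel P a o) j z η₂)
    (hm₁ : Matches P Lab A j η₁ η₁') (hm₂ : Matches P Lab A j η₂ η₂') (hη₁ : Agr j x' η₁')
    (hη₂ : Agr j x' η₂') (hlt : η₁ j < η₂ j) : Conn (sublevel P a o) j η₁' η₂' := by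
  have h₁' := h₁
  have hh₁ := h₁.mem_heights
  obtain ⟨ξ₁, h3, h4, h5, h6⟩ := h₁'
  obtain ⟨ξ₂, h7, h8, h9, h10⟩ := id h₂
  have h11 : Agr j z ξ₂ := h8.agr.mono (Nat.le_succ _)
  have hz₁ : z j = ξ₁ j := h4.agr j (Nat.lt_succ_self _)
  have hz₂ : z j = ξ₂ j := h8.agr j (Nat.lt_succ_self _)
  have hf₁ : ∀ t ∈ uIcc (z j) (η₁ j), t ∈ heights (G (j + 1)) j z → t = η₁ j := by
    rw [hz₁, heights_congr (h4.agr.mono (Nat.le_succ _))]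
    exact h5.2.2.2
  have hf₂ : ∀ t ∈ uIcc (z j) (η₂ j), t ∈ heights (G (j + 1)) j z → t = η₂ j := by
    rw [hz₂, heights_congr h11]
    exact h9.2.2.2
  have hlt₁ : η₁ j < z j := by
    by_contra hle
    rw [not_lt] at hle
    exact hlt.ne (hf₂ _ (by rw [mem_uIcc]; exact Or.inl ⟨hle, hlt.le⟩) h6)
  have hlt₂ : z j < η₂ j := by
    by_contra hle
    rw [not_lt] at hle
    exact hlt.ne' (hf₁ _ (by rw [mem_uIcc]; exact Or.inr ⟨hlt.le, hle⟩) h10)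
  obtain ⟨η, h12, h13⟩ := hA.exists_isEnd hT haj h8.right_mem h7 (v := η₁ j) (by
    rw [← hz₂, ← heights_congr h11]
    exact hf₁)
  have hη : Att P Lab G (sublevel P a o) j z η := ⟨ξ₂, h7, h8, h12, by rwa [h13]⟩
  obtain ⟨η', h14, h15⟩ := hA.exists_matches haj hzx' hη.agr h12.2.1 hη.mem_heights
  refine (hA.conn_of_matches_of_eq hT haj hS hx' h₁ hη hm₁ h15 hη₁ h14 h13.symm).trans ?_
  exact hA.conn_of_matches_of_isEnd hT haj hzx' hx' h11 h8.right_mem h7 h12 h9 hη.mem_heights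
    (by rw [h13, ← hz₂]; exact hlt₁) (by rw [← hz₂]; exact hlt₂) h15 hm₂ h14 hη₂

theorem IsAdapted.conn_of_matches (hA : IsAdapted P a Lab G A)
    (hT : IsCompact (sublevel P a o)) (haj : a ≤ j)
    (hS : Transfers A (sublevel P a o) (j + 1)) {z x' η₁ η₂ η₁' η₂' : Fin m → ℝ}
    (hzx' : SameSign {f | f ∈ A ∧ Dep j f} z x') (hx' : x' ∈ sublevel P a o)
    (h₁ : Att P Lab G (sublevel P a o) j z η₁) (h₂ : Att P Lab G (sublevel P a o) j z η₂)
    (hm₁ : Matches P Lab A j η₁ η₁') (hm₂ : Matches P Lab A j η₂ η₂') (hη₁ : Agr j x' η₁')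
    (hη₂ : Agr j x' η₂') : Conn (sublevel P a o) j η₁' η₂' := by
  rcases lt_trichotomy (η₁ j) (η₂ j) with h | h | h
  · exact hA.conn_of_matches_of_lt hT haj hS hzx' hx' h₁ h₂ hm₁ hm₂ hη₁ hη₂ h
  · exact hA.conn_of_matches_of_eq hT haj hS hx' h₁ h₂ hm₁ hm₂ hη₁ hη₂ h
  · exact (hA.conn_of_matches_of_lt hT haj hS hzx' hx' h₂ h₁ hm₂ hm₁ hη₂ hη₁ h).symm

theorem eventually_relaxed {X : Type*} {l : Filter X} {F : Set (MvPolynomial (Fin m) ℝ)}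
    (hF : F.Finite) {ξ : X → Fin m → ℝ} {y : Fin m → ℝ} (h : Tendsto ξ l (𝓝 y)) :
    ∀ᶠ w in l, Relaxed F (ξ w) y := by
  refine (eventually_all_finite hF).mpr fun f _ => ?_
  have hc : Tendsto (fun w => eval (ξ w) f) l (𝓝 (eval y f)) :=
    ((MvPolynomial.continuous_eval f).tendsto y).comp h
  rcases lt_trichotomy (eval y f) 0 with h0 | h0 | h0
  · filter_upwards [hc.eventually (Iio_mem_nhds h0)] with w hw
    exact Or.inr (by rw [sign_neg h0, sign_neg hw])
  · exact Eventually.of_forall fun w => Or.inl h0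
  · filter_upwards [hc.eventually (Ioi_mem_nhds h0)] with w hw
    exact Or.inr (by rw [sign_pos h0, sign_pos hw])

/-- Nearby points of a slice share an exceptional end point. -/
theorem IsAdapted.eventually_exists_att (hA : IsAdapted P a Lab G A)
    (hT : IsCompact (sublevel P a o)) (haj : a ≤ j) (z : Fin m → ℝ) :
    ∀ᶠ w in 𝓝[{w | w ∈ sublevel P a o ∧ Agr j z w}] z,
      ∃ η, Att P Lab G (sublevel P a o) j z η ∧ Att P Lab G (sublevel P a o) j w η := by
  by_contra hcon
  obtain ⟨u, hu, hu'⟩ := exists_ultrafilter_of_frequently (not_eventually.mp hcon)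
  have huz : Tendsto id (u : Filter (Fin m → ℝ)) (𝓝 z) := hu.trans nhdsWithin_le_nhds
  have huT : ∀ᶠ w in (u : Filter (Fin m → ℝ)), w ∈ sublevel P a o ∧ Agr j z w :=
    hu self_mem_nhdsWithin
  have hex : ∀ w, ∃ ξ, w ∈ sublevel P a o → IsCrit P (j + 1) ξ ∧ Conn (sublevel P a o) (j + 1) w ξ :=
    fun w => by
      by_cases hw : w ∈ sublevel P a o
      · obtain ⟨ξ, h⟩ := exists_isCrit_conn (i := j + 1) hT (by omega) hw
        exact ⟨ξ, fun _ => h⟩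
      · exact ⟨w, fun h => absurd h hw⟩
  choose ξ hξ using hex
  obtain ⟨y, -, hy⟩ := hT.ultrafilter_le_nhds (u.map ξ)
    (le_principal_iff.mpr (huT.mono fun w hw => (hξ w hw.1).2.right_mem))
  have hξy : Tendsto ξ (u : Filter (Fin m → ℝ)) (𝓝 y) := hy
  have hzy : Conn (sublevel P a o) (j + 1) z y :=
    Conn.of_limit u hT (huT.mono fun w hw => (hξ w hw.1).2) huz hξy
  have hycrit : IsCrit P (j + 1) y :=
    (isClosed_isCrit P (j + 1)).mem_of_tendsto hξy (huT.mono fun w hw => (hξ w hw.1).1)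
  have hrel := eventually_relaxed (hA.finite_lab (j + 1)) hξy
  have hzyj : z j = y j := hzy.agr j (Nat.lt_succ_self _)
  have hhy := heights_congr (C := G (j + 1)) (hzy.agr.mono (Nat.le_succ _))
  have hnear : ∀ᶠ w in (u : Filter (Fin m → ℝ)),
      ∀ t ∈ uIcc (w j) (z j), t ∈ heights (G (j + 1)) j z → t = z j := by
    have hopen : {t | t ∈ heights (G (j + 1)) j z ∧ t ≠ z j}ᶜ ∈ 𝓝 (z j) :=
      ((finite_heights (hA.finite_G (j + 1)) j z).subset fun t ht => ht.1).isClosed.isOpen_compl.mem_nhds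
        fun h => h.2 rfl
    obtain ⟨r, hr, hball⟩ := Metric.mem_nhds_iff.mp hopen
    have : Tendsto (fun w : Fin m → ℝ => w j) (u : Filter (Fin m → ℝ)) (𝓝 (z j)) :=
      ((continuous_apply j).tendsto z).comp huz
    filter_upwards [this.eventually (Metric.ball_mem_nhds _ hr)] with w hw t ht hth
    by_contra hne
    have h1 : uIcc (w j) (z j) ⊆ Metric.ball (z j) r := by
      have h2 := Metric.mem_ball_self (x := z j) hr
      rw [← Metric.mem_ball] at hw
      rw [Real.ball_eq_Ioo] at hw h2 ⊢
      exact ordConnected_Ioo.uIcc_subset hw h2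
    exact hball (h1 ht) ⟨hth, hne⟩
  obtain ⟨w, hw, ⟨hwT, hzw⟩, hr, hn⟩ := (hu'.and (huT.and (hrel.and hnear))).exists
  apply hw
  obtain ⟨h1, h2⟩ := hξ w hwT
  have h3 : w j = ξ w j := h2.agr j (Nat.lt_succ_self _)
  have hwξ : Agr j w (ξ w) := h2.agr.mono (Nat.le_succ _)
  have hξyj : Agr j (ξ w) y := (hzw.trans hwξ).symm.trans (hzy.agr.mono (Nat.le_succ _))
  by_cases hzh : z j ∈ heights (G (j + 1)) j z
  · refine ⟨y, ⟨y, hycrit, hzy, isEnd_self hycrit, hzyj ▸ hzh⟩, ξ w, h1, h2,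
      ⟨hξyj, hycrit, hr, fun t ht hth => ?_⟩, ?_⟩
    · rw [← h3, ← hzyj] at ht
      rw [← hzyj]
      exact hn t ht (by rwa [heights_congr (hzw.trans hwξ)])
    · rw [← hzyj, ← heights_congr hzw]
      exact hzh
  · obtain ⟨η, h4, h5⟩ := hA.exists_isEnd_heights hT haj hzy.right_mem hycrit
    have h6 : SameSign (G (j + 1)) (ξ w) y := by
      have h7 := sameSign_update_of_notMem (hA.dep (j + 1)) (x := z) (s := w j) (t := z j)
        fun t ht hth => hzh (hn t ht hth ▸ hth)
      rw [Function.update_eq_self] at h7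
      have h8 : Agr (j + 1) (Function.update z j (w j)) (ξ w) :=
        (hzw.update_left).trans h2.agr
      exact ((SameSign.of_agr (hA.dep (j + 1)) h8).symm.trans h7).trans
        (SameSign.of_agr (hA.dep (j + 1)) hzy.agr)
    obtain ⟨y', h7, h8, h9⟩ := hA.exists_label (j + 1) (by omega) j.2 _ _ h6 (ξ w) (Agr.refl _ _) h1
    have h10 : y' = y := hA.relaxed_unique (j + 1) (by omega) j.2 (ξ w) _ _ h8 hycrit h7.symm
      h9.relaxed hr
    subst h10
    have h11 := hzw.trans hwξ
    refine ⟨η, ⟨y', hycrit, hzy, h4, by rwa [hhy]⟩, ξ w, h1, h2, ⟨hξyj.trans h4.1, h4.2.1,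
      h4.2.2.1.congr h9.symm (SameSign.refl _ _), fun t ht hth => ?_⟩, ?_⟩
    · rcases uIcc_subset_uIcc_union_uIcc (b := z j) ht with ht | ht
      · rw [← heights_congr h11] at hth
        rw [← h3] at ht
        exact absurd (hn t ht hth ▸ hth) hzh
      · rw [hzyj] at ht
        rw [heights_congr hξyj] at hth
        exact h4.2.2.2 t ht hth
    · rwa [← heights_congr hzw, hhy]

theorem IsAdapted.transfers_step (hA : IsAdapted P a Lab G A)
    (hT : IsCompact (sublevel P a o)) (haj : a ≤ j)
    (hS : Transfers A (sublevel P a o) (j + 1)) : Transfers A (sublevel P a o) j := by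
  intro x y x' y' hxy hx' hy' hxy' hxx' hyy'
  obtain ⟨C, hC, hCT, hCx, hx, hy⟩ := hxy
  have hdep : ∀ w ∈ C, SameSign {f | f ∈ A ∧ Dep j f} w x' := fun w hw =>
    (SameSign.of_agr (fun f hf => hf.2) (hCx w hw)).symm.trans (hxx'.mono fun f hf => hf.1)
  let K : (Fin m → ℝ) → Prop := fun w => ∃ η η', Att P Lab G (sublevel P a o) j w η ∧
    Matches P Lab A j η η' ∧ Agr j x' η' ∧ Conn (sublevel P a o) j x' η'
  have hstep : ∀ w ∈ C, ∀ w' ∈ C, ∀ η, Att P Lab G (sublevel P a o) j w η →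
      Att P Lab G (sublevel P a o) j w' η → K w → K w' := by
    rintro w hw w' hw' η hη hη' ⟨η₁, η₁', h1, h2, h3, h4⟩
    obtain ⟨ξ, h5⟩ := id hη
    obtain ⟨η', h6, h7⟩ := hA.exists_matches haj (hdep w hw) hη.agr h5.2.2.1.2.1 hη.mem_heights
    exact ⟨η, η', hη', h7, h6,
      h4.trans (hA.conn_of_matches hT haj hS (hdep w hw) hx' h1 hη h2 h7 h3 h6)⟩
  have hKx : K x := by
    obtain ⟨η, hη⟩ := hA.exists_att hT haj (hCT hx)
    obtain ⟨ξ, h5⟩ := id hη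
    obtain ⟨η', h6, h7⟩ := hA.exists_matches haj (hdep x hx) hη.agr h5.2.2.1.2.1 hη.mem_heights
    exact ⟨η, η', hη, h7, h6, (hA.att_of_matches haj hS hη hx' hxx' h7 h6).conn hA hT haj⟩
  have hKy : K y := by
    refine (hC.induction₂ (fun w w' => K w ↔ K w') (fun w hw => ?_)
      (fun _ _ _ _ _ _ h1 h2 => h1.trans h2) (fun _ _ _ _ h => h.symm) hx hy).mp hKx
    have hsub : C ⊆ {w' | w' ∈ sublevel P a o ∧ Agr j w w'} := fun w' hw' =>
      ⟨hCT hw', (hCx w hw).symm.trans (hCx w' hw')⟩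
    filter_upwards [nhdsWithin_mono w hsub (hA.eventually_exists_att hT haj w),
      self_mem_nhdsWithin] with w' ⟨η, h1, h2⟩ hw'
    exact ⟨hstep w hw w' hw' η h1 h2, hstep w' hw' w hw η h2 h1⟩
  obtain ⟨η, η', h1, h2, h3, h4⟩ := hKy
  exact h4.trans ((hA.att_of_matches haj hS h1 hy' hyy' h2 (hxy'.symm.trans h3)).conn hA hT haj).symm

theorem IsAdapted.transfers (hA : IsAdapted P a Lab G A) (hT : IsCompact (sublevel P a o)) :
    ∀ {i : ℕ}, a ≤ i → i ≤ m → Transfers A (sublevel P a o) i := by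
  suffices h : ∀ k i : ℕ, i + k = m → a ≤ i → Transfers A (sublevel P a o) i from
    fun {i} hai him => h (m - i) i (by omega) hai
  intro k
  induction k with
  | zero =>
    intro i him _ x y x' y' _ hx' _ hxy' _ _
    have : x' = y' := funext fun l => hxy' l (by omega)
    exact this ▸ Conn.refl i hx'
  | succ k ih =>
    intro i him hai
    exact hA.transfers_step (j := ⟨i, by omega⟩) hT hai (ih (i + 1) (by omega) (by omega))

end Transfer

section Labels

variable {m : ℕ}

/-- The value of the `r`-th derivative of `χ` at the variable `X l`. -/
noncomputable def derivAtVar (χ : Polynomial (MvPolynomial (Fin m) ℝ)) (l : Fin m) (r : ℕ) :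
    MvPolynomial (Fin m) ℝ :=
  Polynomial.eval (X l) (Polynomial.derivative^[r] χ)

theorem eval_derivAtVar (χ : Polynomial (MvPolynomial (Fin m) ℝ)) (l : Fin m) (r : ℕ)
    (ξ : Fin m → ℝ) : eval ξ (derivAtVar χ l r) =
      (Polynomial.derivative^[r] (χ.map (eval ξ))).eval (ξ l) := by
  rw [derivAtVar, Polynomial.iterate_derivative_map, Polynomial.eval_map, Polynomial.eval,
    Polynomial.hom_eval₂, RingHom.comp_id, eval_X]

theorem totalDegree_derivAtVar {D : ℕ} {χ : Polynomial (MvPolynomial (Fin m) ℝ)}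
    (hχ : CoeffDegreeLE D χ) (l : Fin m) (r : ℕ) :
    (derivAtVar χ l r).totalDegree ≤ D + χ.natDegree := by
  rw [derivAtVar, Polynomial.eval_eq_sum_range]
  refine totalDegree_finsetSum_le fun k hk => (totalDegree_mul _ _).trans (add_le_add ?_ ?_)
  · rw [Polynomial.coeff_iterate_derivative]
    exact (totalDegree_smul_le _ _).trans (hχ _)
  · rw [totalDegree_X_pow]
    have h1 := Polynomial.natDegree_iterate_derivative χ r
    have h2 := Finset.mem_range.mp hk
    omega

theorem map_eval_congr {i : ℕ} {χ : Polynomial (MvPolynomial (Fin m) ℝ)}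
    (hχ : ∀ k, Dep i (χ.coeff k)) {x y : Fin m → ℝ} (h : Agr i x y) :
    χ.map (eval x) = χ.map (eval y) := by
  ext k
  rw [Polynomial.coeff_map, Polynomial.coeff_map]
  exact hχ k x y h

theorem hasDerivAt_eval_single (f : MvPolynomial (Fin m) ℝ) (ξ : Fin m → ℝ) (l : Fin m) :
    HasDerivAt (fun s : ℝ => eval (ξ + s • Pi.single l (1 : ℝ)) f) (eval ξ (pderiv l f)) 0 := by
  have h := hasDerivAt_eval_line f ξ (Pi.single l 1) 0
  simpa [Pi.single_apply] using h

theorem agr_add_single {i : ℕ} (ξ : Fin m → ℝ) {l : Fin m} (hl : i ≤ (l : ℕ)) (s : ℝ) :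
    Agr i ξ (ξ + s • Pi.single l (1 : ℝ)) := fun k hk => by
  have : k ≠ l := by rintro rfl; omega
  simp [this]

theorem Dep.pderiv {i : ℕ} {f : MvPolynomial (Fin m) ℝ} (hf : Dep i f) (l : Fin m) :
    Dep i (pderiv l f) := by
  intro x y h
  refine (hasDerivAt_eval_single f x l).unique ?_
  have h1 : (fun s : ℝ => eval (x + s • Pi.single l (1 : ℝ)) f) =
      fun s : ℝ => eval (y + s • Pi.single l (1 : ℝ)) f := by
    funext s
    refine hf _ _ fun k hk => ?_
    simp [h k hk]
  rw [h1]
  exact hasDerivAt_eval_single f y l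

theorem eval_pderiv_derivAtVar_self {i : ℕ} {χ : Polynomial (MvPolynomial (Fin m) ℝ)}
    (hχ : ∀ k, Dep i (χ.coeff k)) {l : Fin m} (hl : i ≤ (l : ℕ)) (r : ℕ) (ξ : Fin m → ℝ) :
    eval ξ (pderiv l (derivAtVar χ l r)) =
      (Polynomial.derivative^[r + 1] (χ.map (eval ξ))).eval (ξ l) := by
  refine (hasDerivAt_eval_single _ ξ l).unique ?_
  have h := (Polynomial.derivative^[r] (χ.map (eval ξ))).hasDerivAt (ξ l + 0)
  have h' := h.comp_const_add (ξ l) 0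
  rw [add_zero, ← Function.iterate_succ_apply' Polynomial.derivative] at h'
  convert h' using 1
  ext s
  rw [eval_derivAtVar, ← map_eval_congr hχ (agr_add_single ξ hl s)]
  simp

theorem eval_pderiv_derivAtVar_of_ne {i : ℕ} {χ : Polynomial (MvPolynomial (Fin m) ℝ)}
    (hχ : ∀ k, Dep i (χ.coeff k)) {l l' : Fin m} (hl : i ≤ (l' : ℕ)) (hne : l' ≠ l) (r : ℕ)
    (ξ : Fin m → ℝ) : eval ξ (pderiv l' (derivAtVar χ l r)) = 0 := by
  refine (hasDerivAt_eval_single _ ξ l').unique ?_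
  convert hasDerivAt_const (0 : ℝ) (eval ξ (derivAtVar χ l r)) using 1
  ext s
  rw [eval_derivAtVar, eval_derivAtVar, ← map_eval_congr hχ (agr_add_single ξ hl s)]
  simp [hne.symm]

theorem exists_labels {i n : ℕ} (hn : n ≠ 0) {P : MvPolynomial (Fin m) ℝ}
    {p : Fin m → MvPolynomial (Fin m) ℝ}
    (hp : ∀ l : Fin m, i ≤ (l : ℕ) → p l - X l ^ n ∈ degreeLT (Fin m) n)
    (hcrit : ∀ ξ, IsCrit P i ξ ↔ ∀ l : Fin m, i ≤ (l : ℕ) → eval ξ (p l) = 0) :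
    ∃ Lab : Set (MvPolynomial (Fin m) ℝ), Lab.Finite ∧ P ∈ Lab ∧
      (∀ f ∈ Lab, f.totalDegree ≤ max P.totalDegree
        (Fintype.card (FiberIdx m i n) * (1 + m * n) + Fintype.card (FiberIdx m i n))) ∧
      (∀ ξ η η', IsCrit P i η → IsCrit P i η' → Agr i η η' → Relaxed Lab ξ η → Relaxed Lab ξ η' →
        η = η') ∧
      ∀ ξ, IsCrit P i ξ → ∀ l : Fin m, i ≤ (l : ℕ) → ∃ f ∈ Lab, eval ξ f = 0 ∧
        eval ξ (pderiv l f) ≠ 0 ∧ ∀ l' : Fin m, i ≤ (l' : ℕ) → l' ≠ l →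
          eval ξ (pderiv l' f) = 0 := by
  choose χ hmonic hdeg hcoeff hdep hroot using exists_coordinate_polynomial hn hp
  set N := Fintype.card (FiberIdx m i n)
  have hroot' {ξ : Fin m → ℝ} (hξ : IsCrit P i ξ) (l : Fin m) :
      ((χ l).map (eval ξ)).eval (ξ l) = 0 :=
    hroot l ξ ξ ⟨Agr.refl i ξ, (hcrit ξ).mp hξ⟩
  have hne (l : Fin m) (ξ : Fin m → ℝ) : (χ l).map (eval ξ) ≠ 0 :=
    ((hmonic l).map (eval ξ)).ne_zero
  have hhigh (l : Fin m) (ξ : Fin m → ℝ) {r : ℕ} (hr : N < r) :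
      Polynomial.derivative^[r] ((χ l).map (eval ξ)) = 0 := by
    refine Polynomial.iterate_derivative_eq_zero (lt_of_le_of_lt ?_ hr)
    exact Polynomial.natDegree_map_le.trans (hdeg l).le
  refine ⟨insert P (⋃ l, (fun r => derivAtVar (χ l) l r) '' Iic N),
    (finite_iUnion fun l => (finite_Iic N).image _).insert _, mem_insert _ _, ?_, ?_, ?_⟩
  · rintro f (rfl | hf)
    · exact le_max_left _ _
    · obtain ⟨l, r, -, rfl⟩ := mem_iUnion.mp hf
      exact le_max_of_le_right ((totalDegree_derivAtVar (hcoeff l) l r).trans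
        (Nat.add_le_add_left (hdeg l).le _))
  · intro ξ η η' hη hη' hagr hr hr'
    funext l
    have hsat {ζ : Fin m → ℝ}
        (h : Relaxed (insert P (⋃ l, (fun r => derivAtVar (χ l) l r) '' Iic N)) ξ ζ) :
        ThomSat (fun k => {τ | τ = 0 ∨ τ = SignType.sign (eval ξ (derivAtVar (χ l) l k))})
          ((χ l).map (eval ζ)) (ζ l) := by
      intro k
      rcases le_or_gt k N with hk | hk
      · have := h (derivAtVar (χ l) l k) (Or.inr (mem_iUnion.mpr ⟨l, k, hk, rfl⟩))
        rw [← eval_derivAtVar]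
        rcases this with h0 | h0
        · exact Or.inl (by rw [h0, sign_zero])
        · exact Or.inr h0
      · exact Or.inl (by rw [hhigh l ζ hk, Polynomial.eval_zero, sign_zero])
    have h1 := hsat hr
    have h2 := hsat hr'
    have h3 := hroot' hη l
    rw [map_eval_congr (hdep l) hagr] at h1 h3
    exact ThomSat.eq (isThomConstraint_pair _) (hne l η') h1 h2 h3 (hroot' hη' l)
  · intro ξ hξ l hl
    have hex : ∃ k, (Polynomial.derivative^[k] ((χ l).map (eval ξ))).eval (ξ l) ≠ 0 := by
      by_contra hcon
      push Not at hcon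
      have h1 : SameThom ((χ l).map (eval ξ)) (ξ l) 0 0 := fun k => by
        rw [hcon k, Polynomial.iterate_derivative_zero, Polynomial.eval_zero]
      exact (h1.ne_zero (hne l ξ)) rfl
    classical
    obtain ⟨k, hk, hmin⟩ : ∃ k, (Polynomial.derivative^[k] ((χ l).map (eval ξ))).eval (ξ l) ≠ 0 ∧
        ∀ r < k, (Polynomial.derivative^[r] ((χ l).map (eval ξ))).eval (ξ l) = 0 :=
      ⟨Nat.find hex, Nat.find_spec hex, fun r hr => not_not.mp (Nat.find_min hex hr)⟩
    rcases k with _ | r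
    · exact absurd (hroot' hξ l) hk
    have hr : r ≤ N := by
      by_contra hcon
      exact hk (by rw [hhigh l ξ (by omega), Polynomial.eval_zero])
    refine ⟨derivAtVar (χ l) l r, Or.inr (mem_iUnion.mpr ⟨l, r, hr, rfl⟩), ?_, ?_, ?_⟩
    · rw [eval_derivAtVar]
      exact hmin r (Nat.lt_succ_self r)
    · rwa [eval_pderiv_derivAtVar_self (hdep l) hl]
    · intro l' hl' hne
      exact eval_pderiv_derivAtVar_of_ne (hdep l) hl' hne r ξ

end Labels

section Families

variable {m : ℕ}

theorem totalDegree_pderiv_le {σ : Type*} (l : σ) {f : MvPolynomial σ ℝ} {d : ℕ}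
    (hf : f ∈ degreeLT σ (d + 1)) : pderiv l f ∈ degreeLT σ d := by
  rw [mem_degreeLT] at hf
  rw [f.as_sum, map_sum]
  refine sum_mem fun κ hκ => ?_
  rw [pderiv_monomial]
  by_cases h0 : κ l = 0
  · simp [h0, zero_mem]
  refine mem_degreeLT.2 fun κ' hκ' => ?_
  have := support_monomial_subset hκ'
  rw [Finset.mem_singleton] at this
  subst this
  have h1 : κ - Finsupp.single l 1 + Finsupp.single l 1 = κ :=
    tsub_add_cancel_of_le (by simpa using Nat.one_le_iff_ne_zero.mpr h0)
  have h2 := congrArg Finsupp.degree h1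
  rw [map_add, Finsupp.degree_single] at h2
  have h3 := hf κ hκ
  omega

theorem exists_pderiv_closed {i : ℕ} (l : Fin m) {W : Set (MvPolynomial (Fin m) ℝ)}
    (hW : W.Finite) (hdep : ∀ f ∈ W, Dep i f) {b : ℕ} (hb : ∀ f ∈ W, f.totalDegree ≤ b) :
    ∃ G, W ⊆ G ∧ G.Finite ∧ (∀ f ∈ G, Dep i f) ∧ (∀ f ∈ G, f.totalDegree ≤ b) ∧
      ∀ f ∈ G, pderiv l f ∈ G := by
  have hdeg (f : MvPolynomial (Fin m) ℝ) (hf : f ∈ W) (r : ℕ) (hr : r ≤ b + 1) :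
      (pderiv l)^[r] f ∈ degreeLT (Fin m) (b + 1 - r) := by
    induction r with
    | zero => exact mem_degreeLT_succ.2 (hb f hf)
    | succ r ih =>
      rw [Function.iterate_succ_apply']
      apply totalDegree_pderiv_le
      have := ih (by omega)
      rwa [show b + 1 - r = b + 1 - (r + 1) + 1 by omega] at this
  refine ⟨⋃ r ∈ Iic (b + 1), (pderiv l)^[r] '' W, fun f hf => ?_, ?_, ?_, ?_, ?_⟩
  · exact mem_biUnion (x := 0) (by simp) ⟨f, hf, rfl⟩
  · exact (finite_Iic (b + 1)).biUnion fun r _ => hW.image _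
  · intro f hf
    obtain ⟨r, -, g, hg, rfl⟩ := mem_iUnion₂.mp hf
    clear hf
    induction r with
    | zero => exact hdep g hg
    | succ r ih =>
      rw [Function.iterate_succ_apply']
      exact ih.pderiv l
  · intro f hf
    obtain ⟨r, hr, g, hg, rfl⟩ := mem_iUnion₂.mp hf
    exact mem_degreeLT_succ.1 (degreeLT_mono (by omega) (hdeg g hg r hr))
  · intro f hf
    obtain ⟨r, hr, g, hg, rfl⟩ := mem_iUnion₂.mp hf
    rcases Nat.lt_or_ge r (b + 1) with h | h
    · exact mem_biUnion (x := r + 1) h ⟨g, hg, Function.iterate_succ_apply' _ _ _⟩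
    · have h0 := hdeg g hg r hr
      rw [show b + 1 - r = 0 by omega] at h0
      rw [degreeLT_zero h0, map_zero]
      exact mem_biUnion (x := r) hr ⟨g, hg, degreeLT_zero h0⟩

theorem exists_label_family {i n : ℕ} (hn : n ≠ 0) {P : MvPolynomial (Fin m) ℝ}
    {p : Fin m → MvPolynomial (Fin m) ℝ}
    (hp : ∀ l : Fin m, i ≤ (l : ℕ) → p l - X l ^ n ∈ degreeLT (Fin m) n)
    (hcrit : ∀ ξ, IsCrit P i ξ ↔ ∀ l : Fin m, i ≤ (l : ℕ) → eval ξ (p l) = 0)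
    {Lab : Set (MvPolynomial (Fin m) ℝ)} (hLab : Lab.Finite) {b L : ℕ}
    (hb : ∀ f ∈ Lab, f.totalDegree ≤ b) (hL : 2 * Fintype.card (FiberIdx m i n) ≤ 2 ^ L) :
    ∃ G : Set (MvPolynomial (Fin m) ℝ), G.Finite ∧
      (∀ g ∈ G, g.totalDegree ≤ Fintype.card (FiberIdx m i n) * (L * (2 * b) + 2 * (m * n))) ∧
      (∀ g ∈ G, Dep i g) ∧ (∀ j : Fin m, (j : ℕ) + 1 = i → ∀ c ∈ G, pderiv j c ∈ G) ∧
      ∀ x x', SameSign G x x' → ∀ ξ, Agr i x ξ → IsCrit P i ξ →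
        ∃ ξ', Agr i x' ξ' ∧ IsCrit P i ξ' ∧ SameSign Lab ξ ξ' := by
  obtain ⟨W, hWf, hWb, hWd, hW⟩ := exists_sign_determination_fiber hn hp hLab hb hL
  obtain ⟨G, hWG, hGf, hGd, hGb, hGc⟩ : ∃ G, W ⊆ G ∧ G.Finite ∧ (∀ f ∈ G, Dep i f) ∧
      (∀ f ∈ G, f.totalDegree ≤
        Fintype.card (FiberIdx m i n) * (L * (2 * b) + 2 * (m * n))) ∧
      ∀ j : Fin m, (j : ℕ) + 1 = i → ∀ c ∈ G, pderiv j c ∈ G := by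
    by_cases hj : ∃ j : Fin m, (j : ℕ) + 1 = i
    · obtain ⟨j, hj⟩ := hj
      obtain ⟨G, h1, h2, h3, h4, h5⟩ := exists_pderiv_closed j hWf hWd hWb
      refine ⟨G, h1, h2, h3, h4, fun j' hj' => ?_⟩
      rwa [show j' = j from Fin.ext (by omega)]
    · push Not at hj
      exact ⟨W, le_rfl, hWf, hWd, hWb, fun j h => absurd h (hj j)⟩
  refine ⟨G, hGf, hGb, hGd, hGc, fun x x' h ξ hξ hξc => ?_⟩
  obtain ⟨ξ', h1, h2⟩ := hW x x' (h.mono hWG) ξ ⟨hξ, (hcrit ξ).mp hξc⟩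
  exact ⟨ξ', h1.1, (hcrit ξ').mpr h1.2, fun f hf => (h2 f hf).symm⟩

/-- The properties of an adapted family at the levels at least `i`. -/
structure IsAdaptedFrom (P : MvPolynomial (Fin m) ℝ) (Lab G : ℕ → Set (MvPolynomial (Fin m) ℝ))
    (i : ℕ) (A : Set (MvPolynomial (Fin m) ℝ)) : Prop where
  finite : A.Finite
  G_subset : ∀ k, i ≤ k → k ≤ m → G k ⊆ A
  exists_root : ∀ j : Fin m, i ≤ (j : ℕ) → ∀ x x', SameSign {f | f ∈ A ∧ Dep j f} x x' →
    ∀ c ∈ G (j + 1), restrictLine j c x ≠ 0 → ∀ t, (restrictLine j c x).eval t = 0 →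
      restrictLine j c x' ≠ 0 ∧ ∃ t', (restrictLine j c x').eval t' = 0 ∧
        SameSign {f | f ∈ A ∧ Dep (j + 1) f} (Function.update x j t) (Function.update x' j t')
  exists_crit : ∀ k, i ≤ k → k ≤ m → ∀ x x', SameSign {f | f ∈ A ∧ Dep k f} x x' →
    ∀ ξ, Agr k x ξ → IsCrit P k ξ → ∃ ξ', Agr k x' ξ' ∧ IsCrit P k ξ' ∧
      SameSign A ξ ξ' ∧ SameSign (Lab k) ξ ξ'

theorem isAdaptedFrom_empty (P : MvPolynomial (Fin m) ℝ)
    (Lab G : ℕ → Set (MvPolynomial (Fin m) ℝ)) : IsAdaptedFrom P Lab G (m + 1) ∅ where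
  finite := finite_empty
  G_subset k _ _ := by omega
  exists_root j _ := by omega
  exists_crit k _ _ := by omega

theorem Dep.mono {i j : ℕ} (hij : i ≤ j) {f : MvPolynomial (Fin m) ℝ} (hf : Dep i f) : Dep j f :=
  fun x y h => hf x y (h.mono hij)

theorem sameSign_of_dep {i : ℕ} {A W : Set (MvPolynomial (Fin m) ℝ)} (hWA : W ⊆ A)
    (hW : ∀ f ∈ W, Dep i f) {x x' y y' : Fin m → ℝ} (h : SameSign {f | f ∈ A ∧ Dep i f} x x')
    (hy : Agr i x y) (hy' : Agr i x' y') : SameSign W y y' :=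
  ((SameSign.of_agr hW hy).symm.trans (h.mono fun f hf => And.intro (hWA hf) (hW f hf))).trans
    (SameSign.of_agr hW hy')

theorem SameSign.union {F F' : Set (MvPolynomial (Fin m) ℝ)} {x y : Fin m → ℝ}
    (h : SameSign F x y) (h' : SameSign F' x y) : SameSign (F ∪ F') x y :=
  fun f hf => hf.elim (h f) (h' f)

theorem IsAdaptedFrom.step {P : MvPolynomial (Fin m) ℝ} {Lab G : ℕ → Set (MvPolynomial (Fin m) ℝ)}
    {i : ℕ} {A W : Set (MvPolynomial (Fin m) ℝ)} (hA : IsAdaptedFrom P Lab G (i + 1) A)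
    (hWf : W.Finite) (hW : ∀ f ∈ W, Dep i f) (hG : G i ⊆ W)
    (hroot : ∀ j : Fin m, (j : ℕ) = i → ∀ x x', SameSign W x x' →
      ∀ c ∈ G (j + 1), restrictLine j c x ≠ 0 → ∀ t, (restrictLine j c x).eval t = 0 →
      restrictLine j c x' ≠ 0 ∧ ∃ t', (restrictLine j c x').eval t' = 0 ∧
        SameSign {f | f ∈ A ∧ Dep (j + 1) f} (Function.update x j t) (Function.update x' j t'))
    (hcrit : ∀ x x', SameSign W x x' → ∀ ξ, Agr i x ξ → IsCrit P i ξ →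
      ∃ ξ', Agr i x' ξ' ∧ IsCrit P i ξ' ∧ SameSign (A ∪ Lab i) ξ ξ') :
    IsAdaptedFrom P Lab G i (A ∪ W) where
  finite := hA.finite.union hWf
  G_subset k hk hkm := by
    rcases hk.eq_or_lt with rfl | hk
    · exact hG.trans subset_union_right
    · exact (hA.G_subset k hk hkm).trans subset_union_left
  exists_root j hj x x' h c hc hne t ht := by
    have hWj : ∀ f ∈ W, Dep j f := fun f hf => (hW f hf).mono hj
    have key : restrictLine j c x' ≠ 0 ∧ ∃ t', (restrictLine j c x').eval t' = 0 ∧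
        SameSign {f | f ∈ A ∧ Dep (j + 1) f} (Function.update x j t)
          (Function.update x' j t') := by
      rcases hj.eq_or_lt with hj | hj
      · exact hroot j hj.symm x x' (h.mono fun f hf => And.intro (Or.inr hf) (hWj f hf)) c hc hne t ht
      · exact hA.exists_root j hj x x' (h.mono fun f hf => And.intro (Or.inl hf.1) hf.2) c hc hne t ht
    obtain ⟨h1, t', h2, h3⟩ := key
    refine ⟨h1, t', h2, ?_⟩
    have h4 := sameSign_of_dep subset_union_right hWj h (agr_update j x t) (agr_update j x' t')
    exact (h3.union h4).mono fun f hf => hf.1.imp (fun hfA => ⟨hfA, hf.2⟩) id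
  exists_crit k hk hkm x x' h ξ hξ hξc := by
    have hWk : ∀ f ∈ W, Dep k f := fun f hf => (hW f hf).mono hk
    have key : ∃ ξ', Agr k x' ξ' ∧ IsCrit P k ξ' ∧ SameSign (A ∪ Lab k) ξ ξ' := by
      rcases hk.eq_or_lt with rfl | hk
      · exact hcrit x x' (h.mono fun f hf => And.intro (Or.inr hf) (hWk f hf)) ξ hξ hξc
      · obtain ⟨ξ', h1, h2, h3, h4⟩ :=
          hA.exists_crit k hk hkm x x' (h.mono fun f hf => And.intro (Or.inl hf.1) hf.2) ξ hξ hξc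
        exact ⟨ξ', h1, h2, h3.union h4⟩
    obtain ⟨ξ', h1, h2, h3⟩ := key
    exact ⟨ξ', h1, h2, (h3.mono subset_union_left).union
      (sameSign_of_dep subset_union_right hWk h hξ h1), h3.mono subset_union_right⟩

theorem restrictLine_ne_zero_iff {j : Fin m} {c : MvPolynomial (Fin m) ℝ} (hc : Dep (j + 1) c)
    (x : Fin m → ℝ) : restrictLine j c x ≠ 0 ↔ ∃ s, eval (Function.update x j s) c ≠ 0 := by
  rw [← not_iff_not, not_not]
  push Not
  simp only [← eval_restrictLine hc]
  exact ⟨fun h s => by rw [h, Polynomial.eval_zero], fun h => Polynomial.funext fun s => by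
    rw [h s, Polynomial.eval_zero]⟩

theorem IsAdaptedFrom.exists_step {P : MvPolynomial (Fin m) ℝ}
    {Lab G : ℕ → Set (MvPolynomial (Fin m) ℝ)}
    {i n : ℕ} (hn : n ≠ 0) {p : Fin m → MvPolynomial (Fin m) ℝ}
    (hp : ∀ l : Fin m, i ≤ (l : ℕ) → p l - X l ^ n ∈ degreeLT (Fin m) n)
    (hcrit : ∀ ξ, IsCrit P i ξ ↔ ∀ l : Fin m, i ≤ (l : ℕ) → eval ξ (p l) = 0)
    (hLab : (Lab i).Finite) (hGf : (G i).Finite) (hGd : ∀ c ∈ G i, Dep i c)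
    (hGf' : (G (i + 1)).Finite) (hGd' : ∀ c ∈ G (i + 1), Dep (i + 1) c)
    {A : Set (MvPolynomial (Fin m) ℝ)} (hA : IsAdaptedFrom P Lab G (i + 1) A)
    {b b' g g' L L' : ℕ} (hb : ∀ f ∈ A ∪ Lab i, f.totalDegree ≤ b)
    (hb' : ∀ f ∈ A, f.totalDegree ≤ b')
    (hg : ∀ f ∈ G i, f.totalDegree ≤ g) (hg' : ∀ f ∈ G (i + 1), f.totalDegree ≤ g')
    (hL : 2 * Fintype.card (FiberIdx m i n) ≤ 2 ^ L) (hL' : 2 * g' ≤ 2 ^ L') :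
    ∃ W, W.Finite ∧ (∀ f ∈ W, Dep i f) ∧ IsAdaptedFrom P Lab G i (A ∪ W) ∧ ∀ f ∈ W,
      f.totalDegree ≤ max g (max
        (Fintype.card (FiberIdx m i n) * (L * (2 * b) + 2 * (m * n)))
        (g' * (1 + 2 * (L' * b')) + (2 * (L' * b') + 2 * g') * g')) := by
  obtain ⟨W₁, h1f, h1b, h1d, h1⟩ :=
    exists_sign_determination_fiber hn hp (hA.finite.union hLab) hb hL
  obtain ⟨W₂, h2f, h2b, h2d, h2⟩ : ∃ W₂ : Set (MvPolynomial (Fin m) ℝ), W₂.Finite ∧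
      (∀ w ∈ W₂, w.totalDegree ≤ g' * (1 + 2 * (L' * b')) + (2 * (L' * b') + 2 * g') * g') ∧
      (∀ w ∈ W₂, Dep i w) ∧ ∀ j : Fin m, (j : ℕ) = i → ∀ x x', SameSign W₂ x x' →
      ∀ c ∈ G (j + 1), restrictLine j c x ≠ 0 → ∀ t, (restrictLine j c x).eval t = 0 →
      restrictLine j c x' ≠ 0 ∧ ∃ t', (restrictLine j c x').eval t' = 0 ∧
        SameSign {f | f ∈ A ∧ Dep (j + 1) f} (Function.update x j t)
          (Function.update x' j t') := by
    by_cases him : i < m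
    · have key (c : MvPolynomial (Fin m) ℝ) (hc : c ∈ G (i + 1)) :=
        exists_sign_determination_line ⟨i, him⟩ (hGd' c hc) (hg' c hc)
          (hA.finite.subset (sep_subset A (Dep (i + 1)))) (fun f hf => hf.2)
          (fun f hf => hb' f hf.1) hL'
      choose! V hVf hVb hVd hV using key
      refine ⟨⋃ c ∈ G (i + 1), V c, hGf'.biUnion fun c hc => hVf c hc, ?_, ?_, ?_⟩
      · intro w hw
        obtain ⟨c, hc, hw⟩ := mem_iUnion₂.mp hw
        exact hVb c hc w hw
      · intro w hw
        obtain ⟨c, hc, hw⟩ := mem_iUnion₂.mp hw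
        exact hVd c hc w hw
      · intro j hj x x' h c hc hne t ht
        obtain rfl : j = ⟨i, him⟩ := Fin.ext hj
        have hcd := hGd' c hc
        obtain ⟨h3, h4⟩ := hV c hc x x' (h.mono (subset_biUnion_of_mem hc))
          ((restrictLine_ne_zero_iff hcd x).mp hne)
        rw [eval_restrictLine hcd] at ht
        obtain ⟨t', h5, h6⟩ := h4 t ht
        refine ⟨(restrictLine_ne_zero_iff hcd x').mpr h3, t', ?_, fun f hf => (h6 f hf).symm⟩
        rwa [eval_restrictLine hcd]
    · exact ⟨∅, finite_empty, by simp, by simp, fun j hj => by omega⟩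
  refine ⟨G i ∪ (W₁ ∪ W₂), hGf.union (h1f.union h2f), ?_, ?_, ?_⟩
  · rintro f (hf | hf | hf)
    exacts [hGd f hf, h1d f hf, h2d f hf]
  · refine hA.step (hGf.union (h1f.union h2f)) ?_ subset_union_left ?_ ?_
    · rintro f (hf | hf | hf)
      exacts [hGd f hf, h1d f hf, h2d f hf]
    · exact fun j hj x x' h => h2 j hj x x' (h.mono fun f hf => Or.inr (Or.inr hf))
    · intro x x' h ξ hξ hξc
      obtain ⟨ξ', h3, h4⟩ := h1 x x' (h.mono fun f hf => Or.inr (Or.inl hf)) ξ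
        ⟨hξ, (hcrit ξ).mp hξc⟩
      exact ⟨ξ', h3.1, (hcrit ξ').mpr h3.2, fun f hf => (h4 f hf).symm⟩
  · rintro f (hf | hf | hf)
    · exact le_max_of_le_left (hg f hf)
    · exact le_max_of_le_right (le_max_of_le_left (h1b f hf))
    · exact le_max_of_le_right (le_max_of_le_right (h2b f hf))

end Families

section Numerics

theorem card_fiberIdx (m i n : ℕ) : Fintype.card (FiberIdx m i n) = n ^ (m - i) := by
  rw [Fintype.card_fun, Fintype.card_fin]
  congr 1
  rw [Fintype.card_subtype]
  have h := Fin.card_filter_val_lt (n := m) (m := i)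
  have h2 := Finset.card_filter_add_card_filter_not (s := (Finset.univ : Finset (Fin m)))
    (fun l => (l : ℕ) < i)
  simp only [not_lt, Finset.card_univ, Fintype.card_fin] at h2
  omega

/-- The exponent of a power of two exceeding the number of points of a fibre. -/
def signExp (m n s : ℕ) : ℕ := if s = 0 then 1 else 2 * (m * n)

/-- A bound for the degrees of the polynomials determining the signs of the labels. -/
def labelBound (m n s : ℕ) : ℕ :=
  n ^ s * (signExp m n s * (2 * (3 * (m * n) * n ^ s)) + 2 * (m * n))

/-- A bound for the degrees of the elements of an adapted family. -/
def familyBound (m n s : ℕ) : ℕ := 8 * m * (1000 * m ^ 3) ^ s * n ^ (s + 1) ^ 2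

theorem two_mul_pow_le_signExp {m n s : ℕ} (hm : m ≠ 0) (hn : n ≠ 0) (hs : s ≤ m) :
    2 * n ^ s ≤ 2 ^ signExp m n s := by
  unfold signExp
  split_ifs with h
  · simp [h]
  have h1 : n ^ s ≤ 2 ^ (m * n) := by
    calc n ^ s ≤ n ^ m := Nat.pow_le_pow_right (Nat.pos_of_ne_zero hn) hs
      _ ≤ (2 ^ n) ^ m := Nat.pow_le_pow_left Nat.lt_two_pow_self.le m
      _ = 2 ^ (m * n) := by rw [← pow_mul, mul_comm]
  have h2 : 2 ≤ 2 ^ (m * n) := Nat.le_self_pow (mul_ne_zero hm hn) 2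
  calc 2 * n ^ s ≤ 2 ^ (m * n) * 2 ^ (m * n) := Nat.mul_le_mul h2 h1
    _ = 2 ^ (2 * (m * n)) := by rw [← pow_add, two_mul]

theorem labelBound_le {m n : ℕ} (hm : m ≠ 0) (hn : n ≠ 0) (s : ℕ) :
    labelBound m n s ≤ 18 * m ^ 2 * n ^ (2 * s + 2) := by
  have hm1 : 1 ≤ m := Nat.one_le_iff_ne_zero.mpr hm
  have hn1 : 1 ≤ n := Nat.one_le_iff_ne_zero.mpr hn
  have hmn : 1 ≤ m * n := Nat.one_le_iff_ne_zero.mpr (mul_ne_zero hm hn)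
  have hN : 1 ≤ n ^ s := Nat.one_le_pow _ _ hn1
  have hL : signExp m n s ≤ 2 * (m * n) := by
    unfold signExp
    split_ifs <;> omega
  calc labelBound m n s ≤ n ^ s * (2 * (m * n) * (2 * (3 * (m * n) * n ^ s)) +
        2 * ((m * n) * ((m * n) * n ^ s))) := by
        unfold labelBound
        refine Nat.mul_le_mul_left _ (add_le_add (Nat.mul_le_mul_right _ hL) ?_)
        exact Nat.mul_le_mul_left _ (Nat.le_mul_of_pos_right _ (Nat.mul_pos hmn hN))
    _ = 14 * m ^ 2 * n ^ (2 * s + 2) := by ring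
    _ ≤ _ := by gcongr; norm_num

theorem two_mul_labelBound_le {m n s : ℕ} (hm : m ≠ 0) (hn : n ≠ 0) (hs : s + 1 ≤ m) :
    2 * labelBound m n s ≤ 2 ^ (10 * (m * n)) := by
  have hm1 : 1 ≤ m := Nat.one_le_iff_ne_zero.mpr hm
  have hn1 : 1 ≤ n := Nat.one_le_iff_ne_zero.mpr hn
  have hmn : m ≤ m * n := Nat.le_mul_of_pos_right _ hn1
  have h1 : m ≤ 2 ^ (m * n) := Nat.lt_two_pow_self.le.trans (Nat.pow_le_pow_right two_pos hmn)
  have h2 : n ^ (s + 1) ≤ 2 ^ (m * n) := by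
    calc n ^ (s + 1) ≤ n ^ m := Nat.pow_le_pow_right hn1 hs
      _ ≤ (2 ^ n) ^ m := Nat.pow_le_pow_left Nat.lt_two_pow_self.le m
      _ = 2 ^ (m * n) := by rw [← pow_mul, mul_comm]
  have h3 : 2 ^ 6 ≤ (2 ^ (m * n)) ^ 6 :=
    Nat.pow_le_pow_left (Nat.le_self_pow (by omega) 2) 6
  calc 2 * labelBound m n s ≤ 2 * (18 * m ^ 2 * n ^ (2 * s + 2)) :=
        Nat.mul_le_mul_left _ (labelBound_le hm hn s)
    _ = 36 * m ^ 2 * (n ^ (s + 1)) ^ 2 := by ring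
    _ ≤ (2 ^ (m * n)) ^ 6 * (2 ^ (m * n)) ^ 2 * (2 ^ (m * n)) ^ 2 := by
        gcongr
        exact le_trans (by norm_num) h3
    _ = 2 ^ (10 * (m * n)) := by rw [← pow_add, ← pow_add, ← pow_mul, mul_comm]

theorem familyBound_step {m n : ℕ} (hm : m ≠ 0) (hn : n ≠ 0) (s : ℕ) :
    max (labelBound m n (s + 1)) (max
      (n ^ (s + 1) * (2 * (m * n) * (2 * (familyBound m n s + 3 * (m * n) * n ^ (s + 1))) +
        2 * (m * n)))
      (labelBound m n s * (1 + 2 * (10 * (m * n) * familyBound m n s)) +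
        (2 * (10 * (m * n) * familyBound m n s) + 2 * labelBound m n s) * labelBound m n s)) ≤
      familyBound m n (s + 1) := by
  have hm1 : 1 ≤ m := Nat.one_le_iff_ne_zero.mpr hm
  have hn1 : 1 ≤ n := Nat.one_le_iff_ne_zero.mpr hn
  obtain ⟨k, hk⟩ : ∃ k, k = (1000 * m ^ 3) ^ s := ⟨_, rfl⟩
  have hk1 : 1 ≤ k := hk ▸ Nat.one_le_pow _ _ (by positivity)
  obtain ⟨E, hE⟩ : ∃ E, E = n ^ (s + 2) ^ 2 := ⟨_, rfl⟩
  have hpow {e : ℕ} (he : e ≤ (s + 2) ^ 2) : n ^ e ≤ E := hE ▸ Nat.pow_le_pow_right hn1 he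
  have hB : familyBound m n s = 8 * m * k * n ^ (s + 1) ^ 2 := by rw [familyBound, hk]
  have hB' : familyBound m n (s + 1) = 8000 * (m ^ 4 * k * E) := by
    rw [familyBound, pow_succ, ← hk, show s + 1 + 1 = s + 2 by ring, ← hE]; ring
  have hlow {c : ℕ} (r : ℕ) (hr : r ≤ 4) : c * m ^ r * E ≤ c * (m ^ 4 * k * E) := by
    rw [mul_assoc]
    refine Nat.mul_le_mul_left c (Nat.mul_le_mul_right E ?_)
    exact (Nat.pow_le_pow_right hm1 hr).trans (Nat.le_mul_of_pos_right _ hk1)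
  have hlow' {c : ℕ} (r : ℕ) (hr : r ≤ 4) : c * m ^ r * k * E ≤ c * (m ^ 4 * k * E) := by
    rw [mul_assoc, mul_assoc, mul_assoc (m ^ 4)]
    exact Nat.mul_le_mul_left c (Nat.mul_le_mul_right _ (Nat.pow_le_pow_right hm1 hr))
  have hl := labelBound_le hm hn s
  rw [hB, hB']
  refine max_le ?_ (max_le ?_ ?_)
  · calc labelBound m n (s + 1) ≤ 18 * m ^ 2 * n ^ (2 * (s + 1) + 2) := labelBound_le hm hn _
      _ ≤ 18 * m ^ 2 * E := by gcongr; exact hpow (by nlinarith)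
      _ ≤ 18 * (m ^ 4 * k * E) := hlow 2 (by norm_num)
      _ ≤ _ := by gcongr; norm_num
  · calc _ = 32 * m ^ 2 * k * n ^ ((s + 1) ^ 2 + s + 2) + 12 * m ^ 2 * n ^ (2 * s + 4) +
          2 * m ^ 1 * n ^ (s + 2) := by ring
      _ ≤ 32 * m ^ 2 * k * E + 12 * m ^ 2 * E + 2 * m ^ 1 * E := by
          gcongr <;> exact hpow (by nlinarith)
      _ ≤ 32 * (m ^ 4 * k * E) + 12 * (m ^ 4 * k * E) + 2 * (m ^ 4 * k * E) := by
          exact add_le_add (add_le_add (hlow' 2 (by norm_num)) (hlow 2 (by norm_num)))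
            (hlow 1 (by norm_num))
      _ ≤ _ := by omega
  · calc _ ≤ 18 * m ^ 2 * n ^ (2 * s + 2) * (1 + 2 * (10 * (m * n) *
            (8 * m * k * n ^ (s + 1) ^ 2))) + (2 * (10 * (m * n) * (8 * m * k * n ^ (s + 1) ^ 2)) +
            2 * (18 * m ^ 2 * n ^ (2 * s + 2))) * (18 * m ^ 2 * n ^ (2 * s + 2)) := by gcongr
      _ = 18 * m ^ 2 * n ^ (2 * s + 2) + 5760 * m ^ 4 * k * n ^ ((s + 1) ^ 2 + 2 * s + 3) +
            648 * m ^ 4 * n ^ (4 * s + 4) := by ring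
      _ ≤ 18 * m ^ 2 * E + 5760 * m ^ 4 * k * E + 648 * m ^ 4 * E := by
          gcongr <;> exact hpow (by nlinarith)
      _ ≤ 18 * (m ^ 4 * k * E) + 5760 * (m ^ 4 * k * E) + 648 * (m ^ 4 * k * E) := by
          exact add_le_add (add_le_add (hlow 2 (by norm_num)) (hlow' 4 (by norm_num)))
            (hlow 4 (by norm_num))
      _ ≤ _ := by omega

end Numerics

section Construction

variable {m : ℕ}

/-- The properties of the labels `Lab` and of the family `G` at the level `i`. -/
structure IsLevel (P : MvPolynomial (Fin m) ℝ) (i b g : ℕ) (Lab G : Set (MvPolynomial (Fin m) ℝ)) :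
    Prop where
  degree_lab : ∀ f ∈ Lab, f.totalDegree ≤ b
  degree_G : ∀ f ∈ G, f.totalDegree ≤ g
  relaxed_unique : ∀ ξ η η', IsCrit P i η → IsCrit P i η' → Agr i η η' → Relaxed Lab ξ η →
    Relaxed Lab ξ η' → η = η'
  exists_simple : ∀ ξ, IsCrit P i ξ → ∀ l : Fin m, i ≤ (l : ℕ) → ∃ f ∈ Lab, eval ξ f = 0 ∧
    eval ξ (pderiv l f) ≠ 0 ∧ ∀ l' : Fin m, i ≤ (l' : ℕ) → l' ≠ l → eval ξ (pderiv l' f) = 0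
  exists_label : ∀ x x', SameSign G x x' → ∀ ξ, Agr i x ξ → IsCrit P i ξ →
    ∃ ξ', Agr i x' ξ' ∧ IsCrit P i ξ' ∧ SameSign Lab ξ ξ'

theorem exists_isLevel {i n : ℕ} (hm : m ≠ 0) (hn : n ≠ 0)
    {P : MvPolynomial (Fin m) ℝ} (hP : P.totalDegree ≤ n + 1) {p : Fin m → MvPolynomial (Fin m) ℝ}
    (hp : ∀ l : Fin m, i ≤ (l : ℕ) → p l - X l ^ n ∈ degreeLT (Fin m) n)
    (hcrit : ∀ ξ, IsCrit P i ξ ↔ ∀ l : Fin m, i ≤ (l : ℕ) → eval ξ (p l) = 0) :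
    ∃ Lab G : Set (MvPolynomial (Fin m) ℝ), Lab.Finite ∧ G.Finite ∧ P ∈ Lab ∧
      (∀ c ∈ G, Dep i c) ∧ (∀ j : Fin m, (j : ℕ) + 1 = i → ∀ c ∈ G, pderiv j c ∈ G) ∧
      IsLevel P i (3 * (m * n) * n ^ (m - i)) (labelBound m n (m - i)) Lab G := by
  obtain ⟨Lab, hLf, hPL, hLb, huniq, hsimple⟩ := exists_labels hn hp hcrit
  rw [card_fiberIdx] at hLb
  have hLb' : ∀ f ∈ Lab, f.totalDegree ≤ 3 * (m * n) * n ^ (m - i) := by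
    intro f hf
    refine (hLb f hf).trans (max_le (hP.trans ?_) ?_)
    · have hN : 1 ≤ n ^ (m - i) := Nat.one_le_pow _ _ (Nat.pos_of_ne_zero hn)
      have h1 : 1 * n ≤ m * n := Nat.mul_le_mul_right _ (Nat.pos_of_ne_zero hm)
      have h2 : 3 * (m * n) * 1 ≤ 3 * (m * n) * n ^ (m - i) := Nat.mul_le_mul_left _ hN
      omega
    · have hmn : 1 ≤ m * n := Nat.pos_of_ne_zero (mul_ne_zero hm hn)
      calc n ^ (m - i) * (1 + m * n) + n ^ (m - i) = (2 + m * n) * n ^ (m - i) := by ring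
        _ ≤ 3 * (m * n) * n ^ (m - i) := Nat.mul_le_mul_right _ (by omega)
  obtain ⟨G, hGf, hGb, hGd, hGc, hG⟩ := exists_label_family (L := signExp m n (m - i)) hn hp hcrit
    hLf hLb' (by rw [card_fiberIdx]; exact two_mul_pow_le_signExp hm hn (Nat.sub_le _ _))
  refine ⟨Lab, G, hLf, hGf, hPL, hGd, hGc, hLb', ?_, huniq, hsimple, hG⟩
  rwa [card_fiberIdx] at hGb

theorem exists_isAdapted {a n : ℕ} (ham : a < m) (hn : n ≠ 0)
    {P : MvPolynomial (Fin m) ℝ} (hP : P.totalDegree ≤ n + 1) {p : Fin m → MvPolynomial (Fin m) ℝ}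
    (hp : ∀ l : Fin m, a ≤ (l : ℕ) → p l - X l ^ n ∈ degreeLT (Fin m) n)
    (hcrit : ∀ i, a ≤ i → ∀ ξ, IsCrit P i ξ ↔ ∀ l : Fin m, i ≤ (l : ℕ) → eval ξ (p l) = 0) :
    ∃ Lab G A, IsAdapted P a Lab G A ∧ A.Finite ∧
      ∀ f ∈ A, Dep a f ∨ f.totalDegree ≤ familyBound m n (m - a - 1) := by
  have hm : m ≠ 0 := by omega
  have hlevel (i : ℕ) : ∃ Lab G : Set (MvPolynomial (Fin m) ℝ), Lab.Finite ∧ G.Finite ∧ P ∈ Lab ∧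
      (∀ c ∈ G, Dep i c) ∧ (∀ j : Fin m, (j : ℕ) + 1 = i → ∀ c ∈ G, pderiv j c ∈ G) ∧
      (m < i → G = ∅) ∧ (a ≤ i → i ≤ m →
        IsLevel P i (3 * (m * n) * n ^ (m - i)) (labelBound m n (m - i)) Lab G) := by
    by_cases hi : a ≤ i ∧ i ≤ m
    · obtain ⟨Lab, G, h1, h2, h3, h4, h5, h6⟩ := exists_isLevel hm hn hP
        (fun l hl => hp l (hi.1.trans hl)) (hcrit i hi.1)
      exact ⟨Lab, G, h1, h2, h3, h4, h5, fun h => by omega, fun _ _ => h6⟩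
    · exact ⟨{P}, ∅, finite_singleton _, finite_empty, rfl, by simp, by simp, fun _ => rfl,
        fun h1 h2 => absurd ⟨h1, h2⟩ hi⟩
  choose Lab G hLf hGf hPL hGd hGc hG0 hLG using hlevel
  have hstep (i : ℕ) (hai : a ≤ i) {A : Set (MvPolynomial (Fin m) ℝ)}
      (hA : IsAdaptedFrom P Lab G (i + 1) A) {b b' g g' L L' : ℕ} :=
    hA.exists_step (b := b) (b' := b') (g := g) (g' := g') (L := L) (L' := L')
      hn (fun l hl => hp l (hai.trans hl)) (hcrit i hai)
      (hLf i) (hGf i) (hGd i) (hGf (i + 1)) (hGd (i + 1))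
  simp only [card_fiberIdx] at hstep
  have hfam (s : ℕ) (hs : a + s ≤ m) : ∃ A, IsAdaptedFrom P Lab G (m - s) A ∧
      ∀ f ∈ A, f.totalDegree ≤ familyBound m n s := by
    induction s with
    | zero =>
      have hl := hLG m ham.le le_rfl
      rw [Nat.sub_self] at hl
      obtain ⟨W, -, -, hW, hWb⟩ := hstep m ham.le (isAdaptedFrom_empty P Lab G)
        (b := 3 * (m * n) * n ^ 0) (b' := 0) (g := labelBound m n 0) (g' := 0) (L := 1) (L' := 0)
        (fun f hf => hl.degree_lab f (by simpa using hf)) (by simp) hl.degree_G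
        (by simp [hG0 (m + 1)]) (by simp) (by simp)
      refine ⟨_, hW, fun f hf => (hWb f (by simpa using hf)).trans ?_⟩
      simp only [Nat.sub_self, labelBound, familyBound, signExp]
      refine max_le (le_of_eq ?_) (max_le (le_of_eq ?_) ?_)
      · simp; ring
      · simp; ring
      · simp
    | succ s ih =>
      obtain ⟨A, hA, hAb⟩ := ih (by omega)
      have hi : m - s = m - (s + 1) + 1 := by omega
      rw [hi] at hA
      have hl := hLG (m - (s + 1)) (by omega) (Nat.sub_le _ _)
      have hl' := hLG (m - (s + 1) + 1) (by omega) (by omega)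
      rw [show m - (m - (s + 1)) = s + 1 by omega] at hl
      rw [show m - (m - (s + 1) + 1) = s by omega] at hl'
      obtain ⟨W, -, -, hW, hWb⟩ := hstep (m - (s + 1)) (by omega) hA
        (b := familyBound m n s + 3 * (m * n) * n ^ (s + 1)) (b' := familyBound m n s)
        (g := labelBound m n (s + 1)) (g' := labelBound m n s) (L := 2 * (m * n))
        (L' := 10 * (m * n))
        (fun f hf => hf.elim (fun h => (hAb f h).trans (Nat.le_add_right _ _))
          fun h => (hl.degree_lab f h).trans (Nat.le_add_left _ _))
        hAb hl.degree_G hl'.degree_G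
        (by
          rw [show m - (m - (s + 1)) = s + 1 by omega]
          exact two_mul_pow_le_signExp (s := s + 1) hm hn (by omega))
        (two_mul_labelBound_le hm hn (by omega))
      rw [show m - (m - (s + 1)) = s + 1 by omega] at hWb
      have hmono : familyBound m n s ≤ familyBound m n (s + 1) := by
        unfold familyBound
        have h1 : 0 < 1000 * m ^ 3 := by have := Nat.pos_of_ne_zero hm; positivity
        gcongr <;> omega
      exact ⟨_, hW, fun f hf => hf.elim (fun h => (hAb f h).trans hmono)
        fun h => (hWb f h).trans (familyBound_step hm hn s)⟩
  obtain ⟨A, hA, hAb⟩ := hfam (m - a - 1) (by omega)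
  rw [show m - (m - a - 1) = a + 1 by omega] at hA
  have hl := hLG a le_rfl ham.le
  have hl' := hLG (a + 1) (by omega) ham
  obtain ⟨W, -, hWd, hW, -⟩ := hstep a le_rfl hA
    (b := familyBound m n (m - a - 1) + 3 * (m * n) * n ^ (m - a))
    (b' := familyBound m n (m - a - 1)) (L := 2 * n ^ (m - a))
    (L' := 2 * labelBound m n (m - (a + 1)))
    (fun f hf => hf.elim (fun h => (hAb f h).trans (Nat.le_add_right _ _))
      fun h => (hl.degree_lab f h).trans (Nat.le_add_left _ _))
    hAb hl.degree_G hl'.degree_G Nat.lt_two_pow_self.le Nat.lt_two_pow_self.le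
  refine ⟨Lab, G, A ∪ W, ?_, hW.finite, fun f hf => hf.elim (fun h => Or.inr (hAb f h))
    fun h => Or.inl (hWd f h)⟩
  exact {
    finite_lab := hLf
    finite_G := hGf
    dep := hGd
    pderiv_mem := fun j c hc => hGc _ j rfl c hc
    G_subset := hW.G_subset
    self_mem := hPL
    relaxed_unique := fun i h1 h2 => (hLG i h1 h2).relaxed_unique
    exists_simple := fun i h1 h2 => (hLG i h1 h2).exists_simple
    exists_root := hW.exists_root
    exists_crit := hW.exists_crit
    exists_label := fun i h1 h2 => (hLG i h1 h2).exists_label }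

end Construction

/-! ### The perturbed polynomial -/

section Perturbed

open Filter Topology

/-- The two-parameter family `κ Q² + ∑ X_l ^ (2d+2) - R` of functions on `ℝ^k`, as a polynomial
in which the parameters `κ` and `R` are the first two variables. -/
noncomputable def perturbed {k : ℕ} (Q : MvPolynomial (Fin k) ℝ) (d : ℕ) :
    MvPolynomial (Fin (k + 2)) ℝ :=
  X 0 * rename (fun l : Fin k => l.succ.succ) Q ^ 2 +
    ∑ l : Fin k, X l.succ.succ ^ (2 * d + 2) - X 1

/-- The point of `ℝ^(k+2)` with parameters `κ`, `R` and remaining coordinates `x`. -/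
def parameterPoint {k : ℕ} (κ R : ℝ) (x : Fin k → ℝ) : Fin (k + 2) → ℝ :=
  Fin.cons κ (Fin.cons R x)

variable {k d : ℕ} {Q : MvPolynomial (Fin k) ℝ}

theorem eval_perturbed (w : Fin (k + 2) → ℝ) :
    eval w (perturbed Q d) = w 0 * eval (fun l : Fin k => w l.succ.succ) Q ^ 2 +
      ∑ l : Fin k, w l.succ.succ ^ (2 * d + 2) - w 1 := by
  simp only [perturbed, map_sub, map_add, map_mul, map_pow, map_sum, eval_X, eval_rename]
  rfl

theorem rename_sq_mem_degreeLT (hQ : Q.totalDegree ≤ d) :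
    rename (fun l : Fin k => l.succ.succ) Q ^ 2 ∈ degreeLT (Fin (k + 2)) (2 * d + 1) := by
  rw [mem_degreeLT_succ]
  refine (totalDegree_pow _ _).trans (Nat.mul_le_mul_left 2 ?_)
  exact (totalDegree_rename_le _ _).trans hQ

theorem totalDegree_perturbed_le (hQ : Q.totalDegree ≤ d) :
    (perturbed Q d).totalDegree ≤ 2 * d + 2 := by
  rw [← mem_degreeLT_succ]
  refine sub_mem (add_mem ?_ (sum_mem fun l _ => ?_)) ?_
  · have h1 : (X 0 : MvPolynomial (Fin (k + 2)) ℝ) ∈ degreeLT (Fin (k + 2)) (1 + 1) :=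
      mem_degreeLT_succ.2 (by simp)
    have h := mul_mem_degreeLT h1 (rename_sq_mem_degreeLT hQ)
    exact degreeLT_mono (by omega) h
  · exact mem_degreeLT_succ.2 (totalDegree_X_pow _ _).le
  · exact mem_degreeLT_succ.2 (by simp)

theorem pderiv_perturbed (j : Fin k) :
    pderiv j.succ.succ (perturbed Q d) =
      X 0 * pderiv j.succ.succ (rename (fun l : Fin k => l.succ.succ) Q ^ 2) +
        C ((2 * d + 2 : ℕ) : ℝ) * X j.succ.succ ^ (2 * d + 1) := by
  have h0 : pderiv j.succ.succ (X 0 : MvPolynomial (Fin (k + 2)) ℝ) = 0 :=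
    pderiv_X_of_ne (Fin.succ_ne_zero _).symm
  have h1 : pderiv j.succ.succ (X 1 : MvPolynomial (Fin (k + 2)) ℝ) = 0 :=
    pderiv_X_of_ne fun h => absurd (congrArg Fin.val h) (by simp)
  have h2 : pderiv j.succ.succ (X j.succ.succ ^ (2 * d + 2) : MvPolynomial (Fin (k + 2)) ℝ) =
      C ((2 * d + 2 : ℕ) : ℝ) * X j.succ.succ ^ (2 * d + 1) := by
    rw [pderiv_pow, pderiv_X_self, map_natCast]
    simp
  rw [perturbed, map_sub, map_add, map_sum, Derivation.leibniz, h0, h1,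
    Finset.sum_eq_single j _ (by simp), h2]
  · simp
  · intro l _ hl
    rw [pderiv_pow, pderiv_X_of_ne (by simpa using hl)]
    simp

theorem perturbed_monic (hQ : Q.totalDegree ≤ d) (hd : d ≠ 0) (l : Fin (k + 2))
    (hl : 2 ≤ (l : ℕ)) :
    C (((2 * d + 2 : ℕ) : ℝ)⁻¹) * pderiv l (perturbed Q d) - X l ^ (2 * d + 1) ∈
      degreeLT (Fin (k + 2)) (2 * d + 1) := by
  obtain ⟨j, rfl⟩ : ∃ j : Fin k, l = j.succ.succ :=
    ⟨⟨l - 2, by omega⟩, Fin.ext (by simp; omega)⟩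
  rw [pderiv_perturbed, mul_add, ← mul_assoc (C _) (C _), ← C_mul, inv_mul_cancel₀ (by positivity),
    C_1, one_mul, add_sub_cancel_right, ← mul_assoc]
  have h1 : (C (((2 * d + 2 : ℕ) : ℝ)⁻¹) * X 0 : MvPolynomial (Fin (k + 2)) ℝ) ∈
      degreeLT (Fin (k + 2)) (1 + 1) :=
    mem_degreeLT_succ.2 ((totalDegree_mul _ _).trans (by simp))
  have h2 := totalDegree_pderiv_le j.succ.succ (rename_sq_mem_degreeLT hQ)
  obtain ⟨e, rfl⟩ := Nat.exists_eq_succ_of_ne_zero hd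
  exact degreeLT_mono (by omega) (mul_mem_degreeLT (b := 2 * e + 1) h1 h2)

theorem isCrit_perturbed (i : ℕ) (ξ : Fin (k + 2) → ℝ) :
    IsCrit (perturbed Q d) i ξ ↔ ∀ l : Fin (k + 2), i ≤ (l : ℕ) →
      eval ξ (C (((2 * d + 2 : ℕ) : ℝ)⁻¹) * pderiv l (perturbed Q d)) = 0 := by
  have h : ((2 * d + 2 : ℕ) : ℝ)⁻¹ ≠ 0 := by positivity
  simp only [IsCrit, map_mul, eval_C, mul_eq_zero, h, false_or]

theorem exists_isAdapted_perturbed (hk : k ≠ 0) (hd : d ≠ 0) (hQ : Q.totalDegree ≤ d) :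
    ∃ Lab G A, IsAdapted (perturbed Q d) 2 Lab G A ∧ A.Finite ∧
      ∀ f ∈ A, Dep 2 f ∨ f.totalDegree ≤ familyBound (k + 2) (2 * d + 1) (k - 1) := by
  have h := exists_isAdapted (a := 2) (n := 2 * d + 1) (by omega) (by omega)
    (totalDegree_perturbed_le hQ) (fun l hl => perturbed_monic hQ hd l hl)
    fun i _ ξ => isCrit_perturbed i ξ
  rwa [show k + 2 - 2 - 1 = k - 1 by omega] at h

theorem abs_le_of_pow_le {t M : ℝ} (h : t ^ (2 * d + 2) ≤ M) : |t| ≤ 1 + |M| := by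
  rcases le_total |t| 1 with h1 | h1
  · exact h1.trans (le_add_of_nonneg_right (abs_nonneg _))
  · have h2 : |t| ≤ |t| ^ (2 * d + 2) := le_self_pow₀ h1 (by omega)
    rw [Even.pow_abs ⟨d + 1, by ring⟩] at h2
    linarith [le_abs_self M]

theorem pow_le_of_eval_perturbed_nonpos {w : Fin (k + 2) → ℝ} (h0 : 0 ≤ w 0)
    (hw : eval w (perturbed Q d) ≤ 0) (l : Fin k) : w l.succ.succ ^ (2 * d + 2) ≤ w 1 := by
  rw [eval_perturbed] at hw
  have h1 := Finset.single_le_sum (f := fun l : Fin k => w l.succ.succ ^ (2 * d + 2))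
    (fun l _ => Even.pow_nonneg ⟨d + 1, by ring⟩ _) (Finset.mem_univ l)
  have h2 : 0 ≤ w 0 * eval (fun l : Fin k => w l.succ.succ) Q ^ 2 := by positivity
  linarith

theorem isCompact_sublevel_perturbed {o : Fin (k + 2) → ℝ} (ho : 0 ≤ o 0) :
    IsCompact (sublevel (perturbed Q d) 2 o) := by
  have hagr {w : Fin (k + 2) → ℝ} (hw : w ∈ sublevel (perturbed Q d) 2 o) :
      o 0 = w 0 ∧ o 1 = w 1 := ⟨hw.1 0 (by simp), hw.1 1 (by simp)⟩
  refine IsCompact.of_isClosed_subset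
    (isCompact_Icc (a := fun _ => -(1 + |o 0| + |o 1|)) (b := fun _ => 1 + |o 0| + |o 1|)) ?_ ?_
  · have h : sublevel (perturbed Q d) 2 o =
        (⋂ l : Fin (k + 2), ⋂ _ : (l : ℕ) < 2, {w | o l = w l}) ∩
          {w | eval w (perturbed Q d) ≤ 0} := by
      ext w
      simp [sublevel, Agr]
    rw [h]
    exact (isClosed_iInter fun l => isClosed_iInter fun _ =>
      isClosed_eq continuous_const (continuous_apply l)).inter
      (isClosed_le (continuous_eval _) continuous_const)
  · intro w hw
    suffices h : ∀ l, |w l| ≤ 1 + |o 0| + |o 1| from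
      ⟨fun l => (abs_le.1 (h l)).1, fun l => (abs_le.1 (h l)).2⟩
    obtain ⟨e0, e1⟩ := hagr hw
    have a0 := abs_nonneg (o 0)
    have a1 := abs_nonneg (o 1)
    refine Fin.cases ?_ (Fin.cases ?_ fun l => ?_)
    · rw [← e0]; linarith
    · rw [show (Fin.succ 0 : Fin (k + 2)) = 1 from rfl, ← e1]; linarith
    · have := abs_le_of_pow_le (pow_le_of_eval_perturbed_nonpos (e0 ▸ ho) hw.2 l)
      rw [← e1] at this
      linarith

end Perturbed

/-! ### Signs for large values of the parameters -/

section Eventually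

open Filter Topology

theorem eventually_sign_eval_eq_sign_leadingCoeff (p : Polynomial ℝ) :
    ∀ᶠ t in atTop, SignType.sign (p.eval t) = SignType.sign p.leadingCoeff := by
  rcases le_or_gt p.degree 0 with h | h
  · rw [Polynomial.eq_C_of_degree_le_zero h]
    simp
  have hp : p.leadingCoeff ≠ 0 := by
    rintro h0
    rw [Polynomial.leadingCoeff_eq_zero.1 h0, Polynomial.degree_zero] at h
    exact not_lt_bot h
  rcases hp.lt_or_gt with h0 | h0
  · filter_upwards [(p.tendsto_atBot_of_leadingCoeff_nonpos h h0.le).eventually_lt_atBot 0]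
      with t ht
    rw [sign_neg ht, sign_neg h0]
  · filter_upwards [(p.tendsto_atTop_of_leadingCoeff_nonneg h h0.le).eventually_gt_atTop 0]
      with t ht
    rw [sign_pos ht, sign_pos h0]

theorem eventually_sign_eval_eq {p q : Polynomial ℝ}
    (h : ∀ i, SignType.sign (p.coeff i) = SignType.sign (q.coeff i)) :
    ∀ᶠ t in atTop, SignType.sign (p.eval t) = SignType.sign (q.eval t) := by
  have hle {p q : Polynomial ℝ}
      (h : ∀ i, SignType.sign (p.coeff i) = SignType.sign (q.coeff i)) :
      p.natDegree ≤ q.natDegree := by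
    refine Polynomial.natDegree_le_iff_coeff_eq_zero.2 fun i hi => ?_
    rw [← sign_eq_zero_iff, h i, Polynomial.coeff_eq_zero_of_natDegree_lt hi, sign_zero]
  have hd := le_antisymm (hle h) (hle fun i => (h i).symm)
  filter_upwards [eventually_sign_eval_eq_sign_leadingCoeff p,
    eventually_sign_eval_eq_sign_leadingCoeff q] with t hp hq
  rw [hp, hq, Polynomial.leadingCoeff, Polynomial.leadingCoeff, ← hd, h]

/-- The coefficients of the members of `A`, seen as polynomials in the first variable. -/
def coeffFamily {n : ℕ} (A : Set (MvPolynomial (Fin (n + 1)) ℝ)) :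
    Set (MvPolynomial (Fin n) ℝ) :=
  ⋃ f ∈ A, (finSuccEquiv ℝ n f).coeff '' (finSuccEquiv ℝ n f).support

variable {n : ℕ} {A : Set (MvPolynomial (Fin (n + 1)) ℝ)}

theorem Set.Finite.coeffFamily (hA : A.Finite) : (coeffFamily A).Finite :=
  hA.biUnion fun _ _ => (Finset.finite_toSet _).image _

theorem totalDegree_le_of_mem_coeffFamily {B : ℕ} (hA : ∀ f ∈ A, f.totalDegree ≤ B)
    {g : MvPolynomial (Fin n) ℝ} (hg : g ∈ coeffFamily A) : g.totalDegree ≤ B := by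
  simp only [coeffFamily, mem_iUnion] at hg
  obtain ⟨f, hf, i, hi, rfl⟩ := hg
  have := totalDegree_coeff_finSuccEquiv_add_le f i (Polynomial.mem_support_iff.1 hi)
  have := hA f hf
  omega

theorem SameSign.eventually_cons (hA : A.Finite) {x y : Fin n → ℝ}
    (h : SameSign (coeffFamily A) x y) :
    ∀ᶠ t : ℝ in atTop, SameSign A (Fin.cons t x) (Fin.cons t y) := by
  refine (eventually_all_finite hA).2 fun f hf => ?_
  simp only [eval_eq_eval_mv_eval']
  refine eventually_sign_eval_eq fun i => ?_
  rw [Polynomial.coeff_map, Polynomial.coeff_map]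
  by_cases hi : i ∈ (finSuccEquiv ℝ n f).support
  · exact h _ (mem_biUnion hf ⟨i, hi, rfl⟩)
  · rw [Polynomial.notMem_support_iff.1 hi, map_zero (eval x), map_zero (eval y)]

end Eventually

/-! ### Connecting points of the zero set with the same signs -/

section Connection

open Filter Topology

variable {k d : ℕ} {Q : MvPolynomial (Fin k) ℝ}

theorem parameterPoint_mem_sublevel {κ R : ℝ} {x : Fin k → ℝ} (hx : eval x Q = 0)
    (hR : ∑ l, x l ^ (2 * d + 2) ≤ R) {o : Fin (k + 2) → ℝ}
    (ho : Agr 2 o (parameterPoint κ R x)) :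
    parameterPoint κ R x ∈ sublevel (perturbed Q d) 2 o := by
  refine ⟨ho, ?_⟩
  rw [eval_perturbed]
  have h : (fun l : Fin k => parameterPoint κ R x l.succ.succ) = x := rfl
  rw [h, hx]
  change κ * 0 ^ 2 + ∑ l, x l ^ (2 * d + 2) - R ≤ 0
  linarith

theorem agr_parameterPoint (κ R : ℝ) (x y : Fin k → ℝ) :
    Agr 2 (parameterPoint κ R x) (parameterPoint κ R y) := by
  refine Fin.cases (fun _ => rfl) (Fin.cases (fun _ => rfl) fun l hl => ?_)
  simp at hl

theorem exists_isPreconnected_of_transfers {A : Set (MvPolynomial (Fin (k + 2)) ℝ)}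
    (hA : ∀ o : Fin (k + 2) → ℝ, 0 ≤ o 0 → Transfers A (sublevel (perturbed Q d) 2 o) 2)
    {κ R : ℝ} (hκ : 0 ≤ κ) {x y : Fin k → ℝ} (hx : eval x Q = 0) (hy : eval y Q = 0)
    (hxR : ∑ l, x l ^ (2 * d + 2) ≤ R) (hyR : ∑ l, y l ^ (2 * d + 2) ≤ R)
    (hxy : SameSign A (parameterPoint κ R x) (parameterPoint κ R y)) :
    ∃ D : Set (Fin k → ℝ), IsPreconnected D ∧
      D ⊆ Icc (fun _ => -(1 + |R|)) (fun _ => 1 + |R|) ∧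
      (∀ z ∈ D, κ * eval z Q ^ 2 ≤ R) ∧ x ∈ D ∧ y ∈ D := by
  have hxT := parameterPoint_mem_sublevel hx hxR (agr_parameterPoint κ R x x)
  have hyT := parameterPoint_mem_sublevel hy hyR (agr_parameterPoint κ R x y)
  obtain ⟨D, hD, hDT, hDx, hxD, hyD⟩ := hA (parameterPoint κ R x) hκ _ _ _ _
    (Conn.refl 2 hxT) hxT hyT (agr_parameterPoint κ R x y) (SameSign.refl _ _) hxy
  have h01 {w : Fin (k + 2) → ℝ} (hw : w ∈ D) : w 0 = κ ∧ w 1 = R :=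
    ⟨(hDx w hw 0 (by simp)).symm, (hDx w hw 1 (by simp)).symm⟩
  refine ⟨(fun w l => w l.succ.succ) '' D, hD.image _ (by fun_prop), ?_, ?_,
    ⟨_, hxD, rfl⟩, ⟨_, hyD, rfl⟩⟩
  · rintro _ ⟨w, hw, rfl⟩
    obtain ⟨e0, e1⟩ := h01 hw
    have h (l : Fin k) : |w l.succ.succ| ≤ 1 + |R| :=
      abs_le_of_pow_le (e1 ▸ pow_le_of_eval_perturbed_nonpos (e0 ▸ hκ) (hDT hw).2 l)
    exact ⟨fun l => (abs_le.1 (h l)).1, fun l => (abs_le.1 (h l)).2⟩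
  · rintro _ ⟨w, hw, rfl⟩
    obtain ⟨e0, e1⟩ := h01 hw
    have h := (hDT hw).2
    rw [eval_perturbed, e0, e1] at h
    have h1 : 0 ≤ ∑ l : Fin k, w l.succ.succ ^ (2 * d + 2) :=
      Finset.sum_nonneg fun l _ => Even.pow_nonneg ⟨d + 1, by ring⟩ _
    linarith

theorem exists_isPreconnected_of_sameSign {A : Set (MvPolynomial (Fin (k + 2)) ℝ)}
    (hAf : A.Finite)
    (hA : ∀ o : Fin (k + 2) → ℝ, 0 ≤ o 0 → Transfers A (sublevel (perturbed Q d) 2 o) 2)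
    {x y : Fin k → ℝ} (hx : eval x Q = 0) (hy : eval y Q = 0)
    (hxy : SameSign (coeffFamily (coeffFamily {f | f ∈ A ∧ ¬ Dep 2 f})) x y) :
    ∃ S : Set (Fin k → ℝ), IsPreconnected S ∧ S ⊆ {z | eval z Q = 0} ∧ x ∈ S ∧ y ∈ S := by
  have hA' : {f | f ∈ A ∧ ¬ Dep 2 f}.Finite := hAf.subset fun f hf => hf.1
  obtain ⟨R, ⟨hxR, hyR⟩, hR⟩ := (((eventually_ge_atTop (∑ l, x l ^ (2 * d + 2))).and
    (eventually_ge_atTop (∑ l, y l ^ (2 * d + 2)))).and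
    (hxy.eventually_cons hA'.coeffFamily)).exists
  have hD : ∀ᶠ κ : ℝ in (Ultrafilter.of (atTop : Filter ℝ) : Filter ℝ), ∃ D : Set (Fin k → ℝ),
      IsPreconnected D ∧ D ⊆ Icc (fun _ => -(1 + |R|)) (fun _ => 1 + |R|) ∧
      (∀ z ∈ D, κ * eval z Q ^ 2 ≤ R) ∧ x ∈ D ∧ y ∈ D := by
    refine Filter.Eventually.filter_mono (Ultrafilter.of_le _) ?_
    filter_upwards [eventually_ge_atTop 0, hR.eventually_cons hA'] with κ hκ hs
    refine exists_isPreconnected_of_transfers hA hκ hx hy hxR hyR fun f hf => ?_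
    by_cases hdep : Dep 2 f
    · rw [hdep _ _ (agr_parameterPoint κ R x y)]
    · exact hs f (And.intro hf hdep)
  obtain ⟨D, hD⟩ := hD.choice
  refine ⟨_, isPreconnected_ultrafilter_limit (Ultrafilter.of atTop) isCompact_Icc
    (hD.mono fun κ h => ⟨h.1, h.2.1⟩), fun z hz => ?_, ?_, ?_⟩
  · by_contra hz0
    have hpos : 0 < eval z Q ^ 2 := (sq_nonneg _).lt_of_ne' (pow_ne_zero 2 hz0)
    have hW : {w : Fin k → ℝ | eval z Q ^ 2 / 2 < eval w Q ^ 2} ∈ 𝓝 z :=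
      (isOpen_lt continuous_const ((continuous_eval Q).pow 2)).mem_nhds (half_lt_self hpos)
    have hκ : ∀ᶠ κ : ℝ in (Ultrafilter.of (atTop : Filter ℝ) : Filter ℝ),
        max 0 (R / (eval z Q ^ 2 / 2)) < κ :=
      (eventually_gt_atTop _).filter_mono (Ultrafilter.of_le _)
    obtain ⟨κ, ⟨⟨w, hwD, hwW⟩, h⟩, hκ⟩ := ((hz _ hW).and hD |>.and hκ).exists
    have h1 := h.2.2.1 w hwD
    obtain ⟨hκ0, hκR⟩ := max_lt_iff.1 hκ
    rw [div_lt_iff₀ (by positivity)] at hκR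
    have h2 : κ * (eval z Q ^ 2 / 2) < κ * eval w Q ^ 2 := mul_lt_mul_of_pos_left hwW hκ0
    linarith
  · exact fun W hW => hD.mono fun κ h => ⟨x, h.2.2.2.1, mem_of_mem_nhds hW⟩
  · exact fun W hW => hD.mono fun κ h => ⟨y, h.2.2.2.2, mem_of_mem_nhds hW⟩

end Connection

theorem familyBound_le {k d : ℕ} (hk : k ≠ 0) (hd : d ≠ 0) :
    familyBound (k + 2) (2 * d + 1) (k - 1) ≤ (2000000 * d) ^ k ^ 2 := by
  obtain ⟨s, rfl⟩ := Nat.exists_eq_succ_of_ne_zero hk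
  have h3 : s + 1 + 2 ≤ 3 ^ (s + 1) := by
    induction s with
    | zero => norm_num
    | succ s ih => rw [pow_succ]; have := ih (by omega); omega
  have hs : s + 1 ≤ (s + 1) ^ 2 := Nat.le_self_pow two_ne_zero _
  have hm : s + 1 + 2 ≤ 3 ^ (s + 1) ^ 2 := h3.trans (Nat.pow_le_pow_right (by omega) hs)
  have h8 : 8 ≤ 8 ^ (s + 1) ^ 2 := Nat.le_self_pow (by positivity) _
  have hp : (1000 * (s + 1 + 2) ^ 3) ^ s ≤ 27000 ^ (s + 1) ^ 2 := calc
    (1000 * (s + 1 + 2) ^ 3) ^ s ≤ (1000 ^ (s + 1) * (3 ^ (s + 1)) ^ 3) ^ s := by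
      gcongr
      exact Nat.le_self_pow (by omega) _
    _ = 27000 ^ ((s + 1) * s) := by
      rw [← pow_mul, mul_comm (s + 1) 3, pow_mul, ← mul_pow, ← pow_mul]
      norm_num
    _ ≤ 27000 ^ (s + 1) ^ 2 := Nat.pow_le_pow_right (by omega) (by nlinarith)
  calc familyBound (s + 1 + 2) (2 * d + 1) (s + 1 - 1)
      = 8 * (s + 1 + 2) * (1000 * (s + 1 + 2) ^ 3) ^ s * (2 * d + 1) ^ (s + 1) ^ 2 := rfl
    _ ≤ 8 ^ (s + 1) ^ 2 * 3 ^ (s + 1) ^ 2 * 27000 ^ (s + 1) ^ 2 * (3 * d) ^ (s + 1) ^ 2 := by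
      gcongr
      omega
    _ = (1944000 * d) ^ (s + 1) ^ 2 := by
      rw [← mul_pow, ← mul_pow, ← mul_pow]
      ring_nf
    _ ≤ (2000000 * d) ^ (s + 1) ^ 2 := by gcongr; norm_num

theorem exists_finite_family {k d : ℕ} (hk : k ≠ 0) (hd : d ≠ 0) {Q : MvPolynomial (Fin k) ℝ}
    (hQ : Q.totalDegree ≤ d) :
    ∃ F : Set (MvPolynomial (Fin k) ℝ), F.Finite ∧
      (∀ f ∈ F, f.totalDegree ≤ (2000000 * d) ^ k ^ 2) ∧
      ∀ x y, eval x Q = 0 → eval y Q = 0 → SameSign F x y →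
        y ∈ connectedComponentIn {z : Fin k → ℝ | eval z Q = 0} x := by
  obtain ⟨Lab, G, A, hA, hAf, hAb⟩ := exists_isAdapted_perturbed hk hd hQ
  refine ⟨coeffFamily (coeffFamily {f | f ∈ A ∧ ¬ Dep 2 f}),
    (hAf.subset fun f hf => hf.1 : {f | f ∈ A ∧ ¬ Dep 2 f}.Finite).coeffFamily.coeffFamily,
    fun f hf => ?_, fun x y hx hy hxy => ?_⟩
  · refine totalDegree_le_of_mem_coeffFamily (fun g hg =>
      totalDegree_le_of_mem_coeffFamily (fun g hg => ?_) hg) hf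
    exact ((hAb g hg.1).resolve_left hg.2).trans (familyBound_le hk hd)
  · obtain ⟨S, hS, hSQ, hxS, hyS⟩ := exists_isPreconnected_of_sameSign hAf
      (fun o ho => hA.transfers (isCompact_sublevel_perturbed ho) le_rfl (by omega)) hx hy hxy
    exact hS.subset_connectedComponentIn hxS hSQ hyS

/-- There is a universal constant `c > 0` such that for every `k ≥ 1` and every polynomial
`Q ∈ ℝ[X_1,…,X_k]` of degree at most `d`, each connected component of the real algebraic set
`Z(Q,ℝ^k)` is a finite union of realizations of sign conditions on a finite family of
polynomials of degree at most `(c·d)^{k²}`. -/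
theorem connected_components_of_algebraic_set_description :
    ∃ c : ℕ, 0 < c ∧
      ∀ (k d : ℕ), 1 ≤ k →
      ∀ Q : MvPolynomial (Fin k) ℝ, Q.totalDegree ≤ d →
      ∀ x ∈ {y : Fin k → ℝ | eval y Q = 0},
        ∃ (n : ℕ) (A : Fin n → MvPolynomial (Fin k) ℝ)
          (Sgns : Set (Fin n → SignType)),
          (∀ i, (A i).totalDegree ≤ (c * d) ^ (k ^ 2)) ∧
          connectedComponentIn {y : Fin k → ℝ | eval y Q = 0} x =
            ⋃ σ ∈ Sgns, signRealization A σ := by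
  refine ⟨2000000, by norm_num, fun k d hk Q hQ x hx => ?_⟩
  rcases Nat.eq_zero_or_pos d with rfl | hd
  · have hZ : {y : Fin k → ℝ | eval y Q = 0} = univ := by
      rw [totalDegree_eq_zero_iff_eq_C.1 (Nat.le_zero.1 hQ)] at hx ⊢
      rw [mem_ofPred_eq, eval_C] at hx
      simp [hx]
    refine ⟨0, Fin.elim0, univ, fun i => i.elim0, ?_⟩
    rw [hZ, connectedComponentIn_univ, PreconnectedSpace.connectedComponent_eq_univ]
    refine (eq_univ_of_forall fun y => ?_).symm
    exact mem_biUnion (mem_univ Fin.elim0) fun i => i.elim0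
  obtain ⟨F, hF, hFb, hconn⟩ := exists_finite_family (by omega) hd.ne' hQ
  obtain ⟨n, A, hAF⟩ : ∃ (n : ℕ) (A : Fin n → MvPolynomial (Fin k) ℝ), range A = insert Q F := by
    obtain ⟨n, A, -, hA⟩ := (hF.insert Q).fin_param
    exact ⟨n, A, hA⟩
  refine ⟨n, A, (fun y i => SignType.sign (eval y (A i))) ''
    connectedComponentIn {y : Fin k → ℝ | eval y Q = 0} x, fun i => ?_, ?_⟩
  · rcases hAF ▸ mem_range_self i with h | h
    · rw [h]
      refine (hQ.trans (by omega : d ≤ 2000000 * d)).trans ?_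
      exact Nat.le_self_pow (pow_ne_zero 2 (by omega)) _
    · exact hFb _ h
  · refine Subset.antisymm (fun y hy => mem_biUnion ⟨y, hy, rfl⟩ fun i => rfl) ?_
    simp only [iUnion₂_subset_iff]
    rintro _ ⟨y, hy, rfl⟩ z hz
    have hsign : SameSign (insert Q F) y z := by
      intro f hf
      obtain ⟨i, rfl⟩ := hAF ▸ hf
      exact (hz i).symm
    have hy0 : y ∈ {y : Fin k → ℝ | eval y Q = 0} := connectedComponentIn_subset _ _ hy
    have hz0 : eval z Q = 0 := by
      rw [← sign_eq_zero_iff, ← hsign Q (mem_insert _ _), show eval y Q = 0 from hy0, sign_zero]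
    rw [connectedComponentIn_eq hy]
    exact hconn y z hy0 hz0 fun f hf => hsign f (mem_insert_of_mem _ hf)
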